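/- Let Γ be a simple closed curve in the real projective plane ℝP² whose preimage under the covering π : S² → ℝP² is a disjoint union of two simple closed curves. Then ℝP² \ Γ has exactly two connected components; one is homeomorphic to an open disk and the other is homeomorphic to an open Möbius strip, and both have Γ as their topological boundary. -/

import Mathlib

noncomputable section

/-- The unit 2-sphere in `ℝ³`. -/
abbrev Sphere2 : Set (EuclideanSpace ℝ (Fin 3)) := Metric.sphere 0 1

/-- The antipodal map on the 2-sphere. -/
def antipodal (x : Sphere2) : Sphere2 :=
  ⟨-x.1, by
    rw [mem_sphere_zero_iff_norm, norm_neg]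
    exact mem_sphere_zero_iff_norm.mp x.2⟩

/-- The real projective plane, as the quotient of the sphere by the antipodal map. -/
abbrev RealProjectivePlane : Type := Quot (fun x y : Sphere2 => y = antipodal x)

/-- The covering projection from the sphere to the projective plane. -/
def sphereProj : Sphere2 → RealProjectivePlane := Quot.mk _

/-- The unit circle in the plane. -/
abbrev Circle2 : Set (EuclideanSpace ℝ (Fin 2)) := Metric.sphere 0 1

/-- The open unit disk in the plane. -/
abbrev OpenDisk : Set (EuclideanSpace ℝ (Fin 2)) := Metric.ball 0 1

/-- An open annulus in the plane. -/
abbrev OpenAnnulus : Set (EuclideanSpace ℝ (Fin 2)) := {x | ‖x‖ ∈ Set.Ioo (1:ℝ) 2}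

/-- A set is a simple closed curve if it is homeomorphic to the circle. -/
def IsSimpleClosedCurve {X : Type*} [TopologicalSpace X] (C : Set X) : Prop :=
  Nonempty (C ≃ₜ Circle2)

/-- The strip `ℝ × (-1,1)`. -/
abbrev MobiusDom : Type := {p : ℝ × ℝ // p.2 ∈ Set.Ioo (-1:ℝ) 1}

/-- The generating relation `(x, y) ∼ (x + 1, -y)` for the open Möbius strip. -/
def mobiusRel (p q : MobiusDom) : Prop := q.1.1 = p.1.1 + 1 ∧ q.1.2 = -p.1.2

/-- The open Möbius strip: the quotient of `ℝ × (-1,1)` by `(x,y) ∼ (x+1,-y)`. -/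
abbrev OpenMobius : Type := Quot mobiusRel

/-- The generating relation `(x, y) ∼ (x + 2, y)` for the open cylinder. -/
def cylinderRel (p q : MobiusDom) : Prop := q.1.1 = p.1.1 + 2 ∧ q.1.2 = p.1.2

/-- The open cylinder: the quotient of `ℝ × (-1,1)` by `(x,y) ∼ (x+2,y)`. -/
abbrev OpenCylinder : Type := Quot cylinderRel

/-- The orientation double covering of the open Möbius strip by the open cylinder. -/
def mobiusCover : OpenCylinder → OpenMobius :=
  Quot.lift (fun p => Quot.mk mobiusRel p) (by
    rintro p q ⟨h1, h2⟩
    have hmid : (-p.1.2) ∈ Set.Ioo (-1:ℝ) 1 := by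
      obtain ⟨ha, hb⟩ := p.2; constructor <;> linarith
    have s1 : Quot.mk mobiusRel p = Quot.mk mobiusRel ⟨(p.1.1 + 1, -p.1.2), hmid⟩ :=
      Quot.sound ⟨rfl, rfl⟩
    have s2 : Quot.mk mobiusRel ⟨(p.1.1 + 1, -p.1.2), hmid⟩ = Quot.mk mobiusRel q := by
      apply Quot.sound
      constructor
      · simpa [h1] using by ring
      · simp [h2]
    exact s1.trans s2)

/-- The nontrivial deck transformation of the covering `mobiusCover`,
induced by `(x, y) ↦ (x + 1, -y)`. -/
def mobiusDeck : OpenCylinder → OpenCylinder :=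
  Quot.lift
    (fun p => Quot.mk cylinderRel
      ⟨(p.1.1 + 1, -p.1.2), by obtain ⟨ha, hb⟩ := p.2; constructor <;> dsimp <;> linarith⟩)
    (by
      rintro p q ⟨h1, h2⟩
      apply Quot.sound
      constructor
      · simpa [h1] using by ring
      · simp [h2])

/-- A 2-manifold (an open subset of a surface) is *orientable* if it contains no
homeomorphic copy of the open Möbius strip. -/
def Orientable (X : Type*) [TopologicalSpace X] : Prop :=
  ¬ ∃ A : Set X, Nonempty (A ≃ₜ OpenMobius)

end

namespace ProjSep

open Set Filter Topology Metric
open scoped ComplexConjugate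

/-- `f` has a continuous logarithm on `s`. -/
def HasLogOn {X : Type*} [TopologicalSpace X] (f : X → ℂ) (s : Set X) : Prop :=
  ∃ g : X → ℂ, ContinuousOn g s ∧ ∀ x ∈ s, Complex.exp (g x) = f x

/-- Every nonvanishing continuous function on `s` has a continuous logarithm. -/
def LogProp {X : Type*} [TopologicalSpace X] (s : Set X) : Prop :=
  ∀ f : X → ℂ, ContinuousOn f s → (∀ x ∈ s, f x ≠ 0) → HasLogOn f s

section Basic
variable {X Y : Type*} [TopologicalSpace X] [TopologicalSpace Y]

theorem two_pi_I_ne_zero : (2 * Real.pi * Complex.I : ℂ) ≠ 0 := Complex.two_pi_I_ne_zero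

theorem log_unique_of_preconnected {s : Set X} (hs : IsPreconnected s) {g₁ g₂ : X → ℂ}
    (h₁ : ContinuousOn g₁ s) (h₂ : ContinuousOn g₂ s)
    (h : ∀ x ∈ s, Complex.exp (g₁ x) = Complex.exp (g₂ x)) :
    ∃ k : ℤ, ∀ x ∈ s, g₁ x = g₂ x + k * (2 * Real.pi * Complex.I) := by
  rcases s.eq_empty_or_nonempty with rfl | ⟨a, ha⟩
  · exact ⟨0, by simp⟩
  have hk : ∀ x ∈ s, ∃ k : ℤ, g₁ x = g₂ x + k * (2 * Real.pi * Complex.I) :=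
    fun x hx => Complex.exp_eq_exp_iff_exists_int.1 (h x hx)
  obtain ⟨k, hka⟩ := hk a ha
  refine ⟨k, fun x hx => ?_⟩
  have hc : ContinuousOn (fun x => ((g₁ x - g₂ x) / (2 * Real.pi * Complex.I)).re) s :=
    Complex.continuous_re.comp_continuousOn ((h₁.sub h₂).div_const _)
  have hval : ∀ y : X, ∀ m : ℤ, g₁ y = g₂ y + m * (2 * Real.pi * Complex.I) →
      ((g₁ y - g₂ y) / (2 * Real.pi * Complex.I)).re = m := by
    intro y m hm
    rw [hm, add_sub_cancel_left, mul_div_assoc, div_self two_pi_I_ne_zero]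
    simp
  have hd : DiscreteTopology (range ((↑) : ℤ → ℝ)) := by
    have := Int.isClosedEmbedding_coe_real.isEmbedding.toHomeomorph
    exact this.symm.isEmbedding.discreteTopology
  obtain ⟨m, hm⟩ := hk x hx
  have := hs.constant_of_mapsTo (IsDiscrete.mk hd) hc (T := range ((↑) : ℤ → ℝ))
    (fun y hy => by obtain ⟨m, hm⟩ := hk y hy; exact ⟨m, (hval y m hm).symm⟩) hx ha
  simp only [hval x m hm, hval a k hka] at this
  have hmk : m = k := by exact_mod_cast this
  rw [hm, hmk]

theorem HasLogOn.mono {f : X → ℂ} {s t : Set X} (h : HasLogOn f t) (hst : s ⊆ t) :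
    HasLogOn f s := by
  obtain ⟨g, hg, hf⟩ := h
  exact ⟨g, hg.mono hst, fun x hx => hf x (hst hx)⟩

theorem HasLogOn.congr {f f' : X → ℂ} {s : Set X} (h : HasLogOn f s) (hff : ∀ x ∈ s, f x = f' x) :
    HasLogOn f' s := by
  obtain ⟨g, hg, hf⟩ := h
  exact ⟨g, hg, fun x hx => (hf x hx).trans (hff x hx)⟩

theorem HasLogOn.mul {f f' : X → ℂ} {s : Set X} (h : HasLogOn f s) (h' : HasLogOn f' s) :
    HasLogOn (fun x => f x * f' x) s := by
  obtain ⟨g, hg, hf⟩ := h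
  obtain ⟨g', hg', hf'⟩ := h'
  exact ⟨fun x => g x + g' x, hg.add hg', fun x hx => by
    rw [Complex.exp_add, hf x hx, hf' x hx]⟩

theorem HasLogOn.zpow {f : X → ℂ} {s : Set X} (h : HasLogOn f s) (n : ℤ) :
    HasLogOn (fun x => f x ^ n) s := by
  obtain ⟨g, hg, hf⟩ := h
  exact ⟨fun x => n * g x, continuousOn_const.mul hg, fun x hx => by
    rw [Complex.exp_int_mul, hf x hx]⟩

theorem HasLogOn.inv {f : X → ℂ} {s : Set X} (h : HasLogOn f s) :
    HasLogOn (fun x => (f x)⁻¹) s := by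
  simpa using h.zpow (-1)

theorem hasLogOn_of_norm_sub_one_lt {f : X → ℂ} {s : Set X} (hf : ContinuousOn f s)
    (h : ∀ x ∈ s, ‖f x - 1‖ < 1) : HasLogOn f s := by
  have hsl : ∀ x ∈ s, f x ∈ Complex.slitPlane := by
    intro x hx
    have := Complex.mem_slitPlane_of_norm_lt_one (h x hx)
    simpa using this
  exact ⟨fun x => Complex.log (f x), hf.clog hsl,
    fun x hx => Complex.exp_log (Complex.slitPlane_ne_zero (hsl x hx))⟩

theorem HasLogOn.comp {f : Y → ℂ} {t : Set Y} (h : HasLogOn f t) {φ : X → Y} {s : Set X}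
    (hφ : ContinuousOn φ s) (hm : MapsTo φ s t) : HasLogOn (fun x => f (φ x)) s := by
  obtain ⟨g, hg, hf⟩ := h
  exact ⟨fun x => g (φ x), hg.comp hφ hm, fun x hx => hf _ (hm hx)⟩

/-- Transport of the logarithm property along a set-level homeomorphism. -/
theorem LogProp.of_inverse {s : Set X} {t : Set Y} (ht : LogProp t) {φ : X → Y} {ψ : Y → X}
    (hφ : ContinuousOn φ s) (hψ : ContinuousOn ψ t) (hst : MapsTo φ s t) (hts : MapsTo ψ t s)
    (hinv : ∀ x ∈ s, ψ (φ x) = x) : LogProp s := by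
  intro f hf h0
  have := (ht (fun y => f (ψ y)) (hf.comp hψ hts) fun y hy => h0 _ (hts hy)).comp hφ hst
  exact this.congr fun x hx => by rw [hinv x hx]

theorem logProp_of_simplyConnected [LocallyPathConnectedSpace X] {s : Set X}
    (hs : IsSimplyConnected s) (ho : IsOpen s) : LogProp s := by
  intro f hf h0
  obtain ⟨g, hg, hgf⟩ := Complex.exists_continuousOn_eqOn_exp_comp hs ho hf
    (by rintro ⟨x, hx, h⟩; exact h0 x hx h)
  exact ⟨g, hg, fun x hx => hgf hx⟩

theorem logProp_of_contractible [LocallyPathConnectedSpace X] {s : Set X}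
    (hs : ContractibleSpace s) (ho : IsOpen s) : LogProp s := by
  refine logProp_of_simplyConnected ?_ ho
  have : SimplyConnectedSpace s := inferInstance
  exact this

/-- Gluing logarithms along a connected intersection. -/
theorem LogProp.union {s t : Set X} (hs : LogProp s) (ht : LogProp t) (hso : IsOpen s)
    (hto : IsOpen t) (hc : IsPreconnected (s ∩ t)) : LogProp (s ∪ t) := by
  classical
  intro f hf h0
  obtain ⟨g₁, hg₁, hf₁⟩ := hs f (hf.mono subset_union_left) fun x hx => h0 x (Or.inl hx)
  obtain ⟨g₂, hg₂, hf₂⟩ := ht f (hf.mono subset_union_right) fun x hx => h0 x (Or.inr hx)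
  obtain ⟨k, hk⟩ := log_unique_of_preconnected hc (hg₁.mono inter_subset_left)
    (hg₂.mono inter_subset_right) fun x hx => (hf₁ x hx.1).trans (hf₂ x hx.2).symm
  set g : X → ℂ := fun x => if x ∈ s then g₁ x else g₂ x + k * (2 * Real.pi * Complex.I)
  have hgs : EqOn g g₁ s := fun x hx => if_pos hx
  have hgt : EqOn g (fun x => g₂ x + k * (2 * Real.pi * Complex.I)) t := by
    intro x hx
    by_cases hxs : x ∈ s
    · rw [hgs hxs]; exact hk x ⟨hxs, hx⟩
    · exact if_neg hxs
  refine ⟨g, ?_, ?_⟩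
  · exact (hg₁.congr hgs).union_of_isOpen ((hg₂.add continuousOn_const).congr hgt) hso hto
  · rintro x (hx | hx)
    · rw [hgs hx, hf₁ x hx]
    · rw [hgt hx, Complex.exp_add, hf₂ x hx, Complex.exp_int_mul_two_pi_mul_I, mul_one]

end Basic

section Cut
variable {X : Type*} [MetricSpace X]

/-- The transition data attached to a clopen piece `P` of the intersection of two open sets. -/
theorem exists_transition {s t P Q : Set X} (hs : IsOpen s) (ht : IsOpen t)
    (hs' : sᶜ.Nonempty) (ht' : tᶜ.Nonempty) (hP : IsOpen P) (hQ : IsOpen Q)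
    (hPQ : Disjoint P Q) (hst : P ∪ Q = s ∩ t) :
    ∃ f g₁ g₂ : X → ℂ, ContinuousOn f (s ∪ t) ∧ (∀ x, f x ≠ 0) ∧
      ContinuousOn g₁ s ∧ ContinuousOn g₂ t ∧ (∀ x ∈ s, Complex.exp (g₁ x) = f x) ∧
      (∀ x ∈ t, Complex.exp (g₂ x) = f x) ∧
      (∀ x ∈ P, g₁ x = g₂ x + 2 * Real.pi * Complex.I) ∧ ∀ x ∈ Q, g₁ x = g₂ x := by
  classical
  have hpos : ∀ x ∈ s ∪ t, 0 < infDist x sᶜ + infDist x tᶜ := by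
    rintro x (hx | hx)
    · have := (hs.isClosed_compl.notMem_iff_infDist_pos hs').1 (not_not.2 hx)
      have := infDist_nonneg (x := x) (s := tᶜ); linarith
    · have := (ht.isClosed_compl.notMem_iff_infDist_pos ht').1 (not_not.2 hx)
      have := infDist_nonneg (x := x) (s := sᶜ); linarith
  have key : ∀ u v : Set X, IsOpen u → IsOpen v → vᶜ.Nonempty → P ∪ Q = u ∩ v →
      (∀ x ∈ u ∪ v, 0 < infDist x uᶜ + infDist x vᶜ) → ContinuousOn (fun x => if x ∈ P then
        2 * Real.pi * Complex.I * ((infDist x vᶜ / (infDist x uᶜ + infDist x vᶜ) : ℝ) : ℂ)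
        else 0) u := by
    intro u v hu hv hv' huv hp x hx
    have hφ : ContinuousAt (fun x => 2 * Real.pi * Complex.I *
        ((infDist x vᶜ / (infDist x uᶜ + infDist x vᶜ) : ℝ) : ℂ)) x := by
      refine continuousAt_const.mul (Complex.continuous_ofReal.continuousAt.comp ?_)
      exact ContinuousAt.div (continuous_infDist_pt _).continuousAt
        ((continuous_infDist_pt _).add (continuous_infDist_pt _)).continuousAt
        (hp x (Or.inl hx)).ne'
    apply ContinuousAt.continuousWithinAt
    by_cases hxv : x ∈ v
    · have : x ∈ P ∪ Q := huv ▸ ⟨hx, hxv⟩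
      rcases this with hxP | hxQ
      · refine hφ.congr ?_
        filter_upwards [hP.mem_nhds hxP] with y hy
        rw [if_pos hy]
      · refine (continuousAt_const (y := (0 : ℂ))).congr ?_
        filter_upwards [hQ.mem_nhds hxQ] with y hy
        rw [if_neg fun h => hPQ.le_bot ⟨h, hy⟩]
    · have h0 : infDist x vᶜ = 0 := infDist_zero_of_mem hxv
      have hxP : x ∉ P := fun h => hxv ((huv ▸ Or.inl h : x ∈ u ∩ v).2)
      rw [ContinuousAt, if_neg hxP]
      have hφ0 : Tendsto (fun x => 2 * Real.pi * Complex.I *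
        ((infDist x vᶜ / (infDist x uᶜ + infDist x vᶜ) : ℝ) : ℂ)) (𝓝 x) (𝓝 0) := by
        have := hφ.tendsto
        simpa [h0] using this
      have hn := hφ0.norm
      rw [norm_zero] at hn
      refine squeeze_zero_norm (fun y => ?_) hn
      split_ifs
      · exact le_rfl
      · rw [norm_zero]
        exact norm_nonneg _
  have hsc := key s t hs ht ht' hst hpos
  have htc := key t s ht hs hs' (by rw [hst, inter_comm])
    (fun x hx => by rw [add_comm]; exact hpos x hx.symm)
  set g₁ : X → ℂ := fun x => if x ∈ P then
    2 * Real.pi * Complex.I * ((infDist x tᶜ / (infDist x sᶜ + infDist x tᶜ) : ℝ) : ℂ) else 0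
    with hg₁
  set h₂ : X → ℂ := fun x => if x ∈ P then
    2 * Real.pi * Complex.I * ((infDist x sᶜ / (infDist x tᶜ + infDist x sᶜ) : ℝ) : ℂ) else 0
    with hh₂
  have hdP : ∀ x ∈ P, g₁ x = -h₂ x + 2 * Real.pi * Complex.I := by
    intro x hx
    have hp := hpos x (Or.inl (hst ▸ Or.inl hx : x ∈ s ∩ t).1)
    simp only [hg₁, hh₂, if_pos hx]
    have : (infDist x tᶜ / (infDist x sᶜ + infDist x tᶜ) : ℝ) =
        1 - infDist x sᶜ / (infDist x tᶜ + infDist x sᶜ) := by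
      rw [add_comm (infDist x tᶜ)]
      field_simp
      ring
    rw [this]
    push_cast
    ring
  have hdQ : ∀ x ∉ P, g₁ x = -h₂ x := by
    intro x hx
    simp only [hg₁, hh₂, if_neg hx, neg_zero]
  have hexp : ∀ x, Complex.exp (-h₂ x) = Complex.exp (g₁ x) := by
    intro x
    by_cases hx : x ∈ P
    · rw [hdP x hx, Complex.exp_add, Complex.exp_two_pi_mul_I, mul_one]
    · rw [hdQ x hx]
  refine ⟨fun x => Complex.exp (g₁ x), g₁, fun x => -h₂ x, ?_, fun x => Complex.exp_ne_zero _,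
    hsc, htc.neg, fun x _ => rfl, fun x _ => hexp x, hdP,
    fun x hx => hdQ x fun h => hPQ.le_bot ⟨h, hx⟩⟩
  refine ContinuousOn.union_of_isOpen hsc.cexp ?_ hs ht
  exact htc.neg.cexp.congr fun x _ => (hexp x).symm

/-- If the logarithm property holds on the union of two connected open sets, then their
intersection is connected. -/
theorem LogProp.isPreconnected_inter {s t : Set X} (hs : IsOpen s) (ht : IsOpen t)
    (hs' : sᶜ.Nonempty) (ht' : tᶜ.Nonempty) (hl : LogProp (s ∪ t))
    (hsc : IsPreconnected s) (htc : IsPreconnected t) : IsPreconnected (s ∩ t) := by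
  rw [isPreconnected_iff_subset_of_disjoint]
  intro u v hu hv huv hd
  by_contra hcon
  rw [not_or, not_subset, not_subset] at hcon
  obtain ⟨⟨a, ha, hau⟩, b, hb, hbv⟩ := hcon
  have hav : a ∈ v := (huv ha).resolve_left hau
  have hbu : b ∈ u := (huv hb).resolve_right hbv
  obtain ⟨f, g₁, g₂, hf, hf0, hg₁, hg₂, he₁, he₂, hP, hQ⟩ :=
    exists_transition (P := s ∩ t ∩ u) (Q := s ∩ t ∩ v) hs ht hs' ht' ((hs.inter ht).inter hu)
      ((hs.inter ht).inter hv)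
      (by
        rw [disjoint_iff_inter_eq_empty, ← hd]
        ext x; simp only [mem_inter_iff]; tauto)
      (by rw [← inter_union_distrib_left]; exact inter_eq_left.2 huv)
  obtain ⟨g, hg, hgf⟩ := hl f hf fun x _ => hf0 x
  obtain ⟨k, hk⟩ := log_unique_of_preconnected hsc hg₁ (hg.mono subset_union_left)
    fun x hx => (he₁ x hx).trans (hgf x (Or.inl hx)).symm
  obtain ⟨l, hl⟩ := log_unique_of_preconnected htc hg₂ (hg.mono subset_union_right)
    fun x hx => (he₂ x hx).trans (hgf x (Or.inr hx)).symm
  have h1 := hP b ⟨hb, hbu⟩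
  have h2 := hQ a ⟨ha, hav⟩
  rw [hk b hb.1, hl b hb.2] at h1
  rw [hk a ha.1, hl a ha.2] at h2
  have h3 := add_left_cancel h2
  rw [h3, add_assoc] at h1
  have h4 := add_left_cancel h1
  exact two_pi_I_ne_zero (left_eq_add.1 h4)

/-- If any two nonvanishing functions on a union of two connected open sets are dependent up to
exponentials, then their intersection cannot be split into three nonempty open pieces. -/
theorem not_three_pieces_of_rank_le_one {s t P Q R : Set X} (hs : IsOpen s) (ht : IsOpen t)
    (hs' : sᶜ.Nonempty) (ht' : tᶜ.Nonempty)
    (hr : ∀ f f' : X → ℂ, ContinuousOn f (s ∪ t) → ContinuousOn f' (s ∪ t) →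
      (∀ x ∈ s ∪ t, f x ≠ 0) → (∀ x ∈ s ∪ t, f' x ≠ 0) →
      ∃ a b : ℤ, (a ≠ 0 ∨ b ≠ 0) ∧ HasLogOn (fun x => f x ^ a * f' x ^ b) (s ∪ t))
    (hsc : IsPreconnected s) (htc : IsPreconnected t)
    (hP : IsOpen P) (hQ : IsOpen Q) (hR : IsOpen R) (hPQ : Disjoint P Q) (hPR : Disjoint P R)
    (hQR : Disjoint Q R) (hP0 : P.Nonempty) (hQ0 : Q.Nonempty) (hR0 : R.Nonempty)
    (hst : P ∪ Q ∪ R = s ∩ t) : False := by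
  obtain ⟨f, g₁, g₂, hf, hf0, hg₁, hg₂, he₁, he₂, hfP, hfQ⟩ :=
    exists_transition (P := P) (Q := Q ∪ R) hs ht hs' ht' hP (hQ.union hR)
      (disjoint_union_right.2 ⟨hPQ, hPR⟩) (by rw [← hst, union_assoc])
  obtain ⟨f', g₁', g₂', hf', hf0', hg₁', hg₂', he₁', he₂', hfP', hfQ'⟩ :=
    exists_transition (P := Q) (Q := P ∪ R) hs ht hs' ht' hQ (hP.union hR)
      (disjoint_union_right.2 ⟨hPQ.symm, hQR⟩) (by rw [← hst, ← union_assoc, union_comm Q P])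
  obtain ⟨a, b, hab, g, hg, hgf⟩ := hr f f' hf hf' (fun x _ => hf0 x) fun x _ => hf0' x
  obtain ⟨k, hk⟩ := log_unique_of_preconnected hsc (g₁ := fun x => a * g₁ x + b * g₁' x)
    ((continuousOn_const.mul hg₁).add (continuousOn_const.mul hg₁')) (hg.mono subset_union_left)
    fun x hx => by
      rw [hgf x (Or.inl hx), Complex.exp_add, Complex.exp_int_mul, Complex.exp_int_mul, he₁ x hx,
        he₁' x hx]
  obtain ⟨l, hl⟩ := log_unique_of_preconnected htc (g₁ := fun x => a * g₂ x + b * g₂' x)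
    ((continuousOn_const.mul hg₂).add (continuousOn_const.mul hg₂')) (hg.mono subset_union_right)
    fun x hx => by
      rw [hgf x (Or.inr hx), Complex.exp_add, Complex.exp_int_mul, Complex.exp_int_mul, he₂ x hx,
        he₂' x hx]
  obtain ⟨p, hp⟩ := hP0
  obtain ⟨q, hq⟩ := hQ0
  obtain ⟨r, hr⟩ := hR0
  have hp' : p ∈ s ∩ t := hst ▸ Or.inl (Or.inl hp)
  have hq' : q ∈ s ∩ t := hst ▸ Or.inl (Or.inr hq)
  have hr' : r ∈ s ∩ t := hst ▸ Or.inr hr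
  have kr := hk r hr'.1
  have lr := hl r hr'.2
  have kp := hk p hp'.1
  have lp := hl p hp'.2
  have kq := hk q hq'.1
  have lq := hl q hq'.2
  simp only [hfQ r (Or.inr hr), hfQ' r (Or.inr hr), hfP p hp, hfQ' p (Or.inl hp),
    hfQ q (Or.inl hq), hfP' q hq] at *
  have e1 : (a : ℂ) * (2 * Real.pi * Complex.I) = 0 := by
    linear_combination kp - lp - kr + lr
  have e2 : (b : ℂ) * (2 * Real.pi * Complex.I) = 0 := by
    linear_combination kq - lq - kr + lr
  have a0 : a = 0 := by exact_mod_cast (mul_eq_zero.1 e1).resolve_right two_pi_I_ne_zero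
  have b0 : b = 0 := by exact_mod_cast (mul_eq_zero.1 e2).resolve_right two_pi_I_ne_zero
  tauto

end Cut

section Space

/-- The complement in `ℂ × ℝ` of the part of `L × ℝ` lying at nonpositive height. -/
def upperPart (L : Set ℂ) : Set (ℂ × ℝ) := {p | p.1 ∈ L → 0 < p.2}

/-- The complement in `ℂ × ℝ` of the part of `L × ℝ` lying at nonnegative height. -/
def lowerPart (L : Set ℂ) : Set (ℂ × ℝ) := {p | p.1 ∈ L → p.2 < 0}

variable {L : Set ℂ}

theorem isOpen_upperPart (hL : IsClosed L) : IsOpen (upperPart L) := by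
  have : upperPart L = (Prod.fst ⁻¹' Lᶜ) ∪ (Prod.snd ⁻¹' Ioi 0) := by
    ext p; simp only [upperPart, mem_ofPred_eq, mem_union, mem_preimage, mem_compl_iff, mem_Ioi]
    tauto
  rw [this]
  exact (hL.isOpen_compl.preimage continuous_fst).union (isOpen_Ioi.preimage continuous_snd)

theorem isOpen_lowerPart (hL : IsClosed L) : IsOpen (lowerPart L) := by
  have : lowerPart L = (Prod.fst ⁻¹' Lᶜ) ∪ (Prod.snd ⁻¹' Iio 0) := by
    ext p; simp only [lowerPart, mem_ofPred_eq, mem_union, mem_preimage, mem_compl_iff, mem_Iio]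
    tauto
  rw [this]
  exact (hL.isOpen_compl.preimage continuous_fst).union (isOpen_Iio.preimage continuous_snd)

theorem contractible_upperPart (L : Set ℂ) : ContractibleSpace (upperPart L) := by
  rw [contractible_iff_id_nullhomotopic]
  refine ⟨⟨((0 : ℂ), (1 : ℝ)), fun _ => one_pos⟩, ⟨⟨⟨fun q =>
    ⟨(((1 - max 0 (2 * (q.1 : ℝ) - 1) : ℝ) : ℂ) * q.2.1.1,
      (1 - min 1 (2 * (q.1 : ℝ))) * q.2.1.2 + min 1 (2 * (q.1 : ℝ)) *
        (|q.2.1.2| * (1 - max 0 (2 * (q.1 : ℝ) - 1)) + 1)), ?_⟩, ?_⟩, ?_, ?_⟩⟩⟩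
  · obtain ⟨s, ⟨⟨z, t⟩, hp⟩⟩ := q
    have hs0 := s.2.1
    have hs1 := s.2.2
    simp only [upperPart, mem_ofPred_eq] at hp ⊢
    intro hz
    rcases le_or_gt (2 * (s : ℝ)) 1 with h | h
    · rw [max_eq_left (by linarith), min_eq_right h] at *
      simp only [sub_zero, Complex.ofReal_one, one_mul, mul_one] at hz ⊢
      have ht := hp hz
      rcases eq_or_lt_of_le hs0 with h0 | h0
      · rw [← h0]; simpa using ht
      · have : 0 ≤ (1 - 2 * (s : ℝ)) * t := mul_nonneg (by linarith) ht.le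
        have : 0 < 2 * (s : ℝ) * (|t| + 1) := by positivity
        linarith
    · rw [min_eq_left h.le, max_eq_right (by linarith)]
      have : 0 ≤ |t| * (1 - (2 * (s : ℝ) - 1)) := mul_nonneg (abs_nonneg _) (by linarith)
      linarith
  · fun_prop
  · rintro ⟨⟨z, t⟩, hp⟩
    simp
  · rintro ⟨⟨z, t⟩, hp⟩
    apply Subtype.ext
    norm_num

theorem logProp_upperPart (hL : IsClosed L) : LogProp (upperPart L) :=
  logProp_of_contractible (contractible_upperPart L) (isOpen_upperPart hL)

theorem isPreconnected_upperPart (L : Set ℂ) : IsPreconnected (upperPart L) := by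
  have := contractible_upperPart L
  exact isPreconnected_iff_preconnectedSpace.2 inferInstance

theorem logProp_lowerPart (hL : IsClosed L) : LogProp (lowerPart L) :=
  (logProp_upperPart hL).of_inverse (φ := fun p => (p.1, -p.2)) (ψ := fun p => (p.1, -p.2))
    (by fun_prop) (by fun_prop) (fun p hp h => by simpa using hp h)
    (fun p hp h => by simpa using hp h) (by simp)

theorem isPreconnected_lowerPart (L : Set ℂ) : IsPreconnected (lowerPart L) := by
  have : lowerPart L = (fun p : ℂ × ℝ => (p.1, -p.2)) '' upperPart L := by
    ext p
    constructor
    · intro hp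
      exact ⟨(p.1, -p.2), fun h => by simpa using hp h, by simp⟩
    · rintro ⟨q, hq, rfl⟩ h
      simpa using hq h
  rw [this]
  exact (isPreconnected_upperPart L).image _ (by fun_prop)

theorem upperPart_inter_lowerPart (L : Set ℂ) :
    upperPart L ∩ lowerPart L = Lᶜ ×ˢ (univ : Set ℝ) := by
  ext p
  simp only [upperPart, lowerPart, mem_inter_iff, mem_ofPred_eq, mem_prod, mem_compl_iff, mem_univ,
    and_true]
  constructor
  · rintro ⟨h1, h2⟩ h
    exact lt_asymm (h1 h) (h2 h)
  · intro h; exact ⟨fun h' => absurd h' h, fun h' => absurd h' h⟩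

theorem upperPart_union_lowerPart (L : Set ℂ) :
    upperPart L ∪ lowerPart L = {p | ¬(p.1 ∈ L ∧ p.2 = 0)} := by
  ext p
  simp only [upperPart, lowerPart, mem_union, mem_ofPred_eq]
  rcases lt_trichotomy p.2 0 with h | h | h
  · have := h.ne; have := h.not_gt; tauto
  · simp [h]
  · have := h.ne'; have := h.not_gt; tauto

/-- The straightening homeomorphism attached to a properly embedded line in the plane. -/
noncomputable def straighten (ψ : C(ℝ, ℂ)) (φ : C(ℂ, ℝ)) : (ℂ × ℝ) ≃ₜ (ℂ × ℝ) where
  toFun p := (p.1 - ψ (p.2 + φ p.1), p.2 + φ p.1)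
  invFun q := (q.1 + ψ q.2, q.2 - φ (q.1 + ψ q.2))
  left_inv p := by simp
  right_inv q := by simp
  continuous_toFun := by fun_prop
  continuous_invFun := by fun_prop

theorem straighten_preimage {ψ : C(ℝ, ℂ)} {φ : C(ℂ, ℝ)} (h : ∀ t, φ (ψ t) = t) (M : Set ℝ) :
    {p : ℂ × ℝ | ¬(p.1 ∈ ψ '' M ∧ p.2 = 0)} =
      straighten ψ φ ⁻¹' {p | ¬(p.1 = 0 ∧ p.2 ∈ M)} := by
  ext ⟨z, t⟩
  simp only [mem_ofPred_eq, mem_preimage, straighten, Homeomorph.homeomorph_mk_coe,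
    Equiv.coe_fn_mk, not_iff_not]
  constructor
  · rintro ⟨⟨s, hs, rfl⟩, rfl⟩
    simp [h, hs]
  · rintro ⟨h1, h2⟩
    have h3 : z = ψ (t + φ z) := sub_eq_zero.1 h1
    refine ⟨⟨_, h2, h3.symm⟩, ?_⟩
    have := h (t + φ z)
    rw [← h3] at this
    linarith

theorem logProp_preimage_homeomorph {X Y : Type*} [TopologicalSpace X] [TopologicalSpace Y]
    (e : X ≃ₜ Y) {t : Set Y} (ht : LogProp t) : LogProp (e ⁻¹' t) :=
  ht.of_inverse e.continuous.continuousOn e.symm.continuous.continuousOn (fun _ h => h)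
    (fun y hy => by simpa using hy) (fun x _ => e.symm_apply_apply x)

theorem logProp_compl_rays (t₀ ε : ℝ) (hε : 0 < ε) :
    LogProp {p : ℂ × ℝ | ¬(p.1 = 0 ∧ p.2 ∈ {t | ε ≤ |t - t₀|})} := by
  have hmem : ((0 : ℂ), t₀) ∈ {p : ℂ × ℝ | ¬(p.1 = 0 ∧ p.2 ∈ {t | ε ≤ |t - t₀|})} := by
    simpa using hε
  have hstar : StarConvex ℝ ((0 : ℂ), t₀)
      {p : ℂ × ℝ | ¬(p.1 = 0 ∧ p.2 ∈ {t | ε ≤ |t - t₀|})} := by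
    rintro ⟨z, t⟩ hp a b ha hb hab
    simp only [mem_ofPred_eq, Prod.smul_mk, Prod.mk_add_mk, smul_zero, zero_add, smul_eq_mul,
      not_and, not_le] at hp ⊢
    intro h
    have e1 : a * t₀ + b * t - t₀ = b * (t - t₀) := by
      have : a = 1 - b := by linarith
      rw [this]; ring
    rw [e1, abs_mul, abs_of_nonneg hb]
    rcases smul_eq_zero.1 h with h | h
    · simpa [h] using hε
    · have := hp h
      have hb1 : b ≤ 1 := by linarith
      nlinarith [abs_nonneg (t - t₀)]
  refine logProp_of_contractible (hstar.contractibleSpace ⟨_, hmem⟩) ?_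
  have : {p : ℂ × ℝ | ¬(p.1 = 0 ∧ p.2 ∈ {t | ε ≤ |t - t₀|})} =
      (Prod.fst ⁻¹' {0} ∩ Prod.snd ⁻¹' {t | ε ≤ |t - t₀|})ᶜ := by
    ext; simp
  rw [this]
  refine IsClosed.isOpen_compl (self := ?_)
  exact (isClosed_singleton.preimage continuous_fst).inter
    ((isClosed_le continuous_const (by fun_prop)).preimage continuous_snd)

/-- A continuous function `f` off the axis is `z ^ n` times an exponential. -/
theorem exists_zpow_log_off_axis {f : ℂ × ℝ → ℂ} (hf : ContinuousOn f {p | p.1 ≠ 0})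
    (h0 : ∀ p : ℂ × ℝ, p.1 ≠ 0 → f p ≠ 0) :
    ∃ n : ℤ, HasLogOn (fun p => f p * p.1 ^ n) {p | p.1 ≠ 0} := by
  have hc : ContractibleSpace (univ : Set (ℂ × ℝ)) :=
    (starConvex_univ (0 : ℂ × ℝ)).contractibleSpace univ_nonempty
  obtain ⟨G, hG, hGf⟩ := logProp_of_contractible hc isOpen_univ
    (fun p : ℂ × ℝ => f (Complex.exp p.1, p.2))
    (hf.comp (by fun_prop) fun p _ => Complex.exp_ne_zero _)
    (fun p _ => h0 _ (Complex.exp_ne_zero _))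
  have hGc : Continuous G := continuousOn_univ.1 hG
  obtain ⟨n, hn⟩ := log_unique_of_preconnected (isPreconnected_univ (α := ℂ × ℝ))
    (g₁ := fun p => G (p.1 + 2 * Real.pi * Complex.I, p.2)) (g₂ := G)
    (hGc.comp (by fun_prop)).continuousOn hG (fun p _ => by
      rw [hGf _ trivial, hGf _ trivial]
      simp only [Complex.exp_periodic p.1])
  have hnk : ∀ (k : ℤ) (p : ℂ × ℝ),
      G (p.1 + k * (2 * Real.pi * Complex.I), p.2) = G p + k * (n * (2 * Real.pi * Complex.I)) := by
    intro k
    induction k using Int.induction_on with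
    | zero => simp
    | succ k ih =>
      intro p
      have := hn (p.1 + k * (2 * Real.pi * Complex.I), p.2) trivial
      have h2 := ih p
      push_cast at *
      rw [show p.1 + ((k : ℂ) + 1) * (2 * Real.pi * Complex.I) =
        p.1 + k * (2 * Real.pi * Complex.I) + 2 * Real.pi * Complex.I by ring, this, h2]
      ring
    | pred k ih =>
      intro p
      have := hn (p.1 + (-k - 1) * (2 * Real.pi * Complex.I), p.2) trivial
      have h2 := ih p
      push_cast at *
      rw [show p.1 + (-(k : ℂ) - 1) * (2 * Real.pi * Complex.I) + 2 * Real.pi * Complex.I =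
        p.1 + -k * (2 * Real.pi * Complex.I) by ring, h2] at this
      linear_combination -this
  -- the difference `G - n w` descends to the complement of the axis
  have hdesc : ∀ p q : ℂ × ℝ, Complex.exp p.1 = Complex.exp q.1 → p.2 = q.2 →
      G p - n * p.1 = G q - n * q.1 := by
    intro p q h1 h2
    obtain ⟨k, hk⟩ := Complex.exp_eq_exp_iff_exists_int.1 h1
    have := hnk k q
    rw [← hk, ← h2] at this
    change G p = _ at this
    rw [this, hk]
    ring
  refine ⟨-n, fun p => G (Complex.log p.1, p.2) - n * Complex.log p.1, ?_, ?_⟩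
  · intro p hp
    apply ContinuousAt.continuousWithinAt
    have hp' : p.1 ≠ 0 := hp
    have hcont : ContinuousAt (fun q : ℂ × ℝ =>
        G (Complex.log (q.1 / p.1) + Complex.log p.1, q.2) -
          n * (Complex.log (q.1 / p.1) + Complex.log p.1)) p := by
      have hl : ContinuousAt (fun q : ℂ × ℝ => Complex.log (q.1 / p.1)) p := by
        refine ContinuousAt.clog (by fun_prop) ?_
        rw [div_self hp']
        exact Complex.one_mem_slitPlane
      have := hGc.continuousAt.comp ((hl.add (continuousAt_const (y := Complex.log p.1))).prodMk
        (continuous_snd.continuousAt (x := p)))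
      exact this.sub (continuousAt_const.mul (hl.add continuousAt_const))
    refine hcont.congr ?_
    filter_upwards [(isOpen_compl_singleton.preimage continuous_fst).mem_nhds
      (show p ∈ Prod.fst ⁻¹' {(0 : ℂ)}ᶜ from hp')] with q hq
    have hq' : q.1 ≠ 0 := hq
    refine hdesc (_, _) (_, _) ?_ rfl
    simp only
    rw [Complex.exp_add, Complex.exp_log (div_ne_zero hq' hp'), Complex.exp_log hp',
      Complex.exp_log hq', div_mul_cancel₀ _ hp']
  · intro p hp
    have hp' : p.1 ≠ 0 := hp
    dsimp only
    rw [sub_eq_add_neg, Complex.exp_add, hGf _ trivial, ← neg_mul, ← Int.cast_neg,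
      Complex.exp_int_mul, Complex.exp_log hp']
    simp only [Complex.exp_log hp']

theorem rank_le_one_off_axis (f f' : ℂ × ℝ → ℂ) (hf : ContinuousOn f {p | p.1 ≠ 0})
    (hf' : ContinuousOn f' {p | p.1 ≠ 0})
    (h0 : ∀ p : ℂ × ℝ, p.1 ≠ 0 → f p ≠ 0) (h0' : ∀ p : ℂ × ℝ, p.1 ≠ 0 → f' p ≠ 0) :
    ∃ a b : ℤ, (a ≠ 0 ∨ b ≠ 0) ∧ HasLogOn (fun p => f p ^ a * f' p ^ b) {p | p.1 ≠ 0} := by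
  obtain ⟨m, hm⟩ := exists_zpow_log_off_axis hf h0
  obtain ⟨n, hn⟩ := exists_zpow_log_off_axis hf' h0'
  by_cases h : m = 0
  · refine ⟨1, 0, Or.inl one_ne_zero, hm.congr fun p _ => by simp [h]⟩
  · refine ⟨n, -m, Or.inr (neg_ne_zero.2 h), ((hm.zpow n).mul (hn.zpow (-m))).congr
      fun p hp => ?_⟩
    have hp' : p.1 ≠ 0 := hp
    simp only [mul_zpow, ← zpow_mul]
    rw [show n * -m = -(m * n) by ring, zpow_neg p.1]
    field_simp

theorem not_logProp_off_axis : ¬ LogProp {p : ℂ × ℝ | p.1 ≠ 0} := by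
  intro h
  obtain ⟨g, hg, hgf⟩ := h (fun p => p.1) (by fun_prop) fun p hp => hp
  obtain ⟨k, hk⟩ := log_unique_of_preconnected (isPreconnected_univ (α := ℂ))
    (g₁ := fun w => g (Complex.exp w, 0)) (g₂ := fun w => w)
    (hg.comp (by fun_prop) fun w _ => Complex.exp_ne_zero _) continuousOn_id
    (fun w _ => hgf _ (Complex.exp_ne_zero _))
  have h1 := hk 0 trivial
  have h2 := hk (2 * Real.pi * Complex.I) trivial
  simp only [Complex.exp_zero, Complex.exp_two_pi_mul_I] at h1 h2
  rw [h1] at h2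
  have := add_right_cancel h2
  exact two_pi_I_ne_zero this.symm

end Space

section PlaneJordan

theorem exists_open_split {X : Type*} [TopologicalSpace X] {s : Set X} (hs : IsOpen s)
    (h : ¬ IsPreconnected s) : ∃ P Q : Set X, IsOpen P ∧ IsOpen Q ∧ P.Nonempty ∧ Q.Nonempty ∧
      Disjoint P Q ∧ P ∪ Q = s := by
  rw [isPreconnected_iff_subset_of_disjoint] at h
  push Not at h
  obtain ⟨u, v, hu, hv, hs', hd, h1, h2⟩ := h
  rw [not_subset] at h1 h2
  obtain ⟨a, ha, hau⟩ := h1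
  obtain ⟨b, hb, hbv⟩ := h2
  refine ⟨s ∩ u, s ∩ v, hs.inter hu, hs.inter hv, ⟨b, hb, (hs' hb).resolve_right hbv⟩,
    ⟨a, ha, (hs' ha).resolve_left hau⟩, ?_, ?_⟩
  · rw [disjoint_iff_inter_eq_empty, ← hd]
    ext x; simp only [mem_inter_iff]; tauto
  · rw [← inter_union_distrib_left, inter_eq_left.2 hs']

variable {ψ : C(ℝ, ℂ)} {φ : C(ℂ, ℝ)}

theorem isClosed_line_image (h : ∀ t, φ (ψ t) = t) {M : Set ℝ} (hM : IsClosed M) :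
    IsClosed (ψ '' M) := by
  have : ψ '' M = {z | ψ (φ z) = z} ∩ φ ⁻¹' M := by
    ext z
    constructor
    · rintro ⟨t, ht, rfl⟩
      simp [h, ht]
    · rintro ⟨h1, h2⟩
      exact ⟨φ z, h2, h1⟩
  rw [this]
  exact (isClosed_eq (by fun_prop) continuous_id).inter (hM.preimage φ.continuous)

theorem upper_union_lower_line (h : ∀ t, φ (ψ t) = t) (M : Set ℝ) :
    upperPart (ψ '' M) ∪ lowerPart (ψ '' M) =
      straighten ψ φ ⁻¹' {p | ¬(p.1 = 0 ∧ p.2 ∈ M)} := by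
  rw [upperPart_union_lowerPart, straighten_preimage h]

theorem not_isPreconnected_compl_line (h : ∀ t, φ (ψ t) = t) :
    ¬ IsPreconnected (ψ '' univ)ᶜ := by
  intro hc
  have hL := isClosed_line_image h isClosed_univ
  have h1 := (logProp_upperPart hL).union (logProp_lowerPart hL) (isOpen_upperPart hL)
    (isOpen_lowerPart hL) (by
      rw [upperPart_inter_lowerPart]
      exact hc.prod isPreconnected_univ)
  rw [upper_union_lower_line h] at h1
  have h2 := logProp_preimage_homeomorph (straighten ψ φ).symm h1
  rw [← preimage_comp] at h2
  simp only [Homeomorph.self_comp_symm, preimage_id] at h2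
  exact not_logProp_off_axis (by simpa using h2)

theorem rank_le_one_compl_line (h : ∀ t, φ (ψ t) = t) (f f' : ℂ × ℝ → ℂ)
    (hf : ContinuousOn f (upperPart (ψ '' univ) ∪ lowerPart (ψ '' univ)))
    (hf' : ContinuousOn f' (upperPart (ψ '' univ) ∪ lowerPart (ψ '' univ)))
    (h0 : ∀ p ∈ upperPart (ψ '' univ) ∪ lowerPart (ψ '' univ), f p ≠ 0)
    (h0' : ∀ p ∈ upperPart (ψ '' univ) ∪ lowerPart (ψ '' univ), f' p ≠ 0) :
    ∃ a b : ℤ, (a ≠ 0 ∨ b ≠ 0) ∧ HasLogOn (fun p => f p ^ a * f' p ^ b)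
      (upperPart (ψ '' univ) ∪ lowerPart (ψ '' univ)) := by
  rw [upper_union_lower_line h] at *
  set e := straighten ψ φ
  simp only [mem_univ, and_true] at *
  have hm : MapsTo e.symm {p : ℂ × ℝ | p.1 ≠ 0} (e ⁻¹' {p | ¬ p.1 = 0}) := by
    intro p hp; simpa using hp
  obtain ⟨a, b, hab, hl⟩ := rank_le_one_off_axis (fun p => f (e.symm p)) (fun p => f' (e.symm p))
    (hf.comp e.symm.continuous.continuousOn hm) (hf'.comp e.symm.continuous.continuousOn hm)
    (fun p hp => h0 _ (hm hp)) (fun p hp => h0' _ (hm hp))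
  refine ⟨a, b, hab, (hl.comp (φ := e) (s := e ⁻¹' {p | ¬ p.1 = 0}) e.continuous.continuousOn
    fun p hp => hp).congr fun p _ => ?_⟩
  simp

theorem compl_upperPart_nonempty {L : Set ℂ} (hL : L.Nonempty) : (upperPart L)ᶜ.Nonempty := by
  obtain ⟨z, hz⟩ := hL
  exact ⟨(z, 0), fun h => lt_irrefl (0 : ℝ) (h hz)⟩

theorem compl_lowerPart_nonempty {L : Set ℂ} (hL : L.Nonempty) : (lowerPart L)ᶜ.Nonempty := by
  obtain ⟨z, hz⟩ := hL
  exact ⟨(z, 0), fun h => lt_irrefl (0 : ℝ) (h hz)⟩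

theorem false_of_three_pieces_compl_line (h : ∀ t, φ (ψ t) = t) {P Q R : Set ℂ}
    (hP : IsOpen P) (hQ : IsOpen Q) (hR : IsOpen R) (hPQ : Disjoint P Q) (hPR : Disjoint P R)
    (hQR : Disjoint Q R) (hP0 : P.Nonempty) (hQ0 : Q.Nonempty) (hR0 : R.Nonempty)
    (hU : P ∪ Q ∪ R = (ψ '' univ)ᶜ) : False := by
  have hL := isClosed_line_image h isClosed_univ
  have hLn : (ψ '' univ).Nonempty := univ_nonempty.image _
  have hd : ∀ {A B : Set ℂ}, Disjoint A B →
      Disjoint (A ×ˢ (univ : Set ℝ)) (B ×ˢ (univ : Set ℝ)) := fun hAB =>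
    disjoint_left.2 fun p hp hp' => disjoint_left.1 hAB hp.1 hp'.1
  refine not_three_pieces_of_rank_le_one (isOpen_upperPart hL) (isOpen_lowerPart hL)
    (compl_upperPart_nonempty hLn) (compl_lowerPart_nonempty hLn) (rank_le_one_compl_line h)
    (isPreconnected_upperPart _) (isPreconnected_lowerPart _) (hP.prod isOpen_univ)
    (hQ.prod isOpen_univ) (hR.prod isOpen_univ) (hd hPQ) (hd hPR) (hd hQR)
    (hP0.prod univ_nonempty) (hQ0.prod univ_nonempty) (hR0.prod univ_nonempty) ?_
  rw [upperPart_inter_lowerPart, ← hU]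
  ext p; simp

/-- The complement of a properly embedded line minus an open subarc is connected. -/
theorem isPreconnected_compl_line_gap (h : ∀ t, φ (ψ t) = t) (t₀ ε : ℝ) (hε : 0 < ε) :
    IsPreconnected (ψ '' {t | ε ≤ |t - t₀|})ᶜ := by
  have hL := isClosed_line_image h (M := {t | ε ≤ |t - t₀|})
    (isClosed_le continuous_const (by fun_prop))
  have hLn : (ψ '' {t | ε ≤ |t - t₀|}).Nonempty :=
    ⟨_, t₀ + ε, by simp [abs_of_pos hε], rfl⟩
  have h1 := LogProp.isPreconnected_inter (isOpen_upperPart hL) (isOpen_lowerPart hL)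
    (compl_upperPart_nonempty hLn) (compl_lowerPart_nonempty hLn) (by
      rw [upper_union_lower_line h]
      exact logProp_preimage_homeomorph _ (logProp_compl_rays t₀ ε hε))
    (isPreconnected_upperPart _) (isPreconnected_lowerPart _)
  rw [upperPart_inter_lowerPart] at h1
  have := h1.image Prod.fst continuous_fst.continuousOn
  rwa [fst_image_prod _ univ_nonempty] at this

theorem line_subset_closure (h : ∀ t, φ (ψ t) = t) {P Q : Set ℂ} (hP : IsOpen P) (hQ : IsOpen Q)
    (hPQ : Disjoint P Q) (hP0 : P.Nonempty) (hQ0 : Q.Nonempty) (hU : P ∪ Q = (ψ '' univ)ᶜ) :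
    ψ '' univ ⊆ closure P := by
  rintro _ ⟨t₀, -, rfl⟩
  by_contra hcl
  have hN := isClosed_closure (s := P).isOpen_compl
  obtain ⟨ε, hε, hball⟩ := Metric.mem_nhds_iff.1
    (ψ.continuous.continuousAt.preimage_mem_nhds (hN.mem_nhds hcl))
  have hc := isPreconnected_compl_line_gap h t₀ ε hε
  set N := (closure P)ᶜ
  have hNP : Disjoint P N := disjoint_left.2 fun x hx hx' => hx' (subset_closure hx)
  have hsub : (ψ '' {t | ε ≤ |t - t₀|})ᶜ ⊆ P ∪ (Q ∪ N) := by
    intro z hz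
    by_cases hzL : z ∈ ψ '' univ
    · obtain ⟨t, -, rfl⟩ := hzL
      refine Or.inr (Or.inr (hball ?_))
      rw [Metric.mem_ball, Real.dist_eq]
      by_contra hcon
      exact hz ⟨t, not_lt.1 hcon, rfl⟩
    · have : z ∈ P ∪ Q := hU ▸ hzL
      exact this.elim Or.inl fun h => Or.inr (Or.inl h)
  have hin : ∀ z ∈ P ∪ Q, z ∈ (ψ '' {t | ε ≤ |t - t₀|})ᶜ := by
    intro z hz
    rw [hU] at hz
    exact fun hz' => hz (image_mono (subset_univ _) hz')
  rw [isPreconnected_iff_subset_of_disjoint] at hc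
  obtain ⟨p, hp⟩ := hP0
  obtain ⟨q, hq⟩ := hQ0
  have hd : Disjoint P (Q ∪ N) := disjoint_union_right.2 ⟨hPQ, hNP⟩
  rcases hc P (Q ∪ N) hP (hQ.union hN) hsub (by rw [hd.inter_eq, inter_empty]) with h1 | h1
  · exact disjoint_left.1 hPQ (h1 (hin q (Or.inr hq))) hq
  · exact disjoint_left.1 hd hp (h1 (hin p (Or.inl hp)))

/-- Jordan curve theorem for properly embedded lines in the plane. -/
theorem jordan_line (h : ∀ t, φ (ψ t) = t) : ∃ P Q : Set ℂ, IsOpen P ∧ IsOpen Q ∧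
    IsConnected P ∧ IsConnected Q ∧ Disjoint P Q ∧ P ∪ Q = (range ψ)ᶜ ∧
    range ψ ⊆ closure P ∧ range ψ ⊆ closure Q := by
  rw [← image_univ]
  obtain ⟨P, Q, hP, hQ, hP0, hQ0, hPQ, hU⟩ :=
    exists_open_split (isClosed_line_image h isClosed_univ).isOpen_compl
      (not_isPreconnected_compl_line h)
  refine ⟨P, Q, hP, hQ, ⟨hP0, ?_⟩, ⟨hQ0, ?_⟩, hPQ, hU,
    line_subset_closure h hP hQ hPQ hP0 hQ0 hU,
    line_subset_closure h hQ hP hPQ.symm hQ0 hP0 (by rw [union_comm, hU])⟩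
  · by_contra hcon
    obtain ⟨A, B, hA, hB, hA0, hB0, hAB, hAU⟩ := exists_open_split hP hcon
    rw [← hAU] at hPQ hU
    exact false_of_three_pieces_compl_line h hA hB hQ hAB (disjoint_union_left.1 hPQ).1
      (disjoint_union_left.1 hPQ).2 hA0 hB0 hQ0 hU
  · by_contra hcon
    obtain ⟨A, B, hA, hB, hA0, hB0, hAB, hAU⟩ := exists_open_split hQ hcon
    rw [← hAU] at hPQ hU
    exact false_of_three_pieces_compl_line h hP hA hB (disjoint_union_right.1 hPQ).1
      (disjoint_union_right.1 hPQ).2 hAB hP0 hA0 hB0 (by rw [union_assoc, hU])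

end PlaneJordan

section Chart

abbrev E3 := EuclideanSpace ℝ (Fin 3)

/-- Inverse stereographic projection from the north pole. -/
noncomputable def invStereo (z : ℂ) : E3 :=
  !₂[2 * z.re / (Complex.normSq z + 1), 2 * z.im / (Complex.normSq z + 1),
    (Complex.normSq z - 1) / (Complex.normSq z + 1)]

/-- The north pole. -/
noncomputable def northPole : E3 := !₂[0, 0, 1]

theorem norm_northPole : ‖northPole‖ = 1 := by
  simp [northPole, EuclideanSpace.norm_eq, Fin.sum_univ_three]

theorem normSq_add_one_pos (z : ℂ) : 0 < Complex.normSq z + 1 := by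
  have := Complex.normSq_nonneg z; linarith

theorem norm_invStereo (z : ℂ) : ‖invStereo z‖ = 1 := by
  have h := (normSq_add_one_pos z).ne'
  rw [EuclideanSpace.norm_eq, Real.sqrt_eq_one]
  simp only [invStereo, Fin.sum_univ_three, Real.norm_eq_abs, sq_abs]
  simp
  field_simp
  rw [Complex.normSq_apply]
  ring

theorem continuous_invStereo : Continuous invStereo := by
  have h : ∀ z : ℂ, Complex.normSq z + 1 ≠ 0 := fun z => (normSq_add_one_pos z).ne'
  have hn := Complex.continuous_normSq
  unfold invStereo
  refine (PiLp.continuous_toLp 2 _).comp (continuous_pi fun i => ?_)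
  fin_cases i
  · exact (continuous_const.mul Complex.continuous_re).div (hn.add continuous_const) h
  · exact (continuous_const.mul Complex.continuous_im).div (hn.add continuous_const) h
  · exact (hn.sub continuous_const).div (hn.add continuous_const) h

theorem invStereo_antipodal {z : ℂ} (hz : z ≠ 0) :
    invStereo (-1 / (starRingEnd ℂ) z) = - invStereo z := by
  have h := (normSq_add_one_pos z).ne'
  have h0 : Complex.normSq z ≠ 0 := by simpa using hz
  have e : -1 / (starRingEnd ℂ) z = -z / (Complex.normSq z : ℂ) := by
    rw [← Complex.mul_conj]
    have : (starRingEnd ℂ) z ≠ 0 := by simpa using hz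
    field_simp
  have en : Complex.normSq (-1 / (starRingEnd ℂ) z) = (Complex.normSq z)⁻¹ := by
    simp
  have h2 : (Complex.normSq z)⁻¹ + 1 ≠ 0 := by
    rw [← en]; exact (normSq_add_one_pos _).ne'
  have h3 : 1 + Complex.normSq z ≠ 0 := by rwa [add_comm]
  ext i
  fin_cases i
  · simp only [invStereo, en]
    rw [e]
    simp
    field_simp
    ring
  · simp only [invStereo, en]
    rw [e]
    simp
    field_simp
    ring
  · simp only [invStereo, en]
    simp
    field_simp
    ring

/-- An isometry carrying the north pole to `p`. -/
noncomputable def poleIsometry (p : Sphere2) : E3 ≃ₗᵢ[ℝ] E3 :=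
  (ℝ ∙ (northPole - p.1))ᗮ.reflection

theorem poleIsometry_northPole (p : Sphere2) : poleIsometry p northPole = p.1 :=
  Submodule.reflection_sub (by rw [norm_northPole, mem_sphere_zero_iff_norm.1 p.2])

/-- Inverse stereographic projection from `p`. -/
noncomputable def chart (p : Sphere2) (z : ℂ) : Sphere2 :=
  ⟨poleIsometry p (invStereo z), by
    rw [mem_sphere_zero_iff_norm, LinearIsometryEquiv.norm_map, norm_invStereo]⟩

/-- Stereographic projection from `p`. -/
noncomputable def chartInv (p : Sphere2) (x : Sphere2) : ℂ :=
  ⟨(poleIsometry p).symm x.1 0 / (1 - (poleIsometry p).symm x.1 2),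
    (poleIsometry p).symm x.1 1 / (1 - (poleIsometry p).symm x.1 2)⟩

theorem continuous_chart (p : Sphere2) : Continuous (chart p) :=
  Continuous.subtype_mk ((poleIsometry p).continuous.comp continuous_invStereo) _

theorem antipodal_chart (p : Sphere2) {z : ℂ} (hz : z ≠ 0) :
    chart p (-1 / (starRingEnd ℂ) z) = antipodal (chart p z) := by
  apply Subtype.ext
  simp only [chart, antipodal, invStereo_antipodal hz, map_neg]

theorem chart_zero (p : Sphere2) : chart p 0 = antipodal p := by
  apply Subtype.ext
  simp only [chart, antipodal]
  rw [← poleIsometry_northPole p, ← map_neg]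
  congr 1
  ext i
  fin_cases i <;> simp [invStereo, northPole]

theorem chart_ne (p : Sphere2) (z : ℂ) : chart p z ≠ p := by
  intro h
  have h1 := congrArg Subtype.val h
  rw [← poleIsometry_northPole p] at h1
  have h2 := congrArg (fun v : E3 => v 2) ((poleIsometry p).injective h1)
  have h := (normSq_add_one_pos z).ne'
  simp [invStereo, northPole] at h2
  rw [div_eq_one_iff_eq h] at h2
  linarith

theorem chartInv_chart (p : Sphere2) (z : ℂ) : chartInv p (chart p z) = z := by
  have h := (normSq_add_one_pos z).ne'
  have h1 : 1 - (Complex.normSq z - 1) / (Complex.normSq z + 1) = 2 / (Complex.normSq z + 1) := by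
    field_simp; ring
  apply Complex.ext
  · simp [chartInv, chart, invStereo, h1]; field_simp
  · simp [chartInv, chart, invStereo, h1]; field_simp

theorem coord_sq {p : Sphere2} (x : Sphere2) : ((poleIsometry p).symm x.1 0) ^ 2 +
    ((poleIsometry p).symm x.1 1) ^ 2 + ((poleIsometry p).symm x.1 2) ^ 2 = 1 := by
  have h : ‖(poleIsometry p).symm x.1‖ = 1 := by
    rw [LinearIsometryEquiv.norm_map, mem_sphere_zero_iff_norm.1 x.2]
  rw [EuclideanSpace.norm_eq, Real.sqrt_eq_one, Fin.sum_univ_three] at h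
  simpa [Real.norm_eq_abs, sq_abs] using h

theorem coord_ne_one {p x : Sphere2} (hx : x ≠ p) : 1 - (poleIsometry p).symm x.1 2 ≠ 0 := by
  intro h
  apply hx
  apply Subtype.ext
  rw [← poleIsometry_northPole p, ← LinearIsometryEquiv.symm_apply_eq]
  have h2 : (poleIsometry p).symm x.1 2 = 1 := by linarith
  have hs := coord_sq (p := p) x
  rw [h2] at hs
  have h0 : (poleIsometry p).symm x.1 0 = 0 := by
    nlinarith [sq_nonneg ((poleIsometry p).symm x.1 0), sq_nonneg ((poleIsometry p).symm x.1 1)]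
  have h1 : (poleIsometry p).symm x.1 1 = 0 := by
    nlinarith [sq_nonneg ((poleIsometry p).symm x.1 0), sq_nonneg ((poleIsometry p).symm x.1 1)]
  ext i
  fin_cases i
  · simpa [northPole] using h0
  · simpa [northPole] using h1
  · simpa [northPole] using h2

theorem chart_chartInv {p x : Sphere2} (hx : x ≠ p) : chart p (chartInv p x) = x := by
  apply Subtype.ext
  simp only [chart]
  have hs := coord_sq (p := p) x
  have hd := coord_ne_one hx
  rw [← LinearIsometryEquiv.eq_symm_apply]
  set y := (poleIsometry p).symm x.1 with hy
  have hn : Complex.normSq (chartInv p x) = (1 + y 2) / (1 - y 2) := by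
    rw [Complex.normSq_apply]
    simp only [chartInv, ← hy]
    field_simp
    linarith
  have hn1 : Complex.normSq (chartInv p x) + 1 = 2 / (1 - y 2) := by
    rw [hn]; field_simp; ring
  ext i
  fin_cases i
  · simp only [invStereo, hn1]
    simp [chartInv, ← hy]
    field_simp
  · simp only [invStereo, hn1]
    simp [chartInv, ← hy]
    field_simp
  · simp only [invStereo, hn]
    simp
    field_simp
    ring

theorem continuousOn_chartInv (p : Sphere2) : ContinuousOn (chartInv p) {p}ᶜ := by
  have hc : ∀ i : Fin 3, Continuous fun x : Sphere2 => ((poleIsometry p).symm x.1 i : ℝ) := fun i =>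
    ((EuclideanSpace.proj (𝕜 := ℝ) i).continuous.comp (poleIsometry p).symm.continuous).comp
      continuous_subtype_val
  have h : ContinuousOn (fun x : Sphere2 =>
      (((poleIsometry p).symm x.1 0 / (1 - (poleIsometry p).symm x.1 2) : ℝ) : ℂ) +
      (((poleIsometry p).symm x.1 1 / (1 - (poleIsometry p).symm x.1 2) : ℝ) : ℂ) * Complex.I)
      {p}ᶜ := by
    refine ContinuousOn.add ?_ (ContinuousOn.mul ?_ continuousOn_const) <;>
    refine Complex.continuous_ofReal.comp_continuousOn (ContinuousOn.div (hc _).continuousOn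
      (f := fun x : Sphere2 => ((poleIsometry p).symm x.1 _ : ℝ))
      (g := fun x : Sphere2 => (1 - (poleIsometry p).symm x.1 2 : ℝ))
      (Continuous.sub (f := fun _ : Sphere2 => (1 : ℝ)) continuous_const (hc 2)).continuousOn
      fun x hx => coord_ne_one hx)
  refine h.congr fun x _ => ?_
  apply Complex.ext
  · rw [Complex.add_re, Complex.re_ofReal_mul, Complex.ofReal_re]; simp [chartInv]
  · rw [Complex.add_im, Complex.im_ofReal_mul, Complex.ofReal_im]; simp [chartInv]

theorem range_chart (p : Sphere2) : range (chart p) = {p}ᶜ := by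
  ext x
  constructor
  · rintro ⟨z, rfl⟩; exact chart_ne p z
  · intro hx; exact ⟨_, chart_chartInv hx⟩

theorem isOpenEmbedding_chart (p : Sphere2) : IsOpenEmbedding (chart p) := by
  refine ⟨⟨?_, Function.LeftInverse.injective (chartInv_chart p)⟩, ?_⟩
  · rw [isInducing_iff_nhds]
    intro z
    apply le_antisymm
    · exact (continuous_chart p).continuousAt.le_comap
    · have h1 : Tendsto (chartInv p) (𝓝 (chart p z)) (𝓝 z) := by
        have := (continuousOn_chartInv p).continuousAt
          (isOpen_compl_singleton.mem_nhds (chart_ne p z))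
        rwa [ContinuousAt, chartInv_chart] at this
      have h2 := (h1.comp (tendsto_comap (f := chart p)))
      have h3 : chartInv p ∘ chart p = id := funext (chartInv_chart p)
      rwa [h3] at h2
  · rw [range_chart]; exact isOpen_compl_singleton

theorem antipodal_antipodal (x : Sphere2) : antipodal (antipodal x) = x := by
  apply Subtype.ext; simp [antipodal]

theorem antipodal_ne (x : Sphere2) : antipodal x ≠ x := by
  intro h
  have h1 := congrArg Subtype.val h
  simp only [antipodal] at h1
  have h2 : x.1 = 0 := by
    have h3 : (2 : ℝ) • x.1 = 0 := by
      rw [two_smul]; nth_rewrite 1 [← h1]; simp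
    exact (smul_eq_zero.1 h3).resolve_left two_ne_zero
  have := mem_sphere_zero_iff_norm.1 x.2
  rw [h2, norm_zero] at this
  exact zero_ne_one this

theorem continuous_antipodal : Continuous antipodal :=
  Continuous.subtype_mk (continuous_subtype_val.neg) _

/-- The antipodal map as a homeomorphism. -/
noncomputable def antipodalHomeo : Sphere2 ≃ₜ Sphere2 where
  toFun := antipodal
  invFun := antipodal
  left_inv := antipodal_antipodal
  right_inv := antipodal_antipodal
  continuous_toFun := continuous_antipodal
  continuous_invFun := continuous_antipodal

theorem logProp_complex_univ : LogProp (univ : Set ℂ) :=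
  logProp_of_contractible ((starConvex_univ (0 : ℂ)).contractibleSpace univ_nonempty) isOpen_univ

theorem logProp_sphere : LogProp (univ : Set Sphere2) := by
  have hp : ∀ p : Sphere2, LogProp ({p}ᶜ : Set Sphere2) := fun p =>
    logProp_complex_univ.of_inverse (φ := chartInv p) (ψ := chart p) (continuousOn_chartInv p)
      (continuous_chart p).continuousOn (mapsTo_univ _ _) (fun z _ => chart_ne p z)
      fun x hx => chart_chartInv hx
  obtain ⟨p⟩ : Nonempty Sphere2 := ⟨⟨northPole, by simp [norm_northPole]⟩⟩
  have h := (hp p).union (hp (antipodal p)) isOpen_compl_singleton isOpen_compl_singleton (by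
    have : ({p}ᶜ ∩ {antipodal p}ᶜ : Set Sphere2) = chart p '' {0}ᶜ := by
      ext x
      constructor
      · rintro ⟨h1, h2⟩
        refine ⟨chartInv p x, fun h => h2 ?_, chart_chartInv h1⟩
        rw [mem_singleton_iff, ← chart_zero, ← show chartInv p x = 0 from h, chart_chartInv h1]
      · rintro ⟨z, hz, rfl⟩
        refine ⟨chart_ne p z, fun h => hz ?_⟩
        rw [mem_singleton_iff, ← chart_zero] at h
        exact (isOpenEmbedding_chart p).injective h
    rw [this]
    exact (isConnected_compl_singleton_of_one_lt_rank (by simp) 0).isPreconnected.image _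
      (continuous_chart p).continuousOn)
  rwa [← compl_inter, (disjoint_singleton.2 (antipodal_ne p).symm).inter_eq, compl_empty] at h

end Chart

section SphereJordan

/-- A simple closed curve minus a point is a proper line in the stereographic chart. -/
theorem exists_line_of_curve {C : Set Sphere2} (hC : IsSimpleClosedCurve C) {p : Sphere2}
    (hp : p ∈ C) : ∃ (ψ : C(ℝ, ℂ)) (φ : C(ℂ, ℝ)), (∀ t, φ (ψ t) = t) ∧
      range ψ = chart p ⁻¹' C := by
  obtain ⟨h⟩ := hC
  have hCc : CompactSpace C := h.symm.compactSpace
  have hcl : IsClosed C := (isCompact_iff_compactSpace.2 hCc).isClosed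
  have : Fact (Module.finrank ℝ (EuclideanSpace ℝ (Fin 2)) = 1 + 1) := ⟨by simp⟩
  set q : Circle2 := h ⟨p, hp⟩ with hq
  set S := stereographic' 1 q
  set l : EuclideanSpace ℝ (Fin 1) ≃ₜ ℝ :=
    (EuclideanSpace.equiv (Fin 1) ℝ).toHomeomorph.trans (Homeomorph.funUnique (Fin 1) ℝ)
  have hsymm : Continuous S.symm := by
    rw [← continuousOn_univ]
    simpa [S] using S.continuousOn_symm
  have hScont : ContinuousOn S {q}ᶜ := by simpa [S] using S.continuousOn
  have hne : ∀ v, S.symm v ≠ q := by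
    intro v
    have : S.symm v ∈ S.source := S.map_target (by simp [S])
    simpa [S] using this
  have hright : ∀ v, S (S.symm v) = v := fun v => S.right_inv (by simp [S])
  have hleft : ∀ x, x ≠ q → S.symm (S x) = x := fun x hx => S.left_inv (by simpa [S] using hx)
  set γ : ℝ → Sphere2 := fun t => (h.symm (S.symm (l.symm t))).1 with hγ
  have hγp : ∀ t, γ t ≠ p := by
    intro t ht
    apply hne (l.symm t)
    rw [hq, ← h.symm_apply_eq]
    exact Subtype.ext ht
  have hγc : Continuous γ := continuous_subtype_val.comp
    (h.symm.continuous.comp (hsymm.comp l.symm.continuous))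
  let ψ : C(ℝ, ℂ) := ⟨fun t => chartInv p (γ t), by
    exact (continuousOn_chartInv p).comp_continuous hγc hγp⟩
  have hψ : ∀ t, chart p (ψ t) = γ t := fun t => chart_chartInv (hγp t)
  have hLcl : IsClosed (chart p ⁻¹' C) := hcl.preimage (continuous_chart p)
  have hLne : ∀ z : chart p ⁻¹' C, h ⟨chart p z.1, z.2⟩ ≠ q := by
    intro z hz
    exact chart_ne p z.1 (congrArg Subtype.val (h.injective hz))
  let f : C(chart p ⁻¹' C, ℝ) := ⟨fun z => l (S (h ⟨chart p z.1, z.2⟩)), by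
    refine l.continuous.comp (hScont.comp_continuous (h.continuous.comp ?_) hLne)
    exact Continuous.subtype_mk ((continuous_chart p).comp continuous_subtype_val) _⟩
  obtain ⟨φ, hφ⟩ := f.exists_restrict_eq hLcl
  have hφ' : ∀ z (hz : z ∈ chart p ⁻¹' C), φ z = l (S (h ⟨chart p z, hz⟩)) := fun z hz =>
    congrArg (fun g : C(chart p ⁻¹' C, ℝ) => g ⟨z, hz⟩) hφ
  have hψC : ∀ t, ψ t ∈ chart p ⁻¹' C := fun t => by
    rw [mem_preimage, hψ]; exact (h.symm (S.symm (l.symm t))).2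
  refine ⟨ψ, φ, fun t => ?_, ?_⟩
  · rw [hφ' _ (hψC t)]
    have : (⟨chart p (ψ t), hψC t⟩ : C) = h.symm (S.symm (l.symm t)) := Subtype.ext (hψ t)
    rw [this]
    simp [hright]
  · apply Subset.antisymm
    · rintro _ ⟨t, rfl⟩; exact hψC t
    · intro z hz
      refine ⟨l (S (h ⟨chart p z, hz⟩)), ?_⟩
      apply (isOpenEmbedding_chart p).injective
      rw [hψ]
      simp only [hγ, Homeomorph.symm_apply_apply]
      rw [hleft _ (hLne ⟨z, hz⟩), Homeomorph.symm_apply_apply]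

theorem isCompact_of_curve {C : Set Sphere2} (hC : IsSimpleClosedCurve C) :
    IsCompact C := by
  obtain ⟨h⟩ := hC
  exact isCompact_iff_compactSpace.2 h.symm.compactSpace

theorem nonempty_of_curve {X : Type*} [TopologicalSpace X] {C : Set X}
    (hC : IsSimpleClosedCurve C) : C.Nonempty := by
  obtain ⟨h⟩ := hC
  exact ⟨_, (h.symm ⟨EuclideanSpace.single 0 1, by simp⟩).2⟩

/-- Jordan curve theorem on the sphere. -/
theorem jordan_sphere {C : Set Sphere2} (hC : IsSimpleClosedCurve C) :
    ∃ P Q : Set Sphere2, IsOpen P ∧ IsOpen Q ∧ IsConnected P ∧ IsConnected Q ∧ Disjoint P Q ∧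
      P ∪ Q = Cᶜ ∧ C ⊆ closure P ∧ C ⊆ closure Q := by
  obtain ⟨p, hp⟩ := nonempty_of_curve hC
  obtain ⟨ψ, φ, h, hr⟩ := exists_line_of_curve hC hp
  obtain ⟨P, Q, hP, hQ, hPc, hQc, hPQ, hU, hcP, hcQ⟩ := jordan_line h
  have hcl : ∀ A : Set ℂ, range ψ ⊆ closure A → C ⊆ closure (chart p '' A) := by
    intro A hA
    have h1 : ∀ x ∈ C, x ≠ p → x ∈ closure (chart p '' A) := by
      intro x hx hxp
      have h2 : chartInv p x ∈ range ψ := by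
        rw [hr, mem_preimage, chart_chartInv hxp]; exact hx
      have := image_closure_subset_closure_image (continuous_chart p) (mem_image_of_mem _ (hA h2))
      rwa [chart_chartInv hxp] at this
    intro x hx
    by_cases hxp : x = p
    · subst hxp
      by_contra hcon
      have hK : IsCompact (C ∩ closure (chart x '' A)) :=
          (isCompact_of_curve hC).inter_right isClosed_closure
      have hsub : C ∩ closure (chart x '' A) ⊆ {x}ᶜ := fun y hy hyx => hcon (by
        rw [mem_singleton_iff] at hyx; exact hyx ▸ hy.2)
      have hK2 := (hK.image_of_continuousOn ((continuousOn_chartInv x).mono hsub)).image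
        φ.continuous
      have : φ '' (chartInv x '' (C ∩ closure (chart x '' A))) = univ := by
        rw [eq_univ_iff_forall]
        intro t
        have hm : chart x (ψ t) ∈ C := by
          have : ψ t ∈ chart x ⁻¹' C := hr ▸ mem_range_self t
          exact this
        exact ⟨_, ⟨_, ⟨hm, h1 _ hm (chart_ne x _)⟩, chartInv_chart x _⟩, h t⟩
      rw [this] at hK2
      exact noncompact_univ ℝ hK2
    · exact h1 x hx hxp
  refine ⟨chart p '' P, chart p '' Q, (isOpenEmbedding_chart p).isOpenMap _ hP,
    (isOpenEmbedding_chart p).isOpenMap _ hQ, hPc.image _ (continuous_chart p).continuousOn,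
    hQc.image _ (continuous_chart p).continuousOn,
    (disjoint_image_iff (isOpenEmbedding_chart p).injective).2 hPQ, ?_, hcl P hcP, hcl Q hcQ⟩
  rw [← image_union, hU, hr, ← preimage_compl, image_preimage_eq_inter_range, range_chart,
    inter_eq_left]
  intro x hx hxp
  rw [mem_singleton_iff] at hxp
  exact hx (hxp ▸ hp)

end SphereJordan

section PlaneLog

/-- Points off `K` about which `K` does not wind. -/
def unwound (K : Set ℂ) : Set ℂ := {w | w ∉ K ∧ HasLogOn (fun z => z - w) K}

theorem hasLogOn_const {X : Type*} [TopologicalSpace X] {c : ℂ} (hc : c ≠ 0) (s : Set X) :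
    HasLogOn (fun _ => c) s :=
  ⟨fun _ => Complex.log c, continuousOn_const, fun _ _ => Complex.exp_log hc⟩

theorem hasLogOn_sub_of_near {K : Set ℂ} {w₀ w : ℂ} {r : ℝ} (hr : ball w₀ r ⊆ Kᶜ)
    (hw : ‖w - w₀‖ < r) : HasLogOn (fun z => (z - w) * (z - w₀)⁻¹) K := by
  have hd : ∀ z ∈ K, r ≤ ‖z - w₀‖ := by
    intro z hz
    by_contra hcon
    exact hr (by rw [mem_ball, dist_eq_norm]; exact not_le.1 hcon) hz
  have hr0 : 0 < r := (norm_nonneg _).trans_lt hw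
  have hne : ∀ z ∈ K, z - w₀ ≠ 0 := fun z hz => norm_pos_iff.1 (hr0.trans_le (hd z hz))
  refine hasLogOn_of_norm_sub_one_lt ?_ ?_
  · exact (continuousOn_id.sub continuousOn_const).mul
      ((continuousOn_id.sub continuousOn_const).inv₀ hne)
  · intro z hz
    have : (z - w) * (z - w₀)⁻¹ - 1 = -(w - w₀) / (z - w₀) := by
      have := hne z hz
      field_simp
      ring
    rw [this, norm_div, norm_neg, div_lt_one (hr0.trans_le (hd z hz))]
    exact hw.trans_le (hd z hz)

theorem mem_unwound_congr {K : Set ℂ} {w₀ : ℂ} {r : ℝ} (hr0 : 0 < r) (hr : ball w₀ r ⊆ Kᶜ) :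
    ∀ w ∈ ball w₀ r, (w ∈ unwound K ↔ w₀ ∈ unwound K) := by
  intro w hw
  have hw0 : w₀ ∉ K := hr (mem_ball_self hr0)
  have hwK : w ∉ K := hr hw
  have h1 := hasLogOn_sub_of_near hr (by rwa [mem_ball, dist_eq_norm] at hw)
  constructor
  · rintro ⟨-, h2⟩
    refine ⟨hw0, (h1.inv.mul h2).congr fun z hz => ?_⟩
    have : z - w ≠ 0 := sub_ne_zero.2 fun h => hwK (h ▸ hz)
    field_simp
  · rintro ⟨-, h2⟩
    refine ⟨hwK, (h1.mul h2).congr fun z hz => ?_⟩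
    have : z - w₀ ≠ 0 := sub_ne_zero.2 fun h => hw0 (h ▸ hz)
    field_simp

theorem isOpen_unwound {K : Set ℂ} (hK : IsClosed K) : IsOpen (unwound K) := by
  rw [Metric.isOpen_iff]
  intro w hw
  obtain ⟨r, hr, hb⟩ := Metric.isOpen_iff.1 hK.isOpen_compl w hw.1
  exact ⟨r, hr, fun w' hw' => (mem_unwound_congr hr hb w' hw').2 hw⟩

theorem isOpen_wound {K : Set ℂ} (hK : IsClosed K) : IsOpen (Kᶜ \ unwound K) := by
  rw [Metric.isOpen_iff]
  rintro w ⟨hwK, hw⟩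
  obtain ⟨r, hr, hb⟩ := Metric.isOpen_iff.1 hK.isOpen_compl w hwK
  exact ⟨r, hr, fun w' hw' => ⟨hb hw', fun h => hw ((mem_unwound_congr hr hb w' hw').1 h)⟩⟩

theorem exists_forall_lt_mem_unwound {K : Set ℂ} (hK : Bornology.IsBounded K) :
    ∃ R : ℝ, ∀ w : ℂ, R < ‖w‖ → w ∈ unwound K := by
  obtain ⟨R, hR⟩ := hK.exists_norm_le
  refine ⟨max R 0, fun w hw => ?_⟩
  have hw1 : R < ‖w‖ := (le_max_left _ _).trans_lt hw
  have hw0 : w ≠ 0 := norm_pos_iff.1 ((le_max_right _ _).trans_lt hw)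
  refine ⟨fun h => not_lt.2 (hR w h) hw1, ?_⟩
  have h1 : HasLogOn (fun z => 1 - z / w) K := by
    refine hasLogOn_of_norm_sub_one_lt (by fun_prop) fun z hz => ?_
    rw [show 1 - z / w - 1 = -(z / w) by ring, norm_neg, norm_div, div_lt_one (norm_pos_iff.2 hw0)]
    exact (hR z hz).trans_lt hw1
  refine (h1.mul (hasLogOn_const (neg_ne_zero.2 hw0) K)).congr fun z _ => ?_
  field_simp
  ring

/-- An unbounded connected set off `K` consists of points about which `K` does not wind. -/
theorem subset_unwound_of_unbounded {K S : Set ℂ} (hK : IsCompact K) (hS : IsPreconnected S)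
    (hSK : Disjoint S K) (hSb : ¬ Bornology.IsBounded S) : S ⊆ unwound K := by
  obtain ⟨R, hR⟩ := exists_forall_lt_mem_unwound hK.isBounded
  have hex : ∃ w ∈ S, R < ‖w‖ := by
    by_contra! hcon
    exact hSb (isBounded_iff_forall_norm_le.2 ⟨R, hcon⟩)
  obtain ⟨w, hwS, hw⟩ := hex
  have hd : Disjoint (unwound K) (Kᶜ \ unwound K) := disjoint_sdiff_right
  rcases (isPreconnected_iff_subset_of_disjoint.1 hS) _ _ (isOpen_unwound hK.isClosed)
    (isOpen_wound hK.isClosed) (fun z hz => by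
      by_cases h : z ∈ unwound K
      · exact Or.inl h
      · exact Or.inr ⟨disjoint_left.1 hSK hz, h⟩) (by rw [hd.inter_eq, inter_empty]) with h | h
  · exact h
  · exact absurd (hR w hw) (h hwS).2

theorem mem_unwound_of_mem_closure {K S : Set ℂ} (hK : IsCompact K) (hS : S ⊆ unwound K) {w : ℂ}
    (hw : w ∈ closure S) (hwK : w ∉ K) : w ∈ unwound K := by
  by_contra hcon
  obtain ⟨z, hz, hzS⟩ := mem_closure_iff.1 hw _ (isOpen_wound hK.isClosed) ⟨hwK, hcon⟩
  exact hz.2 (hS hzS)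

/-- Logarithms on all compact subsets patch to a logarithm on a connected open set. -/
theorem hasLogOn_of_compacts {U : Set ℂ} (hU : IsOpen U) (hUc : IsConnected U) {f : ℂ → ℂ}
    (h : ∀ K ⊆ U, IsCompact K → HasLogOn f K) : HasLogOn f U := by
  obtain ⟨a, ha⟩ := hUc.nonempty
  have hf0 : ∀ z ∈ U, f z ≠ 0 := fun z hz => by
    obtain ⟨g, -, hg⟩ := h {z} (singleton_subset_iff.2 hz) isCompact_singleton
    rw [← hg z rfl]; exact Complex.exp_ne_zero _
  -- normalized logarithms
  have hnorm : ∀ K ⊆ U, IsCompact K → ∃ g : ℂ → ℂ, ContinuousOn g K ∧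
      (∀ z ∈ K, Complex.exp (g z) = f z) ∧ (a ∈ K → g a = Complex.log (f a)) := by
    intro K hKU hK
    obtain ⟨g, hg, hgf⟩ := h K hKU hK
    by_cases haK : a ∈ K
    · have : Complex.exp (Complex.log (f a) - g a) = 1 := by
        rw [Complex.exp_sub, hgf a haK, Complex.exp_log (hf0 a ha), div_self (hf0 a ha)]
      exact ⟨fun z => g z + (Complex.log (f a) - g a), hg.add continuousOn_const,
        fun z hz => by rw [Complex.exp_add, this, mul_one, hgf z hz], fun _ => by ring⟩
    · exact ⟨g, hg, hgf, fun h => absurd h haK⟩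
  have huniq : ∀ K ⊆ U, IsPreconnected K → a ∈ K → ∀ g g' : ℂ → ℂ, ContinuousOn g K →
      ContinuousOn g' K → (∀ z ∈ K, Complex.exp (g z) = f z) →
      (∀ z ∈ K, Complex.exp (g' z) = f z) → g a = g' a → ∀ z ∈ K, g z = g' z := by
    intro K _ hK haK g g' hg hg' hgf hgf' he z hz
    obtain ⟨k, hk⟩ := log_unique_of_preconnected hK hg hg' fun x hx => by rw [hgf x hx, hgf' x hx]
    have h1 := hk a haK
    rw [he] at h1
    have h2 : (k : ℂ) * (2 * Real.pi * Complex.I) = 0 := by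
      have := congrArg (fun x => x - g' a) h1
      simpa using this.symm
    rw [hk z hz, h2, add_zero]
  have hpath : ∀ z ∈ U, ∃ K ⊆ U, IsCompact K ∧ IsPreconnected K ∧ a ∈ K ∧ z ∈ K := by
    intro z hz
    obtain ⟨γ, hγ⟩ := (hU.isConnected_iff_isPathConnected.1 hUc).joinedIn a ha z hz
    exact ⟨range γ, range_subset_iff.2 hγ, isCompact_range γ.continuous,
      isPreconnected_range γ.continuous, ⟨0, γ.source⟩, ⟨1, γ.target⟩⟩
  choose! K hKU hKc hKp haK hzK using hpath
  choose! g hg hgf hga using hnorm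
  have hkey : ∀ z ∈ U, ∀ L ⊆ U, IsCompact L → IsPreconnected L → a ∈ L → z ∈ L →
      g (K z) z = g L z := by
    intro z hz L hLU hL hLp haL hzL
    have hUn : K z ∪ L ⊆ U := union_subset (hKU z hz) hLU
    have hUc := (hKc z hz).union hL
    have ha' : a ∈ K z ∪ L := Or.inl (haK z hz)
    have h1 := huniq (K z) (hKU z hz) (hKp z hz) (haK z hz) (g (K z)) (g (K z ∪ L))
      (hg _ (hKU z hz) (hKc z hz)) ((hg _ hUn hUc).mono subset_union_left)
      (hgf _ (hKU z hz) (hKc z hz)) (fun x hx => hgf _ hUn hUc x (Or.inl hx))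
      (by rw [hga _ (hKU z hz) (hKc z hz) (haK z hz), hga _ hUn hUc ha']) z (hzK z hz)
    have h2 := huniq L hLU hLp haL (g L) (g (K z ∪ L))
      (hg _ hLU hL) ((hg _ hUn hUc).mono subset_union_right)
      (hgf _ hLU hL) (fun x hx => hgf _ hUn hUc x (Or.inr hx))
      (by rw [hga _ hLU hL haL, hga _ hUn hUc ha']) z hzL
    rw [h1, h2]
  refine ⟨fun z => g (K z) z, ?_, fun z hz => hgf _ (hKU z hz) (hKc z hz) z (hzK z hz)⟩
  intro z hz
  obtain ⟨r, hr, hb⟩ := Metric.nhds_basis_closedBall.mem_iff.1 (hU.mem_nhds hz)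
  set L := K z ∪ closedBall z r
  have hLU : L ⊆ U := union_subset (hKU z hz) hb
  have hL : IsCompact L := (hKc z hz).union (isCompact_closedBall z r)
  have hLp : IsPreconnected L := (hKp z hz).union z (hzK z hz) (mem_closedBall_self hr.le)
    (convex_closedBall z r).isPreconnected
  have hzL : L ∈ 𝓝 z := mem_of_superset (closedBall_mem_nhds z hr) subset_union_right
  have hc : ContinuousAt (g L) z := (hg L hLU hL).continuousAt hzL
  refine (hc.congr ?_).continuousWithinAt
  filter_upwards [hzL] with w hw
  exact (hkey w (hLU hw) L hLU hL hLp (Or.inl (haK z hz)) hw).symm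

end PlaneLog

section FiniteZeros

/-- A function on a punctured disc is a power times an exponential. -/
theorem exists_zpow_log_punctured_ball (a : ℂ) {r : ℝ} (hr : 0 < r) {f : ℂ → ℂ}
    (hf : ContinuousOn f (ball a r \ {a})) (h0 : ∀ z ∈ ball a r \ {a}, f z ≠ 0) :
    ∃ n : ℤ, HasLogOn (fun z => f z * (z - a) ^ n) (ball a r \ {a}) := by
  -- parametrize the punctured disc by a map to `{p | p.1 ≠ 0}`
  let θ : ℂ → ℂ := fun w => a + (r / (1 + ‖w‖) : ℝ) * w
  have hpos : ∀ w : ℂ, 0 < 1 + ‖w‖ := fun w => by positivity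
  have hθc : Continuous θ := by
    have : Continuous fun w : ℂ => r / (1 + ‖w‖) :=
      continuous_const.div (by fun_prop) fun w => (hpos w).ne'
    exact continuous_const.add ((Complex.continuous_ofReal.comp this).mul continuous_id)
  have hθm : ∀ w : ℂ, w ≠ 0 → θ w ∈ ball a r \ {a} := by
    intro w hw
    have h1 := hpos w
    constructor
    · rw [mem_ball, dist_eq_norm]
      simp only [θ, add_sub_cancel_left, norm_mul, Complex.norm_real, Real.norm_eq_abs]
      rw [abs_of_pos (by positivity), div_mul_eq_mul_div, div_lt_iff₀ h1]
      nlinarith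
    · simp only [θ, mem_singleton_iff, add_eq_left, mul_eq_zero, not_or]
      exact ⟨by exact_mod_cast (div_pos hr h1).ne', hw⟩
  obtain ⟨n, hn⟩ := exists_zpow_log_off_axis (f := fun p => f (θ p.1))
    (hf.comp (hθc.comp continuous_fst).continuousOn fun p hp => hθm _ hp)
    (fun p hp => h0 _ (hθm _ hp))
  let η : ℂ → ℂ := fun z => (1 / (r - ‖z - a‖) : ℝ) * (z - a)
  have hlt : ∀ z ∈ ball a r, 0 < r - ‖z - a‖ := fun z hz => by
    rw [mem_ball, dist_eq_norm] at hz; linarith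
  have hηc : ContinuousOn η (ball a r) := by
    have : ContinuousOn (fun z : ℂ => 1 / (r - ‖z - a‖)) (ball a r) :=
      continuousOn_const.div (by fun_prop) fun z hz => (hlt z hz).ne'
    exact (Complex.continuous_ofReal.comp_continuousOn this).mul (by fun_prop)
  have hη0 : ∀ z ∈ ball a r \ {a}, η z ≠ 0 := by
    intro z hz
    refine mul_ne_zero ?_ (sub_ne_zero.2 hz.2)
    exact_mod_cast (one_div_pos.2 (hlt z hz.1)).ne'
  have hθη : ∀ z ∈ ball a r, θ (η z) = z := by
    intro z hz
    have h1 := hlt z hz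
    have h2 : ‖η z‖ = ‖z - a‖ / (r - ‖z - a‖) := by
      simp only [η, norm_mul, Complex.norm_real, Real.norm_eq_abs]
      rw [abs_of_pos (by positivity)]; ring
    have h3 : r / (1 + ‖η z‖) = r - ‖z - a‖ := by
      rw [h2]; field_simp; ring
    simp only [θ]
    rw [h3]
    simp only [η]
    have : ((r - ‖z - a‖ : ℝ) : ℂ) ≠ 0 := by exact_mod_cast h1.ne'
    push_cast at this ⊢
    field_simp
    ring
  have h1 := hn.comp (φ := fun z => (η z, (0 : ℝ))) (s := ball a r \ {a})
    ((hηc.mono sdiff_subset).prodMk continuousOn_const) (fun z hz => hη0 z hz)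
  -- `η z` and `z - a` differ by a positive factor
  have h2 : HasLogOn (fun z => (r - ‖z - a‖ : ℂ)) (ball a r \ {a}) := by
    refine ⟨fun z => (Real.log (r - ‖z - a‖) : ℝ), ?_, ?_⟩
    · refine Complex.continuous_ofReal.comp_continuousOn (ContinuousOn.log (by fun_prop) ?_)
      exact fun z hz => (hlt z hz.1).ne'
    · intro z hz
      dsimp only
      rw [← Complex.ofReal_exp, Real.exp_log (hlt z hz.1)]
      push_cast
      ring
  refine ⟨n, (h1.mul (h2.zpow n)).congr fun z hz => ?_⟩
  have h3 : ((r - ‖z - a‖ : ℝ) : ℂ) ≠ 0 := by exact_mod_cast (hlt z hz.1).ne'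
  dsimp only
  rw [hθη z hz.1, mul_assoc, ← mul_zpow]
  congr 2
  simp only [η]
  push_cast at h3 ⊢
  field_simp

/-- A nonvanishing function off a finite set is a product of powers times an exponential. -/
theorem exists_prod_zpow_log (Z : Finset ℂ) : ∀ f : ℂ → ℂ, ContinuousOn f (Z : Set ℂ)ᶜ →
    (∀ z ∉ Z, f z ≠ 0) →
    ∃ n : ℂ → ℤ, HasLogOn (fun z => f z * ∏ a ∈ Z, (z - a) ^ n a) (Z : Set ℂ)ᶜ := by
  classical
  induction Z using Finset.induction_on with
  | empty =>
    intro f hf h0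
    refine ⟨0, ?_⟩
    simpa using logProp_complex_univ f (by simpa using hf) (by simpa using h0)
  | insert a Z ha ih =>
    intro f hf h0
    have hopen : IsOpen ((Z : Set ℂ)ᶜ) := Z.finite_toSet.isClosed.isOpen_compl
    obtain ⟨r, hr, hb⟩ := Metric.isOpen_iff.1 hopen a (by simpa using ha)
    have hsub : ball a r \ {a} ⊆ ((insert a Z : Finset ℂ) : Set ℂ)ᶜ := by
      intro z hz h
      rw [Finset.coe_insert] at h
      exact h.elim (fun h => hz.2 h) fun h => hb hz.1 h
    obtain ⟨n, l, hl, hlf⟩ := exists_zpow_log_punctured_ball a hr (hf.mono hsub)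
      (fun z hz => h0 z (by simpa using hsub hz))
    -- cutoff, zero near `a` and one near the boundary of the disc
    let η : ℂ → ℝ := fun z => max 0 (min 1 (3 * ‖z - a‖ / r - 1))
    have hηc : Continuous η := by
      have : Continuous fun z : ℂ => 3 * ‖z - a‖ / r - 1 := by fun_prop
      exact continuous_const.max (continuous_const.min this)
    have hη0 : ∀ z ∈ ball a (r / 3), η z = 0 := by
      intro z hz
      rw [mem_ball, dist_eq_norm] at hz
      refine max_eq_left ((min_le_right _ _).trans ?_)
      rw [sub_nonpos, div_le_one hr]; linarith
    have hη1 : ∀ z, z ∉ closedBall a (2 * r / 3) → η z = 1 := by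
      intro z hz
      rw [mem_closedBall, dist_eq_norm, not_le] at hz
      have : 1 ≤ 3 * ‖z - a‖ / r - 1 := by
        rw [le_sub_iff_add_le, le_div_iff₀ hr]; linarith
      simp only [η]
      rw [min_eq_left this]; simp
    set lam : ℂ → ℂ := fun z => if z ∈ ball a r then (1 - η z : ℝ) * l z else 0 with hlam
    have hlamc : ContinuousOn lam {a}ᶜ := by
      intro z hz
      apply ContinuousAt.continuousWithinAt
      by_cases hzb : z ∈ ball a r
      · have h1 : ContinuousAt l z := hl.continuousAt
          ((isOpen_ball.sdiff isClosed_singleton).mem_nhds ⟨hzb, hz⟩)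
        have h2 : ContinuousAt (fun z => ((1 - η z : ℝ) : ℂ) * l z) z :=
          (Complex.continuous_ofReal.comp (continuous_const.sub hηc)).continuousAt.mul h1
        refine h2.congr ?_
        filter_upwards [isOpen_ball.mem_nhds hzb] with w hw
        simp only [hlam, if_pos hw]
      · have h1 : z ∉ closedBall a (2 * r / 3) := fun h => hzb (by
          rw [mem_closedBall] at h; rw [mem_ball]; linarith)
        refine (continuousAt_const (y := (0 : ℂ))).congr ?_
        filter_upwards [isClosed_closedBall.isOpen_compl.mem_nhds h1] with w hw
        simp [hlam, hη1 w hw]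
    -- the modified function
    set F : ℂ → ℂ := fun z => if z ∈ ball a (r / 3) then 1 else
      f z * (z - a) ^ n * Complex.exp (-lam z) with hF
    have hnear : ∀ z ∈ ball a (r / 3), z ≠ a →
        f z * (z - a) ^ n * Complex.exp (-lam z) = 1 := by
      intro z hz hza
      have hzr : z ∈ ball a r := ball_subset_ball (by linarith) hz
      have : lam z = l z := by simp only [hlam, if_pos hzr, hη0 z hz]; simp
      rw [this, Complex.exp_neg, hlf z ⟨hzr, hza⟩]
      have h1 : f z * (z - a) ^ n ≠ 0 := mul_ne_zero (h0 z (by simpa using hsub ⟨hzr, hza⟩))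
        (zpow_ne_zero _ (sub_ne_zero.2 hza))
      exact mul_inv_cancel₀ h1
    have hFeq : ∀ z, z ≠ a → F z = f z * (z - a) ^ n * Complex.exp (-lam z) := by
      intro z hza
      simp only [hF]
      split_ifs with h
      · exact (hnear z h hza).symm
      · rfl
    have hFc : ContinuousOn F (Z : Set ℂ)ᶜ := by
      intro z hz
      apply ContinuousAt.continuousWithinAt
      by_cases hza : z = a
      · refine (continuousAt_const (y := (1 : ℂ))).congr ?_
        filter_upwards [isOpen_ball.mem_nhds (by rw [hza]; exact mem_ball_self (by linarith) :
          z ∈ ball a (r / 3))] with w hw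
        simp only [hF, if_pos hw]
      · have hzI : ((insert a Z : Finset ℂ) : Set ℂ)ᶜ ∈ 𝓝 z := by
          refine (insert a Z).finite_toSet.isClosed.isOpen_compl.mem_nhds ?_
          rw [Finset.coe_insert]
          exact fun h => h.elim hza hz
        have h1 : ContinuousAt f z := hf.continuousAt hzI
        have h2 : ContinuousAt (fun w : ℂ => (w - a) ^ n) z :=
          (continuousAt_id.sub continuousAt_const).zpow₀ n (Or.inl (sub_ne_zero.2 hza))
        have h3 : ContinuousAt lam z :=
          hlamc.continuousAt (isOpen_compl_singleton.mem_nhds hza)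
        refine ((h1.mul h2).mul h3.neg.cexp).congr ?_
        filter_upwards [isOpen_compl_singleton.mem_nhds hza] with w hw
        exact (hFeq w hw).symm
    have hF0 : ∀ z ∉ Z, F z ≠ 0 := by
      intro z hz
      by_cases hza : z = a
      · simp only [hF]
        rw [if_pos (by rw [hza]; exact mem_ball_self (by linarith))]
        exact one_ne_zero
      · rw [hFeq z hza]
        exact mul_ne_zero (mul_ne_zero (h0 z (by simp [hza, hz]))
          (zpow_ne_zero _ (sub_ne_zero.2 hza))) (Complex.exp_ne_zero _)
    obtain ⟨m, hm⟩ := ih F hFc hF0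
    refine ⟨fun b => if b = a then n else m b, ?_⟩
    have hlamlog : HasLogOn (fun z => Complex.exp (lam z)) ((insert a Z : Finset ℂ) : Set ℂ)ᶜ :=
      ⟨lam, hlamc.mono fun z hz hza => hz (by rw [mem_singleton_iff] at hza; simp [hza]),
        fun _ _ => rfl⟩
    refine ((hm.mono (by simp)).mul hlamlog).congr fun z hz => ?_
    have hza : z ≠ a := fun h => hz (by simp [h])
    dsimp only
    rw [hFeq z hza, Finset.prod_insert ha, if_pos rfl]
    have hprod : ∏ b ∈ Z, (z - b) ^ (if b = a then n else m b) = ∏ b ∈ Z, (z - b) ^ m b :=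
      Finset.prod_congr rfl fun b hb => by
        have : b ≠ a := fun h => ha (h ▸ hb)
        rw [if_neg this]
    rw [hprod, Complex.exp_neg]
    have := Complex.exp_ne_zero (lam z)
    field_simp

end FiniteZeros

section Sard

theorem finite_fiber_of_det_ne_zero {F : ℂ → ℂ} {F' : ℂ → ℂ →L[ℝ] ℂ} {c : ℂ}
    (hF : ∀ x, HasFDerivAt F (F' x) x) (hreg : ∀ x, F x = c → (F' x).det ≠ 0)
    (hb : Bornology.IsBounded (F ⁻¹' {c})) : (F ⁻¹' {c}).Finite := by
  by_contra hinf
  have hc : Continuous F := continuous_iff_continuousAt.2 fun x => (hF x).continuousAt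
  have hcl : IsClosed (F ⁻¹' {c}) := isClosed_singleton.preimage hc
  have hcomp : IsCompact (F ⁻¹' {c}) := Metric.isCompact_of_isClosed_isBounded hcl hb
  obtain ⟨x, hx, hacc⟩ := Set.Infinite.exists_accPt_of_subset_isCompact hinf hcomp Subset.rfl
  have hdet := hreg x hx
  have hker : LinearMap.ker ((F' x) : ℂ →ₗ[ℝ] ℂ) = ⊥ := by
    by_contra hk
    exact hdet (LinearMap.det_eq_zero_iff_ker_ne_bot.2 hk)
  obtain ⟨C, -, hC⟩ := LinearMap.exists_antilipschitzWith ((F' x) : ℂ →ₗ[ℝ] ℂ) hker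
  have hne := (hF x).eventually_ne (c := c) ⟨C, hC⟩
  rw [accPt_iff_frequently_nhdsNE] at hacc
  exact hacc (hne.mono fun z hz => by simpa using hz)

/-- Sard's theorem in the plane: regular values are dense. -/
theorem exists_regular_value {F : ℂ → ℂ} {F' : ℂ → ℂ →L[ℝ] ℂ} (hF : ∀ x, HasFDerivAt F (F' x) x)
    {δ : ℝ} (hδ : 0 < δ) : ∃ c : ℂ, c ≠ 0 ∧ ‖c‖ < δ ∧ ∀ x, F x = c → (F' x).det ≠ 0 := by
  set S : Set ℂ := {x | (F' x).det = 0}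
  have h0 : MeasureTheory.volume (F '' S) = 0 :=
    MeasureTheory.addHaar_image_eq_zero_of_det_fderivWithin_eq_zero MeasureTheory.volume
      (fun x _ => (hF x).hasFDerivWithinAt) fun x hx => hx
  have h1 : MeasureTheory.volume (F '' S ∪ {0}) = 0 :=
    MeasureTheory.measure_union_null h0 (by simp)
  have h2 : 0 < MeasureTheory.volume (ball (0 : ℂ) δ) := measure_ball_pos _ _ hδ
  have h3 : ¬ ball (0 : ℂ) δ ⊆ F '' S ∪ {0} := fun h => by
    have := MeasureTheory.measure_mono_null h h1
    exact h2.ne' this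
  obtain ⟨c, hc, hcS⟩ := not_subset.1 h3
  refine ⟨c, fun h => hcS (Or.inr h), by simpa using hc, fun x hx hd => hcS (Or.inl ⟨x, hd, hx⟩)⟩

/-- If no compact subset of `U` winds about a point off `U`, then nonvanishing holomorphic
functions on `U` have logarithms on compact subsets. -/
theorem hasLogOn_compact_of_unwound {U : Set ℂ} (hU : IsOpen U)
    (hKW : ∀ K ⊆ U, IsCompact K → Uᶜ ⊆ unwound K) {f : ℂ → ℂ} (hf : DifferentiableOn ℂ f U)
    (h0 : ∀ z ∈ U, f z ≠ 0) {K : Set ℂ} (hKU : K ⊆ U) (hK : IsCompact K) : HasLogOn f K := by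
  set K' : Set ℂ := (unwound K)ᶜ with hK'
  have hK'c : IsClosed K' := (isOpen_unwound hK.isClosed).isClosed_compl
  have hKK' : K ⊆ K' := fun z hz h => h.1 hz
  have hK'U : K' ⊆ U := compl_subset_comm.1 (hKW K hKU hK)
  have hK'b : Bornology.IsBounded K' := by
    obtain ⟨R, hR⟩ := exists_forall_lt_mem_unwound hK.isBounded
    refine isBounded_iff_forall_norm_le.2 ⟨R, fun z hz => ?_⟩
    by_contra hcon
    exact hz (hR z (not_le.1 hcon))
  have hK'k : IsCompact K' := Metric.isCompact_of_isClosed_isBounded hK'c hK'b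
  obtain ⟨W, hWo, hKW', hWU, hWc⟩ := exists_open_between_and_isCompact_closure hK'k hU hK'U
  obtain ⟨χ, hχ0, hχ1, -⟩ := exists_contMDiffMap_zero_one_nhds_of_isClosed
    (n := (1 : ℕ∞)) (modelWithCornersSelf ℝ ℂ) (s := Wᶜ) (t := K') hWo.isClosed_compl hK'c
    (disjoint_left.2 fun z hz hz' => hz (hKW' hz'))
  have hχd : Differentiable ℝ χ := (χ.contMDiff.contDiff).differentiable (by simp)
  have hχ0' : ∀ z ∉ W, ∀ᶠ w in 𝓝 z, χ w = 0 := fun z hz => by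
    rw [eventually_nhdsSet_iff_forall] at hχ0; exact hχ0 z hz
  have hχ1' : ∀ z ∈ K', χ z = 1 := fun z hz => by
    rw [eventually_nhdsSet_iff_forall] at hχ1; exact (hχ1 z hz).self_of_nhds
  set F : ℂ → ℂ := fun z => χ z • f z with hFdef
  have hFd : ∀ z, DifferentiableAt ℝ F z := by
    intro z
    by_cases hz : z ∈ W
    · exact (hχd z).smul
        ((hf.differentiableAt (hU.mem_nhds (hWU (subset_closure hz)))).restrictScalars ℝ)
    · have : F =ᶠ[𝓝 z] fun _ => 0 := by
        filter_upwards [hχ0' z hz] with w hw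
        simp [hFdef, hw]
      exact (differentiableAt_const (0 : ℂ)).congr_of_eventuallyEq this
  have hFK : ∀ z ∈ K', F z = f z := fun z hz => by simp [hFdef, hχ1' z hz]
  -- a lower bound for `f` on `K'`
  obtain ⟨δ, hδ, hδf⟩ : ∃ δ > 0, ∀ z ∈ K', δ ≤ ‖f z‖ := by
    rcases K'.eq_empty_or_nonempty with he | hne
    · exact ⟨1, one_pos, by simp [he]⟩
    · obtain ⟨z₀, hz₀, hmin⟩ := hK'k.exists_isMinOn hne ((hf.continuousOn.mono hK'U).norm)
      exact ⟨‖f z₀‖, norm_pos_iff.2 (h0 _ (hK'U hz₀)), fun z hz => hmin hz⟩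
  obtain ⟨c, hc0, hcδ, hreg⟩ := exists_regular_value (fun x => (hFd x).hasFDerivAt) hδ
  have hfib : F ⁻¹' {c} ⊆ closure W := by
    intro z hz
    by_contra hcon
    have h1 : F z = c := hz
    have h2 := (hχ0' z fun h => hcon (subset_closure h)).self_of_nhds
    rw [hFdef] at h1
    simp only [h2, zero_smul] at h1
    exact hc0 h1.symm
  have hfin := finite_fiber_of_det_ne_zero (fun x => (hFd x).hasFDerivAt) hreg
    (hWc.isBounded.subset hfib)
  set Z : Finset ℂ := hfin.toFinset with hZ
  have hZmem : ∀ z, z ∈ Z ↔ F z = c := fun z => by simp [hZ]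
  have hFc : Continuous F := continuous_iff_continuousAt.2 fun x => (hFd x).continuousAt
  obtain ⟨n, hn⟩ := exists_prod_zpow_log Z (fun z => F z - c)
    (hFc.sub continuous_const).continuousOn
    fun z hz => sub_ne_zero.2 fun h => hz ((hZmem z).2 h)
  have hZK : ∀ a ∈ Z, a ∈ unwound K := by
    intro a ha
    by_contra hcon
    have h1 : a ∈ K' := hcon
    have h2 := (hZmem a).1 ha
    rw [hFK a h1] at h2
    have := hδf a h1
    rw [h2] at this
    linarith
  have hprod : ∀ T : Finset ℂ, (∀ a ∈ T, a ∈ unwound K) →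
      HasLogOn (fun z => ∏ a ∈ T, (z - a) ^ n a) K := by
    classical
    intro T
    induction T using Finset.induction_on with
    | empty => intro _; simpa using hasLogOn_const one_ne_zero K
    | insert a T ha ih =>
      intro h
      simp only [Finset.prod_insert ha]
      exact ((h a (Finset.mem_insert_self a T)).2.zpow _).mul
        (ih fun b hb => h b (Finset.mem_insert_of_mem hb))
  have h1 : HasLogOn (fun z => 1 - c / f z) K := by
    refine hasLogOn_of_norm_sub_one_lt ?_ ?_
    · exact continuousOn_const.sub (continuousOn_const.div (hf.continuousOn.mono hKU)
        fun z hz => h0 z (hKU hz))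
    · intro z hz
      have h2 := hδf z (hKK' hz)
      rw [show 1 - c / f z - 1 = -(c / f z) by ring, norm_neg, norm_div,
        div_lt_one (hδ.trans_le h2)]
      exact hcδ.trans_le h2
  have hKZ : K ⊆ (Z : Set ℂ)ᶜ := fun z hz h => (hZK z h).1 hz
  refine (((hn.mono hKZ).mul (hprod Z hZK).inv).mul h1.inv).congr fun z hz => ?_
  have hfz := h0 z (hKU hz)
  have hp : ∏ a ∈ Z, (z - a) ^ n a ≠ 0 := Finset.prod_ne_zero_iff.2 fun a ha =>
    zpow_ne_zero _ (sub_ne_zero.2 fun h => (hZK a ha).1 (h ▸ hz))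
  have h3 : f z - c ≠ 0 := by
    intro h
    have h2 := hδf z (hKK' hz)
    rw [sub_eq_zero.1 h] at h2
    linarith
  have h4 : 1 - c / f z = (f z - c) / f z := by field_simp
  rw [hFK z (hKK' hz), h4]
  field_simp

/-- Nonvanishing holomorphic functions have holomorphic logarithms on a connected open set none of
whose compact subsets winds about a point of the complement. -/
theorem exists_holomorphic_log {U : Set ℂ} (hU : IsOpen U) (hUc : IsConnected U)
    (hKW : ∀ K ⊆ U, IsCompact K → Uᶜ ⊆ unwound K) {f : ℂ → ℂ} (hf : DifferentiableOn ℂ f U)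
    (h0 : ∀ z ∈ U, f z ≠ 0) :
    ∃ g : ℂ → ℂ, DifferentiableOn ℂ g U ∧ ∀ z ∈ U, Complex.exp (g z) = f z := by
  obtain ⟨g, hg, hgf⟩ := hasLogOn_of_compacts hU hUc fun K hKU hK =>
    hasLogOn_compact_of_unwound hU hKW hf h0 hKU hK
  refine ⟨g, fun z hz => DifferentiableAt.differentiableWithinAt ?_, hgf⟩
  have hfz : DifferentiableAt ℂ f z := hf.differentiableAt (hU.mem_nhds hz)
  have h1 : ∀ᶠ w in 𝓝 z, g w = g z + Complex.log (f w / f z) := by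
    have hc : ContinuousAt (fun w => (g w - g z).im) z :=
      Complex.continuous_im.continuousAt.comp
        ((hg.continuousAt (hU.mem_nhds hz)).sub continuousAt_const)
    have h2 : ∀ᶠ w in 𝓝 z, (g w - g z).im ∈ Ioo (-Real.pi) Real.pi := by
      refine hc.eventually_mem (Ioo_mem_nhds ?_ ?_) <;> simp [Real.pi_pos]
    filter_upwards [h2, hU.mem_nhds hz] with w hw hwU
    rw [← hgf w hwU, ← hgf z hz, ← Complex.exp_sub, Complex.log_exp hw.1 hw.2.le]
    ring
  have h2 : DifferentiableAt ℂ (fun w => g z + Complex.log (f w / f z)) z := by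
    refine (differentiableAt_const _).add (DifferentiableAt.clog (hfz.div_const _) ?_)
    rw [div_self (h0 z hz)]
    exact Complex.one_mem_slitPlane
  exact h2.congr_of_eventuallyEq h1

end Sard

/-- The automorphism of the unit disc that sends `c` to the origin. -/
noncomputable def discMap (c z : ℂ) : ℂ := (z - c) / (1 - conj c * z)

theorem one_sub_conj_mul_ne_zero {c z : ℂ} (hc : ‖c‖ < 1) (hz : ‖z‖ < 1) : 1 - conj c * z ≠ 0 := by
  intro h
  have h1 : ‖conj c * z‖ = 1 := by rw [← sub_eq_zero.1 h, norm_one]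
  rw [norm_mul, RCLike.norm_conj] at h1
  nlinarith [norm_nonneg c, norm_nonneg z]

theorem norm_discMap_lt_one {c z : ℂ} (hc : ‖c‖ < 1) (hz : ‖z‖ < 1) : ‖discMap c z‖ < 1 := by
  rw [discMap, norm_div, div_lt_one (norm_pos_iff.2 (one_sub_conj_mul_ne_zero hc hz))]
  refine lt_of_pow_lt_pow_left₀ 2 (norm_nonneg _) ?_
  have hc' : ‖c‖ ^ 2 < 1 := by nlinarith [norm_nonneg c]
  have hz' : ‖z‖ ^ 2 < 1 := by nlinarith [norm_nonneg z]
  rw [← Complex.normSq_eq_norm_sq] at hc' hz'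
  rw [← Complex.normSq_eq_norm_sq, ← Complex.normSq_eq_norm_sq]
  simp only [Complex.normSq_apply, Complex.sub_re, Complex.sub_im, Complex.one_re, Complex.one_im,
    Complex.mul_re, Complex.mul_im, Complex.conj_re, Complex.conj_im] at *
  nlinarith [mul_pos (sub_pos.2 hc') (sub_pos.2 hz')]

theorem discMap_neg_discMap {c z : ℂ} (hc : ‖c‖ < 1) (hz : ‖z‖ < 1) :
    discMap (-c) (discMap c z) = z := by
  have h1 := one_sub_conj_mul_ne_zero hc hz
  have h2 := one_sub_conj_mul_ne_zero hc hc
  have h3 : 1 - conj c * z + conj c * (z - c) ≠ 0 := by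
    convert h2 using 1
    ring
  rw [discMap, discMap, map_neg]
  have h4 : 1 - -conj c * ((z - c) / (1 - conj c * z)) ≠ 0 := by
    rw [show 1 - -conj c * ((z - c) / (1 - conj c * z)) =
      (1 - conj c * z + conj c * (z - c)) / (1 - conj c * z) by field_simp; ring]
    exact div_ne_zero h3 h1
  rw [div_eq_iff h4]
  have h5 : (z - c) / (1 - conj c * z) * (1 - conj c * z) = z - c := div_mul_cancel₀ _ h1
  linear_combination h5

theorem discMap_self (c : ℂ) : discMap c c = 0 := by simp [discMap]

theorem discMap_zero (c : ℂ) : discMap c 0 = -c := by simp [discMap]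

theorem mapsTo_discMap {c : ℂ} (hc : ‖c‖ < 1) : MapsTo (discMap c) (ball 0 1) (ball 0 1) :=
  fun _ hz => mem_ball_zero_iff.2 (norm_discMap_lt_one hc (mem_ball_zero_iff.1 hz))

theorem injOn_discMap {c : ℂ} (hc : ‖c‖ < 1) : InjOn (discMap c) (ball 0 1) :=
  fun z hz w hw h => by
    rw [← discMap_neg_discMap hc (mem_ball_zero_iff.1 hz), h,
      discMap_neg_discMap hc (mem_ball_zero_iff.1 hw)]

theorem differentiableOn_discMap {c : ℂ} (hc : ‖c‖ < 1) :
    DifferentiableOn ℂ (discMap c) (ball 0 1) := fun _ hz =>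
  ((differentiableAt_id.sub_const c).div
    ((differentiableAt_const _).sub ((differentiableAt_const _).mul differentiableAt_id))
    (one_sub_conj_mul_ne_zero hc (mem_ball_zero_iff.1 hz))).differentiableWithinAt

/-- Holomorphic maps into the unit disc converge locally uniformly along some ultrafilter. -/
theorem exists_tendstoLocallyUniformlyOn {U : Set ℂ} (hU : IsOpen U) (f : ℕ → ℂ → ℂ)
    (hd : ∀ n, DifferentiableOn ℂ (f n) U) (hm : ∀ n, MapsTo (f n) U (ball 0 1)) :
    ∃ F : ℂ → ℂ, TendstoLocallyUniformlyOn f F (hyperfilter ℕ : Filter ℕ) U := by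
  have h1 : ∀ z, ∃ w, z ∈ U → Tendsto (fun n => f n z) (hyperfilter ℕ : Filter ℕ) (𝓝 w) := by
    intro z
    by_cases hz : z ∈ U
    · obtain ⟨w, -, hw⟩ := (isCompact_closedBall (0 : ℂ) 1).ultrafilter_le_nhds
        ((hyperfilter ℕ).map fun n => f n z) (by
          rw [le_principal_iff]
          exact Filter.mem_map.2 (Filter.univ_mem' fun n => ball_subset_closedBall (hm n hz)))
      exact ⟨w, fun _ => hw⟩
    · exact ⟨0, fun h => absurd h hz⟩
  choose F hF using h1
  refine ⟨F, Metric.tendstoLocallyUniformlyOn_iff.2 fun ε hε x hx => ?_⟩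
  obtain ⟨r, hr, hrU⟩ := Metric.isOpen_iff.1 hU x hx
  have h2 : ∀ n, ∀ z ∈ ball x r, dist (f n z) (f n x) ≤ 2 / r * dist z x := by
    intro n z hz
    refine Complex.dist_le_div_mul_dist_of_mapsTo_ball ((hd n).mono hrU) (fun y hy => ?_) hz
    have h3 := mem_ball_zero_iff.1 (hm n (hrU hy))
    have h4 := mem_ball_zero_iff.1 (hm n hx)
    rw [mem_closedBall, dist_eq_norm]
    exact (norm_sub_le _ _).trans (by linarith)
  have h3 : ∀ z ∈ ball x r, dist (F z) (F x) ≤ 2 / r * dist z x := fun z hz =>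
    le_of_tendsto ((hF z (hrU hz)).dist (hF x hx)) (Eventually.of_forall fun n => h2 n z hz)
  refine ⟨ball x (min r (ε * r / 6)),
    mem_nhdsWithin_of_mem_nhds (ball_mem_nhds _ (by positivity)), ?_⟩
  filter_upwards [(tendsto_iff_dist_tendsto_zero.1 (hF x hx)).eventually_lt_const
    (show 0 < ε / 3 by positivity)] with n hn z hz
  have hz1 : z ∈ ball x r := ball_subset_ball (min_le_left _ _) hz
  have hz2 : 2 / r * dist z x < ε / 3 := by
    have h5 : dist z x < ε * r / 6 := (mem_ball.1 hz).trans_le (min_le_right _ _)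
    calc 2 / r * dist z x < 2 / r * (ε * r / 6) := by gcongr
      _ = ε / 3 := by field_simp; norm_num
  have h6 := h2 n z hz1
  have h7 := h3 z hz1
  have h8 := dist_triangle4 (F z) (F x) (f n x) (f n z)
  rw [dist_comm (F x), dist_comm (f n x) (f n z)] at h8
  linarith

/-- Hurwitz: a nonconstant locally uniform limit of injective holomorphic functions is
injective. -/
theorem injOn_of_tendstoLocallyUniformlyOn {ι : Type*} {l : Filter ι} [l.NeBot] {U : Set ℂ}
    (hU : IsOpen U) (hUc : IsPreconnected U) {f : ι → ℂ → ℂ} {F : ℂ → ℂ}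
    (hf : TendstoLocallyUniformlyOn f F l U) (hd : ∀ n, DifferentiableOn ℂ (f n) U)
    (hi : ∀ n, InjOn (f n) U) {a b : ℂ} (ha : a ∈ U) (hb : b ∈ U) (hab : F a ≠ F b) :
    InjOn F U := by
  have hFd : DifferentiableOn ℂ F U := hf.differentiableOn (Eventually.of_forall hd) hU
  have hFa : AnalyticOnNhd ℂ F U := hFd.analyticOnNhd hU
  intro p hp q hq hpq
  by_contra hne
  have h1 : ∀ᶠ z in 𝓝[≠] p, F z ≠ F p := by
    refine ((hFa p hp).eventually_eq_or_eventually_ne analyticAt_const).resolve_left fun h => ?_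
    have h2 := hFa.eqOn_of_preconnected_of_eventuallyEq analyticOnNhd_const hUc hp h
    exact hab ((h2 ha).trans (h2 hb).symm)
  rw [eventually_nhdsWithin_iff] at h1
  obtain ⟨r, hr, hr1⟩ := Metric.eventually_nhds_iff_ball.1
    (h1.and ((hU.eventually_mem hp).and (isOpen_ne.eventually_mem hne)))
  set s := r / 2 with hs
  have hs0 : 0 < s := by positivity
  have hsr : closedBall p s ⊆ ball p r := closedBall_subset_ball (by linarith)
  have hsU : closedBall p s ⊆ U := fun z hz => (hr1 z (hsr hz)).2.1
  have hqs : q ∉ closedBall p s := fun h => (hr1 q (hsr h)).2.2 rfl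
  obtain ⟨x, hx, hxm⟩ := (isCompact_sphere p s).exists_isMinOn
    (NormedSpace.sphere_nonempty.2 hs0.le)
    (((hFd.continuousOn.mono (sphere_subset_closedBall.trans hsU)).sub
      (continuousOn_const (c := F p))).norm)
  set m := ‖F x - F p‖ with hm
  have hm0 : 0 < m := norm_pos_iff.2 (sub_ne_zero.2
    ((hr1 x (hsr (sphere_subset_closedBall hx))).1 (ne_of_mem_sphere hx hs0.ne')))
  have h3 := Metric.tendstoLocallyUniformlyOn_iff.1 hf
  have h4 : TendstoUniformlyOn f F l (closedBall p s) :=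
    (tendstoLocallyUniformlyOn_iff_tendstoUniformlyOn_of_compact (isCompact_closedBall p s)).1
      (hf.mono hsU)
  have h5 := (Metric.tendstoUniformlyOn_iff.1 h4) (m / 8) (by positivity)
  have h6 := (tendsto_iff_dist_tendsto_zero.1 (hf.tendsto_at hq)).eventually_lt_const
    (show 0 < m / 8 by positivity)
  obtain ⟨n, hn, hnq⟩ := (h5.and h6).exists
  have hnp := hn p (mem_closedBall_self hs0.le)
  have h7 := DiffContOnCl.ball_subset_image_closedBall (f := f n) (z₀ := p) (r := s) (ε := m / 2)
    (((hd n).mono (closure_ball p hs0.ne' ▸ hsU)).diffContOnCl) hs0 (fun z hz => ?_) ?_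
  · have h8 : f n q ∈ ball (f n p) (m / 2 / 2) := by
      rw [mem_ball]
      have := dist_triangle (f n q) (F q) (f n p)
      rw [← hpq] at this hnq
      linarith
    obtain ⟨z, hz, hzq⟩ := h7 h8
    exact hqs (hi n (hsU hz) hq hzq ▸ hz)
  · have h9 : m ≤ ‖F z - F p‖ := hxm hz
    have h10 := hn z (sphere_subset_closedBall hz)
    rw [← dist_eq_norm] at h9 ⊢
    have := dist_triangle4 (F z) (f n z) (f n p) (F p)
    rw [dist_comm (f n p)] at this
    linarith
  · refine Eventually.frequently (f := 𝓝[≠] p) ?_ |>.filter_mono nhdsWithin_le_nhds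
    filter_upwards [self_mem_nhdsWithin,
      mem_nhdsWithin_of_mem_nhds (hU.mem_nhds hp)] with z hz hzU h
    exact hz (hi n hzU hp h)

/-- Square roots from logarithms. -/
theorem exists_sqrt_of_log {U : Set ℂ} {f : ℂ → ℂ}
    (h : ∃ g : ℂ → ℂ, DifferentiableOn ℂ g U ∧ ∀ z ∈ U, Complex.exp (g z) = f z) :
    ∃ g : ℂ → ℂ, DifferentiableOn ℂ g U ∧ ∀ z ∈ U, g z ^ 2 = f z := by
  obtain ⟨g, hg, hgf⟩ := h
  refine ⟨fun z => Complex.exp (g z / 2), (hg.div_const 2).cexp, fun z hz => ?_⟩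
  rw [← hgf z hz, ← Complex.exp_nat_mul]
  congr 1
  push_cast
  ring

theorem exists_injOn_mapsTo_ball {U : Set ℂ} (hU : IsOpen U) (hUc : IsConnected U)
    (hUn : U ≠ univ)
    (hlog : ∀ f : ℂ → ℂ, DifferentiableOn ℂ f U → (∀ z ∈ U, f z ≠ 0) →
      ∃ g : ℂ → ℂ, DifferentiableOn ℂ g U ∧ ∀ z ∈ U, Complex.exp (g z) = f z) :
    ∃ f : ℂ → ℂ, DifferentiableOn ℂ f U ∧ InjOn f U ∧ MapsTo f U (ball 0 1) := by
  obtain ⟨a, ha⟩ := (ne_univ_iff_exists_notMem U).1 hUn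
  obtain ⟨x, hx⟩ := hUc.nonempty
  obtain ⟨g, hg, hg2⟩ := exists_sqrt_of_log (hlog (fun z => z - a)
    (differentiableOn_id.sub_const a) (fun z hz => sub_ne_zero.2 fun h => ha (h ▸ hz)))
  have hgi : InjOn g U := fun z hz w hw h => by
    have := hg2 z hz
    rw [h, hg2 w hw] at this
    exact (sub_left_injective this).symm
  have hgo : g '' U ∈ 𝓝 (g x) := by
    rcases (hg.analyticOnNhd hU x hx).eventually_constant_or_nhds_le_map_nhds with h | h
    · exfalso
      have h1 : ∀ᶠ z in 𝓝[≠] x, False := by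
        filter_upwards [self_mem_nhdsWithin, nhdsWithin_le_nhds h,
          nhdsWithin_le_nhds (hU.mem_nhds hx)] with z hz hzg hzU
        exact hz (hgi hzU hx hzg)
      simp at h1
      exact absurd h1 (NormedField.nhdsNE_neBot x).ne
    · exact h (image_mem_map (hU.mem_nhds hx))
  obtain ⟨r, hr, hrg⟩ := Metric.mem_nhds_iff.1 hgo
  have hfar : ∀ z ∈ U, r ≤ ‖g z + g x‖ := by
    intro z hz
    by_contra! hlt
    obtain ⟨y, hy, hyz⟩ := hrg (show -g z ∈ ball (g x) r by
      rw [mem_ball, dist_eq_norm, ← norm_neg]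
      rwa [show -(-g z - g x) = g z + g x by ring])
    have h1 : y = z := by
      have h2 := hg2 y hy
      rw [hyz, neg_sq, hg2 z hz] at h2
      exact (sub_left_injective h2).symm
    subst h1
    have h3 : g y = 0 := by linear_combination hyz / 2
    have h4 := hg2 y hy
    rw [h3] at h4
    exact ha (by rwa [← show y = a by linear_combination -h4])
  have hne : ∀ z ∈ U, g z + g x ≠ 0 := fun z hz => norm_pos_iff.1 (hr.trans_le (hfar z hz))
  refine ⟨fun z => (r / 2 : ℝ) / (g z + g x), (differentiableOn_const _).div (hg.add_const _) hne,
    fun z hz w hw h => ?_, fun z hz => ?_⟩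
  · have hr2 : ((r / 2 : ℝ) : ℂ) ≠ 0 := by exact_mod_cast (half_pos hr).ne'
    dsimp only at h
    rw [div_eq_div_iff (hne z hz) (hne w hw)] at h
    have := mul_left_cancel₀ hr2 h
    exact hgi hz hw (add_right_cancel this).symm
  · rw [mem_ball_zero_iff, norm_div, div_lt_one (norm_pos_iff.2 (hne z hz)), Complex.norm_real,
      Real.norm_of_nonneg (half_pos hr).le]
    linarith [hfar z hz]

/-- Schwarz's inequality is strict for maps of the disc to itself that are not injective. -/
theorem norm_lt_of_not_injOn {h : ℂ → ℂ} (hd : DifferentiableOn ℂ h (ball 0 1))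
    (hm : MapsTo h (ball 0 1) (ball 0 1)) (h0 : h 0 = 0) (hi : ¬InjOn h (ball 0 1)) {z : ℂ}
    (hz : z ∈ ball (0 : ℂ) 1) (hz0 : z ≠ 0) : ‖h z‖ < ‖z‖ := by
  refine lt_of_le_of_ne (Complex.norm_le_norm_of_mapsTo_ball hd
    (fun w hw => ball_subset_closedBall (hm hw)) h0 (mem_ball_zero_iff.1 hz)) fun he => hi ?_
  obtain ⟨C, hC, hCe⟩ := Complex.affine_of_mapsTo_ball_of_exists_norm_dslope_eq_div' hd
    (R₂ := 1) (by rw [h0]; exact fun w hw => ball_subset_closedBall (hm hw)) ⟨z, hz, by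
      rw [dslope_of_ne _ hz0, slope_def_field, h0, sub_zero, sub_zero, norm_div, he, div_one,
        div_self (norm_ne_zero_iff.2 hz0)]⟩
  intro x hx y hy hxy
  rw [hCe hx, hCe hy] at hxy
  have hC0 : C ≠ 0 := by
    rw [div_one] at hC
    exact norm_ne_zero_iff.1 (hC ▸ one_ne_zero)
  simpa [h0, hC0] using hxy

/-- The inverse of an injective holomorphic function is holomorphic. -/
theorem differentiableOn_of_leftInvOn {U : Set ℂ} (hU : IsOpen U) {F G : ℂ → ℂ}
    (hF : DifferentiableOn ℂ F U) (hG : LeftInvOn G F U) :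
    IsOpen (F '' U) ∧ DifferentiableOn ℂ G (F '' U) := by
  have hFa := hF.analyticOnNhd hU
  have hi : InjOn F U := hG.injOn
  have hopen : ∀ z ∈ U, 𝓝 (F z) ≤ map F (𝓝 z) := by
    intro z hz
    refine (hFa z hz).eventually_constant_or_nhds_le_map_nhds.resolve_left fun h => ?_
    have h1 : ∀ᶠ w in 𝓝[≠] z, False := by
      filter_upwards [self_mem_nhdsWithin, nhdsWithin_le_nhds h,
        nhdsWithin_le_nhds (hU.mem_nhds hz)] with w hw hwF hwU
      exact hw (hi hwU hz hwF)
    simp at h1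
    exact absurd h1 (NormedField.nhdsNE_neBot z).ne
  have hFU : IsOpen (F '' U) := isOpen_iff_mem_nhds.2 fun w ⟨z, hz, hzw⟩ =>
    hzw ▸ hopen z hz (image_mem_map (hU.mem_nhds hz))
  have hGc : ∀ z ∈ U, ContinuousAt G (F z) := by
    intro z hz
    rw [ContinuousAt, hG hz]
    refine (map_mono (hopen z hz)).trans ?_
    rw [Filter.map_map]
    refine (tendsto_id (x := 𝓝 z)).congr' ?_
    filter_upwards [hU.mem_nhds hz] with w hw using (hG hw).symm
  have hGd : ∀ z ∈ U, deriv F z ≠ 0 → DifferentiableAt ℂ G (F z) := by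
    intro z hz h
    have hGz : G (F z) = z := hG hz
    refine (HasDerivAt.of_local_left_inverse (f := F) (f' := deriv F z) (hGc z hz) ?_ h
      ?_).differentiableAt
    · rw [hGz]
      exact (hF.differentiableAt (hU.mem_nhds hz)).hasDerivAt
    · filter_upwards [hFU.mem_nhds (mem_image_of_mem F hz)]
      rintro _ ⟨w, hw, rfl⟩
      rw [hG hw]
  refine ⟨hFU, ?_⟩
  rintro _ ⟨z, hz, rfl⟩
  refine DifferentiableAt.differentiableWithinAt ?_
  have h1 : ∀ᶠ w in 𝓝[≠] z, deriv F w ≠ 0 := by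
    refine ((hFa z hz).deriv.eventually_eq_or_eventually_ne analyticAt_const).resolve_left
      fun h => ?_
    obtain ⟨r, hr, hr1⟩ := Metric.eventually_nhds_iff_ball.1 (h.and (hU.eventually_mem hz))
    have h2 : ∀ w ∈ ball z r, F w = F z := fun w hw =>
      (convex_ball z r).is_const_of_fderivWithin_eq_zero (𝕜 := ℂ)
        (hF.mono fun y hy => (hr1 y hy).2) (fun y hy => by
          rw [fderivWithin_of_isOpen isOpen_ball hy]
          ext
          simpa using (hr1 y hy).1) hw (mem_ball_self hr)
    have h3 : z + (r / 2 : ℝ) ∈ ball z r := by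
      rw [mem_ball, dist_eq_norm, add_sub_cancel_left, Complex.norm_real,
        Real.norm_of_nonneg (half_pos hr).le]
      linarith
    have h4 := hi (hr1 _ h3).2 hz (h2 _ h3)
    have h5 : ((r / 2 : ℝ) : ℂ) = 0 := by linear_combination h4
    exact (half_pos hr).ne' (by exact_mod_cast h5)
  obtain ⟨W, hWz, hW⟩ := (eventually_nhdsWithin_iff.1 h1).exists_mem
  have hFW : F '' (W ∩ U) ∈ 𝓝 (F z) :=
    hopen z hz (image_mem_map (inter_mem hWz (hU.mem_nhds hz)))
  refine ((Complex.differentiableOn_compl_singleton_and_continuousAt_iff hFW).1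
    ⟨?_, hGc z hz⟩).differentiableAt hFW
  rintro _ ⟨⟨w, hw, rfl⟩, hne⟩
  exact (hGd w hw.2 (hW w hw.1 fun h => hne (by rw [mem_singleton_iff.1 h]; rfl))).differentiableWithinAt

/-- The Riemann mapping theorem for plane domains on which nonvanishing holomorphic functions have
logarithms. -/
theorem riemann_mapping {U : Set ℂ} (hU : IsOpen U) (hUc : IsConnected U) (hUn : U ≠ univ)
    (hlog : ∀ f : ℂ → ℂ, DifferentiableOn ℂ f U → (∀ z ∈ U, f z ≠ 0) →
      ∃ g : ℂ → ℂ, DifferentiableOn ℂ g U ∧ ∀ z ∈ U, Complex.exp (g z) = f z) :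
    ∃ F G : ℂ → ℂ, DifferentiableOn ℂ F U ∧ DifferentiableOn ℂ G (ball 0 1) ∧
      MapsTo F U (ball 0 1) ∧ MapsTo G (ball 0 1) U ∧ LeftInvOn G F U ∧
      RightInvOn G F (ball 0 1) := by
  obtain ⟨a, ha⟩ := hUc.nonempty
  obtain ⟨b, hb, hba⟩ : ∃ b ∈ U, b ≠ a := by
    have h1 : ∀ᶠ b in 𝓝[≠] a, b ∈ U ∧ b ≠ a :=
      (hU.eventually_mem ha).filter_mono nhdsWithin_le_nhds |>.and self_mem_nhdsWithin
    exact h1.exists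
  let S : Set (ℂ → ℂ) :=
    {f | DifferentiableOn ℂ f U ∧ InjOn f U ∧ MapsTo f U (ball 0 1) ∧ f a = 0}
  have hnorm : ∀ f, DifferentiableOn ℂ f U → InjOn f U → MapsTo f U (ball 0 1) →
      (discMap (f a) ∘ f) ∈ S := by
    intro f hf hfi hfm
    have hfa := mem_ball_zero_iff.1 (hfm ha)
    exact ⟨(differentiableOn_discMap hfa).comp hf hfm, (injOn_discMap hfa).comp hfi hfm,
      (mapsTo_discMap hfa).comp hfm, discMap_self _⟩
  obtain ⟨f₀, hf₀, hf₀i, hf₀m⟩ := exists_injOn_mapsTo_ball hU hUc hUn hlog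
  let N : Set ℝ := (fun f : ℂ → ℂ => ‖f b‖) '' S
  have hN : N.Nonempty := ⟨_, mem_image_of_mem _ (hnorm f₀ hf₀ hf₀i hf₀m)⟩
  have hNb : BddAbove N := ⟨1, by
    rintro _ ⟨f, hf, rfl⟩
    exact (mem_ball_zero_iff.1 (hf.2.2.1 hb)).le⟩
  obtain ⟨u, -, hu, huN⟩ := exists_seq_tendsto_sSup hN hNb
  choose f hfS hfu using huN
  obtain ⟨F, hF⟩ := exists_tendstoLocallyUniformlyOn hU f (fun n => (hfS n).1)
    (fun n => (hfS n).2.2.1)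
  have hFb : ‖F b‖ = sSup N := by
    refine tendsto_nhds_unique (hF.tendsto_at hb).norm ?_
    simp only [hfu]
    exact hu.mono_left Nat.hyperfilter_le_atTop
  have hFa : F a = 0 := by
    refine tendsto_nhds_unique (hF.tendsto_at ha) ?_
    simp only [(hfS _).2.2.2]
    exact tendsto_const_nhds
  have hmax : ∀ g ∈ S, ‖g b‖ ≤ ‖F b‖ := fun g hg => hFb ▸ le_csSup hNb (mem_image_of_mem _ hg)
  have hFb0 : F b ≠ 0 := by
    have h1 := hnorm f₀ hf₀ hf₀i hf₀m
    have h2 : (discMap (f₀ a) ∘ f₀) b ≠ 0 := fun h => hba (h1.2.1 hb ha (h.trans h1.2.2.2.symm))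
    exact norm_pos_iff.1 ((norm_pos_iff.2 h2).trans_le (hmax _ h1))
  have hFi : InjOn F U := injOn_of_tendstoLocallyUniformlyOn hU hUc.isPreconnected hF
    (fun n => (hfS n).1) (fun n => (hfS n).2.1) ha hb (by rw [hFa]; exact hFb0.symm)
  have hFd : DifferentiableOn ℂ F U :=
    hF.differentiableOn (Eventually.of_forall fun n => (hfS n).1) hU
  have hFcl : ∀ z ∈ U, F z ∈ closedBall (0 : ℂ) 1 := fun z hz =>
    isClosed_closedBall.mem_of_tendsto (hF.tendsto_at hz)
      (Eventually.of_forall fun n => ball_subset_closedBall ((hfS n).2.2.1 hz))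
  have hleft : LeftInvOn (Function.invFunOn F U) F U := hFi.leftInvOn_invFunOn
  obtain ⟨hFo, hGd⟩ := differentiableOn_of_leftInvOn hU hFd hleft
  have hFm : MapsTo F U (ball 0 1) := by
    have h1 : F '' U ⊆ interior (closedBall (0 : ℂ) 1) :=
      interior_maximal (image_subset_iff.2 hFcl) hFo
    rw [interior_closedBall _ one_ne_zero] at h1
    exact image_subset_iff.1 h1
  have hFs : ball (0 : ℂ) 1 ⊆ F '' U := by
    intro c hc
    by_contra hcF
    have hc1 := mem_ball_zero_iff.1 hc
    obtain ⟨g, hg, hg2⟩ := exists_sqrt_of_log (hlog (discMap c ∘ F)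
      ((differentiableOn_discMap hc1).comp hFd hFm) fun z hz h =>
        hcF ⟨z, hz, injOn_discMap hc1 (hFm hz) hc (h.trans (discMap_self c).symm)⟩)
    have hgm : MapsTo g U (ball 0 1) := by
      intro z hz
      have h1 := norm_discMap_lt_one hc1 (mem_ball_zero_iff.1 (hFm hz))
      rw [← Function.comp_apply (f := discMap c), ← hg2 z hz, norm_pow] at h1
      rw [mem_ball_zero_iff]
      exact (pow_lt_one_iff_of_nonneg (norm_nonneg _) two_ne_zero).1 h1
    have hgi : InjOn g U := by
      intro z hz w hw h
      have h1 := hg2 z hz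
      rw [h, hg2 w hw] at h1
      exact hFi hz hw (injOn_discMap hc1 (hFm hz) (hFm hw) h1.symm)
    have hS := hnorm g hg hgi hgm
    have hd := mem_ball_zero_iff.1 (hgm ha)
    set d := g a with hd'
    have hnd : ‖-d‖ < 1 := by rwa [norm_neg]
    have hnc : ‖-c‖ < 1 := by rwa [norm_neg]
    have hsq : MapsTo (fun w : ℂ => w ^ 2) (ball 0 1) (ball 0 1) := fun w hw => by
      rw [mem_ball_zero_iff] at hw ⊢
      rw [norm_pow]
      exact pow_lt_one₀ (norm_nonneg _) hw two_ne_zero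
    let h : ℂ → ℂ := fun w => discMap (-c) (discMap (-d) w ^ 2)
    have hhF : ∀ z ∈ U, h ((discMap d ∘ g) z) = F z := fun z hz => by
      simp only [h, Function.comp_apply]
      rw [discMap_neg_discMap hd (mem_ball_zero_iff.1 (hgm hz)), hg2 z hz, Function.comp_apply,
        discMap_neg_discMap hc1 (mem_ball_zero_iff.1 (hFm hz))]
    have hlt : ‖h ((discMap d ∘ g) b)‖ < ‖(discMap d ∘ g) b‖ := by
      refine norm_lt_of_not_injOn (h := h) ?_ ?_ ?_ ?_ (hS.2.2.1 hb) ?_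
      · exact (differentiableOn_discMap hnc).comp ((differentiableOn_discMap hnd).pow 2)
          (hsq.comp (mapsTo_discMap hnd))
      · exact (mapsTo_discMap hnc).comp (hsq.comp (mapsTo_discMap hnd))
      · have h1 := hhF a ha
        rwa [hS.2.2.2, hFa] at h1
      · intro hinj
        have h2 : ((1 / 2 : ℝ) : ℂ) ∈ ball (0 : ℂ) 1 := by
          rw [mem_ball_zero_iff, Complex.norm_real]
          norm_num
        have h3 : -((1 / 2 : ℝ) : ℂ) ∈ ball (0 : ℂ) 1 := by
          rwa [mem_ball_zero_iff, norm_neg, ← mem_ball_zero_iff]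
        have h4 : h (discMap d (1 / 2 : ℝ)) = h (discMap d (-(1 / 2 : ℝ))) := by
          simp only [h]
          rw [discMap_neg_discMap hd (mem_ball_zero_iff.1 h2),
            discMap_neg_discMap hd (mem_ball_zero_iff.1 h3), neg_sq]
        have h5 := injOn_discMap hd h2 h3
          (hinj (mapsTo_discMap hd h2) (mapsTo_discMap hd h3) h4)
        have h6 := congrArg Complex.re h5
        norm_num at h6
      · exact fun h0 => hba (hS.2.1 hb ha (h0.trans hS.2.2.2.symm))
    rw [hhF b hb] at hlt
    exact absurd (hmax _ hS) (not_le.2 hlt)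
  have hFU : F '' U = ball 0 1 := (image_subset_iff.2 hFm).antisymm hFs
  rw [hFU] at hGd
  refine ⟨F, Function.invFunOn F U, hFd, hGd, hFm, fun w hw => ?_, hleft, fun w hw => ?_⟩
  · exact Function.invFunOn_mem (hFs hw)
  · exact Function.invFunOn_eq (hFs hw)

/-- Holomorphic automorphisms of the unit disc are Möbius transformations. -/
theorem exists_eq_mul_discMap {h : ℂ → ℂ} (hd : DifferentiableOn ℂ h (ball 0 1))
    (hb : BijOn h (ball 0 1) (ball 0 1)) :
    ∃ ε c : ℂ, ‖ε‖ = 1 ∧ ‖c‖ < 1 ∧ ∀ z ∈ ball (0 : ℂ) 1, h z = ε * discMap c z := by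
  obtain ⟨c, hc, hc0⟩ := hb.surjOn (mem_ball_self one_pos)
  have hc1 := mem_ball_zero_iff.1 hc
  have hnc : ‖-c‖ < 1 := by rwa [norm_neg]
  have hleft : LeftInvOn (Function.invFunOn h (ball 0 1)) h (ball 0 1) :=
    hb.injOn.leftInvOn_invFunOn
  obtain ⟨-, hkd⟩ := differentiableOn_of_leftInvOn isOpen_ball hd hleft
  rw [hb.image_eq] at hkd
  set k := Function.invFunOn h (ball 0 1)
  have hkm : MapsTo k (ball 0 1) (ball 0 1) := fun w hw =>
    Function.invFunOn_mem (hb.surjOn hw)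
  set g := h ∘ discMap (-c) with hg
  have hgd : DifferentiableOn ℂ g (ball 0 1) :=
    hd.comp (differentiableOn_discMap hnc) (mapsTo_discMap hnc)
  have hgm : MapsTo g (ball 0 1) (ball 0 1) := hb.mapsTo.comp (mapsTo_discMap hnc)
  have hg0 : g 0 = 0 := by simp [hg, discMap_zero, hc0]
  set q := discMap c ∘ k with hq
  have hqd : DifferentiableOn ℂ q (ball 0 1) := (differentiableOn_discMap hc1).comp hkd hkm
  have hqm : MapsTo q (ball 0 1) (ball 0 1) := (mapsTo_discMap hc1).comp hkm
  have hq0 : q 0 = 0 := by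
    have : k 0 = c := by rw [← hc0, hleft hc]
    simp [hq, this, discMap_self]
  have hqg : ∀ z ∈ ball (0 : ℂ) 1, q (g z) = z := by
    intro z hz
    simp only [hq, hg, Function.comp_apply]
    rw [hleft (mapsTo_discMap hnc hz)]
    have := discMap_neg_discMap hnc (mem_ball_zero_iff.1 hz)
    rwa [neg_neg] at this
  have h2 : ((1 / 2 : ℝ) : ℂ) ∈ ball (0 : ℂ) 1 := by
    rw [mem_ball_zero_iff, Complex.norm_real]
    norm_num
  set t := ((1 / 2 : ℝ) : ℂ) with ht
  have ht0 : t ≠ 0 := by simp [ht]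
  have he : ‖g t‖ = ‖t‖ := by
    refine le_antisymm (Complex.norm_le_norm_of_mapsTo_ball hgd
      (fun w hw => ball_subset_closedBall (hgm hw)) hg0 (mem_ball_zero_iff.1 h2)) ?_
    have := Complex.norm_le_norm_of_mapsTo_ball hqd
      (fun w hw => ball_subset_closedBall (hqm hw)) hq0 (mem_ball_zero_iff.1 (hgm h2))
    rwa [hqg t h2] at this
  obtain ⟨C, hC, hCe⟩ := Complex.affine_of_mapsTo_ball_of_exists_norm_dslope_eq_div' hgd
    (R₂ := 1) (by rw [hg0]; exact fun w hw => ball_subset_closedBall (hgm hw)) ⟨t, h2, by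
      rw [dslope_of_ne _ ht0, slope_def_field, hg0, sub_zero, sub_zero, norm_div, he, div_one,
        div_self (norm_ne_zero_iff.2 ht0)]⟩
  refine ⟨C, c, by rw [hC, div_one], hc1, fun z hz => ?_⟩
  have h3 := hCe (mapsTo_discMap hc1 hz)
  rw [hg0] at h3
  simp only [hg, Function.comp_apply] at h3
  rw [discMap_neg_discMap hc1 (mem_ball_zero_iff.1 hz)] at h3
  rw [h3]
  simp [mul_comm]

/-- A Möbius transformation from the unit disc to the upper half plane. -/
noncomputable def cayley (p z : ℂ) : ℂ := Complex.I * (1 - conj p * z) / (z + conj p)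

/-- The inverse of `cayley p`. -/
noncomputable def cayleyInv (p w : ℂ) : ℂ := (Complex.I - conj p * w) / (w + Complex.I * conj p)

section Cayley

variable {p : ℂ}

theorem conj_mul_self_of_norm_one (hp : ‖p‖ = 1) : conj p * p = 1 := by
  rw [mul_comm, Complex.mul_conj, Complex.normSq_eq_norm_sq, hp]
  simp

theorem add_conj_ne_zero (hp : ‖p‖ = 1) {z : ℂ} (hz : ‖z‖ < 1) : z + conj p ≠ 0 := by
  intro h
  rw [eq_neg_of_add_eq_zero_left h, norm_neg, RCLike.norm_conj, hp] at hz
  exact lt_irrefl _ hz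

theorem cayley_im (hp : ‖p‖ = 1) {z : ℂ} (hz : ‖z‖ < 1) :
    (cayley p z).im = p.re * (1 - ‖z‖ ^ 2) / Complex.normSq (z + conj p) := by
  have h1 := add_conj_ne_zero hp hz
  have hpp : Complex.normSq p = 1 := by rw [Complex.normSq_eq_norm_sq, hp]; norm_num
  rw [cayley, ← Complex.normSq_eq_norm_sq, Complex.div_im, ← sub_div]
  congr 1
  rw [Complex.normSq_apply] at *
  simp
  linear_combination (-z.re) * hpp

theorem cayley_im_pos (hp : ‖p‖ = 1) (hp0 : 0 < p.re) {z : ℂ} (hz : ‖z‖ < 1) :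
    0 < (cayley p z).im := by
  rw [cayley_im hp hz]
  have h1 : ‖z‖ ^ 2 < 1 := by nlinarith [norm_nonneg z]
  exact div_pos (mul_pos hp0 (by linarith)) (Complex.normSq_pos.2 (add_conj_ne_zero hp hz))

theorem add_I_mul_conj_ne_zero (hp0 : 0 < p.re) {w : ℂ} (hw : 0 < w.im) :
    w + Complex.I * conj p ≠ 0 := by
  intro h
  have := congrArg Complex.im h
  simp at this
  linarith

theorem norm_cayleyInv_lt_one (hp : ‖p‖ = 1) (hp0 : 0 < p.re) {w : ℂ} (hw : 0 < w.im) :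
    ‖cayleyInv p w‖ < 1 := by
  have hpp : Complex.normSq p = 1 := by rw [Complex.normSq_eq_norm_sq, hp]; norm_num
  rw [cayleyInv, norm_div, div_lt_one (norm_pos_iff.2 (add_I_mul_conj_ne_zero hp0 hw))]
  refine lt_of_pow_lt_pow_left₀ 2 (norm_nonneg _) ?_
  rw [← Complex.normSq_eq_norm_sq, ← Complex.normSq_eq_norm_sq]
  rw [Complex.normSq_apply] at *
  rw [Complex.normSq_apply]
  simp
  linear_combination 4 * mul_pos hp0 hw + (w.re ^ 2 + w.im ^ 2 - 1) * hpp

theorem cayleyInv_cayley (hp : ‖p‖ = 1) (hp0 : 0 < p.re) {z : ℂ} (hz : ‖z‖ < 1) :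
    cayleyInv p (cayley p z) = z := by
  have h1 := add_conj_ne_zero hp hz
  have hw := add_I_mul_conj_ne_zero hp0 (cayley_im_pos hp hp0 hz)
  rw [cayleyInv, div_eq_iff hw]
  have h2 : cayley p z * (z + conj p) = Complex.I * (1 - conj p * z) := div_mul_cancel₀ _ h1
  linear_combination -h2

theorem cayley_cayleyInv (hp : ‖p‖ = 1) (hp0 : 0 < p.re) {w : ℂ} (hw : 0 < w.im) :
    cayley p (cayleyInv p w) = w := by
  have h1 := add_I_mul_conj_ne_zero hp0 hw
  rw [cayley, div_eq_iff (add_conj_ne_zero hp (norm_cayleyInv_lt_one hp hp0 hw))]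
  have h2 : cayleyInv p w * (w + Complex.I * conj p) = Complex.I - conj p * w :=
    div_mul_cancel₀ _ h1
  linear_combination -h2

theorem cayley_glide (hp : ‖p‖ = 1) {c : ℂ} (hc : ‖c‖ < 1) (hpc : p.im = -c.im) (hcp : |c.re| < p.re)
    {z : ℂ}
    (hz : ‖z‖ < 1) :
    cayley p (discMap c (conj z)) =
      -((((p.re + c.re) / (p.re - c.re) : ℝ) : ℂ)) * conj (cayley p z) := by
  have hcz : ‖conj z‖ < 1 := by rwa [RCLike.norm_conj]
  have h1 := add_conj_ne_zero hp hz
  have h2 := add_conj_ne_zero hp (norm_discMap_lt_one hc hcz)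
  have h3 := one_sub_conj_mul_ne_zero hc hcz
  have h4 : conj z + p ≠ 0 := by
    intro h
    apply h1
    have := congrArg conj h
    simpa using this
  obtain ⟨h5, h6⟩ := abs_lt.1 hcp
  have h7 : ((p.re - c.re : ℝ) : ℂ) ≠ 0 := by exact_mod_cast (sub_pos.2 h6).ne'
  have e1 : c + p = (p.re + c.re : ℝ) := by
    apply Complex.ext <;> simp [hpc, add_comm]
  have e1' : conj c + conj p = (p.re + c.re : ℝ) := by
    apply Complex.ext <;> simp [hpc, add_comm]
  have e2 : conj p - c = (p.re - c.re : ℝ) := by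
    apply Complex.ext <;> simp [hpc]
  have e2' : p - conj c = (p.re - c.re : ℝ) := by
    apply Complex.ext <;> simp [hpc]
  have hpp := conj_mul_self_of_norm_one hp
  have hw : conj (cayley p z) = -Complex.I * (1 - p * conj z) / (conj z + p) := by
    simp [cayley]
  rw [hw, cayley, div_eq_iff h2]
  generalize conj z = Z at *
  have e3 : discMap c Z * (1 - conj c * Z) = Z - c := div_mul_cancel₀ _ h3
  have e4 : (1 - conj p * discMap c Z) * (1 - conj c * Z) = (p.re + c.re : ℝ) * (conj p - Z) := by
    linear_combination (-conj p) * e3 - hpp + conj p * e1 - Z * e1'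
  have e5 : (discMap c Z + conj p) * (1 - conj c * Z) = (p.re - c.re : ℝ) * (1 + conj p * Z) := by
    linear_combination e3 + e2 + conj p * Z * e2' - Z * hpp
  have e6 : ((((p.re + c.re) / (p.re - c.re) : ℝ) : ℂ)) * (p.re - c.re : ℝ) =
      (p.re + c.re : ℝ) := by
    rw [← Complex.ofReal_mul, div_mul_cancel₀]
    exact_mod_cast h7
  refine mul_right_cancel₀ h3 (mul_right_cancel₀ h4 ?_)
  have e7 : -Complex.I * (1 - p * Z) / (Z + p) * (Z + p) = -Complex.I * (1 - p * Z) :=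
    div_mul_cancel₀ _ h4
  generalize -Complex.I * (1 - p * Z) / (Z + p) = W at *
  generalize ((((p.re + c.re) / (p.re - c.re) : ℝ) : ℂ)) = L at *
  generalize ((p.re + c.re : ℝ) : ℂ) = S at *
  generalize ((p.re - c.re : ℝ) : ℂ) = R at *
  linear_combination Complex.I * (Z + p) * e4 + L * W * (Z + p) * e5 +
    L * R * (1 + conj p * Z) * e7 - Complex.I * (1 - p * Z) * (1 + conj p * Z) * e6 +
    Complex.I * S * (1 + Z ^ 2) * hpp

end Cayley

/-- The strip coordinates on the upper half plane in which `w ↦ -exp l * conj w` is a glide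
reflection. -/
noncomputable def stripMap (l : ℝ) (w : ℂ) : ℝ × ℝ :=
  ((Complex.log w).re / l, 2 * (Complex.log w).im / Real.pi - 1)

/-- The inverse of `stripMap l`. -/
noncomputable def stripInv (l : ℝ) (q : ℝ × ℝ) : ℂ :=
  Complex.exp ((q.1 * l : ℝ) + (Real.pi * (q.2 + 1) / 2 : ℝ) * Complex.I)

theorem continuous_stripInv (l : ℝ) : Continuous (stripInv l) := by
  unfold stripInv
  fun_prop

theorem continuousOn_stripMap (l : ℝ) : ContinuousOn (stripMap l) {w | 0 < w.im} := by
  have h : ContinuousOn Complex.log {w | 0 < w.im} := fun w hw =>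
    (continuousAt_clog (Or.inr (ne_of_gt hw))).continuousWithinAt
  exact ((Complex.continuous_re.comp_continuousOn h).div_const l).prodMk
    ((((continuousOn_const).mul (Complex.continuous_im.comp_continuousOn h)).div_const
      Real.pi).sub continuousOn_const)

theorem stripInv_im_pos (l : ℝ) {q : ℝ × ℝ} (hq : q.2 ∈ Ioo (-1 : ℝ) 1) :
    0 < (stripInv l q).im := by
  rw [stripInv, Complex.exp_im]
  refine mul_pos (Real.exp_pos _) ?_
  obtain ⟨h1, h2⟩ := hq
  have := Real.pi_pos
  refine Real.sin_pos_of_pos_of_lt_pi ?_ ?_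
  · simp
    nlinarith
  · simp
    nlinarith

theorem log_im_mem {w : ℂ} (hw : 0 < w.im) : (Complex.log w).im ∈ Ioo 0 Real.pi := by
  rw [Complex.log_im]
  refine ⟨(Complex.arg_nonneg_iff.2 hw.le).lt_of_ne fun h => ?_,
    Complex.arg_lt_pi_iff.2 (Or.inr hw.ne')⟩
  exact hw.ne' (Complex.arg_eq_zero_iff.1 h.symm).2

theorem stripMap_mem (l : ℝ) {w : ℂ} (hw : 0 < w.im) : (stripMap l w).2 ∈ Ioo (-1 : ℝ) 1 := by
  obtain ⟨h1, h2⟩ := log_im_mem hw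
  have := Real.pi_pos
  simp only [stripMap, mem_Ioo]
  constructor
  · have : 0 < 2 * (Complex.log w).im / Real.pi := by positivity
    linarith
  · have : 2 * (Complex.log w).im / Real.pi < 2 := by
      rw [div_lt_iff₀ this]
      linarith
    linarith

theorem stripInv_stripMap {l : ℝ} (hl : l ≠ 0) {w : ℂ} (hw : 0 < w.im) :
    stripInv l (stripMap l w) = w := by
  have hw0 : w ≠ 0 := by
    rintro rfl
    simp at hw
  have hpi := Real.pi_ne_zero
  have : ((stripMap l w).1 * l : ℝ) + (Real.pi * ((stripMap l w).2 + 1) / 2 : ℝ) * Complex.I =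
      Complex.log w := by
    rw [← Complex.re_add_im (Complex.log w)]
    simp only [stripMap]
    congr 3
    · field_simp
    · field_simp
      ring
  rw [stripInv, this, Complex.exp_log hw0]

theorem stripMap_stripInv {l : ℝ} (hl : l ≠ 0) {q : ℝ × ℝ} (hq : q.2 ∈ Ioo (-1 : ℝ) 1) :
    stripMap l (stripInv l q) = q := by
  obtain ⟨h1, h2⟩ := hq
  have hpi := Real.pi_pos
  have : Complex.log (stripInv l q) =
      (q.1 * l : ℝ) + (Real.pi * (q.2 + 1) / 2 : ℝ) * Complex.I := by
    rw [stripInv, Complex.log_exp]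
    · simp
      nlinarith
    · simp
      nlinarith
  rw [stripMap, this]
  ext
  · simp [hl]
  · simp
    field_simp
    ring

theorem stripMap_glide {l : ℝ} (hl : l ≠ 0) {w : ℂ} (hw : 0 < w.im) :
    stripMap l (-((Real.exp l : ℝ) : ℂ) * conj w) = ((stripMap l w).1 + 1, -(stripMap l w).2) := by
  have h1 : -((Real.exp l : ℝ) : ℂ) * conj w =
      stripInv l ((stripMap l w).1 + 1, -(stripMap l w).2) := by
    conv_lhs => rw [← stripInv_stripMap hl hw]
    set q := stripMap l w
    rw [stripInv, stripInv, ← Complex.exp_conj, Complex.ofReal_exp, neg_mul, ← Complex.exp_add,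
      ← Complex.exp_add_pi_mul_I]
    congr 1
    simp only [map_add, map_mul, Complex.conj_ofReal, Complex.conj_I]
    push_cast
    ring
  rw [h1, stripMap_stripInv hl]
  obtain ⟨h2, h3⟩ := stripMap_mem l hw
  constructor <;> simp only <;> linarith

/-- An antiholomorphic automorphism of the unit disc without fixed points is conjugate to a glide
reflection of a strip. -/
theorem exists_glide {T : ℂ → ℂ} (hd : DifferentiableOn ℂ (fun z => T (conj z)) (ball 0 1))
    (hb : BijOn T (ball 0 1) (ball 0 1)) (hfix : ∀ z ∈ ball (0 : ℂ) 1, T z ≠ z) :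
    ∃ (H : ℂ → ℝ × ℝ) (K : ℝ × ℝ → ℂ), ContinuousOn H (ball 0 1) ∧
      ContinuousOn K {q | q.2 ∈ Ioo (-1 : ℝ) 1} ∧ (∀ z ∈ ball (0 : ℂ) 1, (H z).2 ∈ Ioo (-1 : ℝ) 1) ∧
      (∀ q : ℝ × ℝ, q.2 ∈ Ioo (-1 : ℝ) 1 → K q ∈ ball (0 : ℂ) 1) ∧
      (∀ z ∈ ball (0 : ℂ) 1, K (H z) = z) ∧ (∀ q : ℝ × ℝ, q.2 ∈ Ioo (-1 : ℝ) 1 → H (K q) = q) ∧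
      ∀ z ∈ ball (0 : ℂ) 1, H (T z) = ((H z).1 + 1, -(H z).2) := by
  have hconj : BijOn (conj : ℂ → ℂ) (ball 0 1) (ball 0 1) := by
    have hm : MapsTo (conj : ℂ → ℂ) (ball 0 1) (ball 0 1) := fun z hz => by
      rwa [mem_ball_zero_iff, RCLike.norm_conj, ← mem_ball_zero_iff]
    exact ⟨hm, fun z _ w _ h => (starRingEnd ℂ).injective h,
      fun w hw => ⟨conj w, hm hw, Complex.conj_conj w⟩⟩
  obtain ⟨ε, c₀, hε, hc₀, hT⟩ := exists_eq_mul_discMap hd (hb.comp hconj)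
  obtain ⟨η, hη⟩ := IsAlgClosed.exists_pow_nat_eq ε two_pos
  have hη1 : ‖η‖ = 1 := by
    have : ‖η‖ ^ 2 = 1 := by rw [← norm_pow, hη, hε]
    exact (pow_eq_one_iff_of_nonneg (norm_nonneg _) two_ne_zero).1 this
  have hηη : η * conj η = 1 := by
    rw [Complex.mul_conj, Complex.normSq_eq_norm_sq, hη1]
    simp
  set c := c₀ * η with hcdef
  have hc : ‖c‖ < 1 := by rwa [hcdef, norm_mul, hη1, mul_one]
  have hTη : ∀ z ∈ ball (0 : ℂ) 1, conj η * T z = discMap c (conj (conj η * z)) := by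
    intro z hz
    have h1 := hT (conj z) (hconj.mapsTo hz)
    simp only [Complex.conj_conj] at h1
    rw [h1, ← hη, discMap, discMap, hcdef, map_mul, map_mul, Complex.conj_conj]
    rw [show conj c₀ * conj η * (η * conj z) = (η * conj η) * (conj c₀ * conj z) by ring, hηη,
      one_mul, ← mul_div_assoc, ← mul_div_assoc]
    congr 1
    linear_combination (η * conj z - η * c₀) * hηη
  have hcsq : c.re ^ 2 + c.im ^ 2 < 1 := by
    have h1 : ‖c‖ ^ 2 < 1 := by nlinarith [norm_nonneg c]
    rw [← Complex.normSq_eq_norm_sq, Complex.normSq_apply] at h1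
    linarith
  set r := Real.sqrt (1 - c.im ^ 2) with hr
  have hrsq : r ^ 2 = 1 - c.im ^ 2 := Real.sq_sqrt (by nlinarith [sq_nonneg c.re])
  have hr0 : 0 < r := Real.sqrt_pos.2 (by nlinarith [sq_nonneg c.re])
  set p : ℂ := ⟨r, -c.im⟩ with hpdef
  have hp : ‖p‖ = 1 := by
    have : ‖p‖ ^ 2 = 1 := by
      rw [← Complex.normSq_eq_norm_sq, Complex.normSq_apply]
      simp only [hpdef]
      linarith
    exact (pow_eq_one_iff_of_nonneg (norm_nonneg _) two_ne_zero).1 this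
  have hp0 : 0 < p.re := hr0
  have hcp : |c.re| < p.re := by
    refine abs_lt_of_sq_lt_sq ?_ hr0.le
    change _ < r ^ 2
    linarith
  obtain ⟨hcp1, hcp2⟩ := abs_lt.1 hcp
  set L : ℝ := (p.re + c.re) / (p.re - c.re) with hL
  have hL0 : 0 < L := div_pos (by linarith) (by linarith)
  have hnη : ∀ z ∈ ball (0 : ℂ) 1, ‖conj η * z‖ < 1 := fun z hz => by
    rwa [norm_mul, RCLike.norm_conj, hη1, one_mul, ← mem_ball_zero_iff]
  have hglide : ∀ z ∈ ball (0 : ℂ) 1,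
      cayley p (conj η * T z) = -(L : ℂ) * conj (cayley p (conj η * z)) := fun z hz => by
    rw [hTη z hz, cayley_glide hp hc rfl hcp (hnη z hz)]
  have hηK : ∀ w : ℂ, 0 < w.im → η * cayleyInv p w ∈ ball (0 : ℂ) 1 := fun w hw => by
    rw [mem_ball_zero_iff, norm_mul, hη1, one_mul]
    exact norm_cayleyInv_lt_one hp hp0 hw
  have hηc : ∀ w, conj η * (η * w) = w := fun w => by
    rw [← mul_assoc, mul_comm (conj η), hηη, one_mul]
  have hηc' : ∀ w, η * (conj η * w) = w := fun w => by rw [← mul_assoc, hηη, one_mul]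
  have hL1 : L ≠ 1 := by
    intro h
    have hI : 0 < Complex.I.im := by simp
    have h1 := hηK Complex.I hI
    refine hfix _ h1 ?_
    have h2 := hglide _ h1
    rw [hηc, cayley_cayleyInv hp hp0 hI, h] at h2
    have h3 := congrArg (cayleyInv p) h2
    rw [cayleyInv_cayley hp hp0 (hnη _ (hb.mapsTo h1))] at h3
    rw [← hηc' (T _), h3]
    simp
  set l := Real.log L with hl
  have hl0 : l ≠ 0 := Real.log_ne_zero_of_pos_of_ne_one hL0 hL1
  have hexp : Real.exp l = L := Real.exp_log hL0
  have hcont : ContinuousOn (fun z => cayley p (conj η * z)) (ball 0 1) := by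
    have : ∀ z ∈ ball (0 : ℂ) 1, conj η * z + conj p ≠ 0 := fun z hz =>
      add_conj_ne_zero hp (hnη z hz)
    unfold cayley
    fun_prop (disch := assumption)
  have hcontK : ContinuousOn (fun w => η * cayleyInv p w) {w | 0 < w.im} := by
    have : ∀ w ∈ {w : ℂ | 0 < w.im}, w + Complex.I * conj p ≠ 0 := fun w hw =>
      add_I_mul_conj_ne_zero hp0 hw
    unfold cayleyInv
    fun_prop (disch := assumption)
  refine ⟨fun z => stripMap l (cayley p (conj η * z)),
    fun q => η * cayleyInv p (stripInv l q), ?_, ?_, fun z hz => ?_, fun q hq => ?_,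
    fun z hz => ?_, fun q hq => ?_, fun z hz => ?_⟩
  · exact (continuousOn_stripMap l).comp hcont fun z hz => cayley_im_pos hp hp0 (hnη z hz)
  · exact hcontK.comp (continuous_stripInv l).continuousOn fun q hq => stripInv_im_pos l hq
  · exact stripMap_mem l (cayley_im_pos hp hp0 (hnη z hz))
  · exact hηK _ (stripInv_im_pos l hq)
  · have h1 := cayley_im_pos hp hp0 (hnη z hz)
    simp only [stripInv_stripMap hl0 h1, cayleyInv_cayley hp hp0 (hnη z hz), hηc']
  · have h1 := stripInv_im_pos l hq
    simp only [hηc, cayley_cayleyInv hp hp0 h1, stripMap_stripInv hl0 hq]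
  · have h1 := cayley_im_pos hp hp0 (hnη z hz)
    simp only [hglide z hz, ← hexp, stripMap_glide hl0 h1]

section Projection

theorem continuous_sphereProj : Continuous sphereProj := continuous_quot_mk

theorem surjective_sphereProj : Function.Surjective sphereProj := Quot.mk_surjective

theorem sphereProj_antipodal (x : Sphere2) : sphereProj (antipodal x) = sphereProj x :=
  (Quot.sound (r := fun x y : Sphere2 => y = antipodal x) rfl).symm

theorem sphereProj_eq_iff {x y : Sphere2} :
    sphereProj x = sphereProj y ↔ y = x ∨ y = antipodal x := by
  constructor
  · intro h
    have h' := Quot.eqvGen_exact h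
    induction h' with
    | rel a b hab => exact Or.inr hab
    | refl a => exact Or.inl rfl
    | symm a b hab ih =>
      rcases ih (Quot.eqvGen_sound hab) with e | e
      · exact Or.inl e.symm
      · right; rw [e, antipodal_antipodal]
    | trans a b c hab hbc ih1 ih2 =>
      rcases ih1 (Quot.eqvGen_sound hab) with e | e <;>
        rcases ih2 (Quot.eqvGen_sound hbc) with e' | e'
      · left; rw [e', e]
      · right; rw [e', e]
      · right; rw [e', e]
      · left; rw [e', e, antipodal_antipodal]
  · rintro (rfl | rfl)
    · rfl
    · exact (sphereProj_antipodal x).symm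

theorem preimage_image_sphereProj (S : Set Sphere2) :
    sphereProj ⁻¹' (sphereProj '' S) = S ∪ antipodal ⁻¹' S := by
  ext x
  constructor
  · rintro ⟨y, hy, h⟩
    rcases sphereProj_eq_iff.1 h with e | e
    · left; rw [e]; exact hy
    · right; rw [mem_preimage, e, antipodal_antipodal]; exact hy
  · rintro (h | h)
    · exact ⟨x, h, rfl⟩
    · exact ⟨_, h, sphereProj_antipodal x⟩

theorem isOpenMap_sphereProj : IsOpenMap sphereProj := by
  intro S hS
  rw [← isQuotientMap_quot_mk.isOpen_preimage]
  change IsOpen (sphereProj ⁻¹' (sphereProj '' S))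
  rw [preimage_image_sphereProj]
  exact hS.union (hS.preimage continuous_antipodal)

theorem isClosed_image_sphereProj {S : Set Sphere2} (hS : IsClosed S) :
    IsClosed (sphereProj '' S) := by
  rw [← isQuotientMap_quot_mk.isClosed_preimage]
  change IsClosed (sphereProj ⁻¹' (sphereProj '' S))
  rw [preimage_image_sphereProj]
  exact hS.union (hS.preimage continuous_antipodal)

theorem preimage_antipodal_preimage (S : Set Sphere2) :
    antipodal ⁻¹' (antipodal ⁻¹' S) = S := by
  ext x; simp [antipodal_antipodal]

theorem isConnected_preimage_antipodal {S : Set Sphere2} (hS : IsConnected S) :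
    IsConnected (antipodal ⁻¹' S) :=
  (antipodalHomeo.isConnected_preimage (s := S)).2 hS

theorem closure_preimage_antipodal (S : Set Sphere2) :
    closure (antipodal ⁻¹' S) = antipodal ⁻¹' closure S :=
  (antipodalHomeo.preimage_closure S).symm

end Projection

section Curve

theorem isConnected_of_curve {X : Type*} [TopologicalSpace X] {C : Set X}
    (hC : IsSimpleClosedCurve C) : IsConnected C := by
  obtain ⟨e⟩ := hC
  have h1 : IsConnected (Circle2) := by
    refine isConnected_sphere ?_ 0 zero_le_one
    rw [← Module.finrank_eq_rank]; simp
  have h2 : ConnectedSpace Circle2 := isConnected_iff_connectedSpace.1 h1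
  exact isConnected_iff_connectedSpace.2 (e.symm.surjective.connectedSpace e.symm.continuous)

/-- The antipodal map exchanges the two lifts of `Γ`. -/
theorem preimage_antipodal_of_lift {Γ : Set RealProjectivePlane} (hΓ : IsConnected Γ)
    {C₁ C₂ : Set Sphere2} (hpre : sphereProj ⁻¹' Γ = C₁ ∪ C₂) (hdisj : Disjoint C₁ C₂)
    (h₁ : IsConnected C₁) (h₂ : IsConnected C₂) (hc₁ : IsClosed C₁) (hc₂ : IsClosed C₂) :
    antipodal ⁻¹' C₁ = C₂ := by
  have hsym : antipodal ⁻¹' (C₁ ∪ C₂) = C₁ ∪ C₂ := by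
    rw [← hpre, ← preimage_comp]
    congr 1
    ext x
    exact sphereProj_antipodal x
  have himg : sphereProj '' C₁ ∪ sphereProj '' C₂ = Γ := by
    rw [← image_union, ← hpre, image_preimage_eq _ surjective_sphereProj]
  have hmeet : (sphereProj '' C₁ ∩ sphereProj '' C₂).Nonempty := by
    have := isPreconnected_closed_iff.1 hΓ.isPreconnected _ _ (isClosed_image_sphereProj hc₁)
      (isClosed_image_sphereProj hc₂) himg.ge
      (by rw [inter_eq_self_of_subset_right (himg ▸ subset_union_left)]
          exact h₁.nonempty.image _)
      (by rw [inter_eq_self_of_subset_right (himg ▸ subset_union_right)]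
          exact h₂.nonempty.image _)
    exact this.mono inter_subset_right
  obtain ⟨_, ⟨x, hx, rfl⟩, ⟨y, hy, hxy⟩⟩ := hmeet
  have hyx : antipodal y = x := by
    rcases sphereProj_eq_iff.1 hxy with e | e
    · exact absurd hy (disjoint_left.1 hdisj (e ▸ hx))
    · exact e.symm
  have key : ∀ P Q R : Set Sphere2, IsConnected R → antipodal ⁻¹' R ⊆ P ∪ Q → Disjoint P Q →
      IsClosed P → IsClosed Q → (antipodal ⁻¹' R ∩ Q).Nonempty → antipodal ⁻¹' R ⊆ Q := by
    intro P Q R hR hRs hPQ hP hQ hne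
    rcases (isPreconnected_iff_subset_of_disjoint_closed.1
      (isConnected_preimage_antipodal hR).isPreconnected) P Q hP hQ hRs
      (by rw [hPQ.inter_eq, inter_empty]) with h | h
    · obtain ⟨z, hz, hzQ⟩ := hne
      exact absurd hzQ (disjoint_left.1 hPQ (h hz))
    · exact h
  refine (key C₁ C₂ C₁ h₁ ?_ hdisj hc₁ hc₂ ⟨y, by rw [mem_preimage, hyx]; exact hx, hy⟩).antisymm ?_
  · rw [← hsym]; exact preimage_mono subset_union_left
  · have := key C₂ C₁ C₂ h₂ (by
      rw [union_comm, ← hsym]; exact preimage_mono subset_union_right) hdisj.symm hc₂ hc₁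
      ⟨x, by rw [mem_preimage, ← hyx, antipodal_antipodal]; exact hy, hx⟩
    have h' := preimage_mono (f := antipodal) this
    rwa [preimage_antipodal_preimage] at h'

/-- The pieces of the complement of a pair of antipodal disjoint curves: a cap `D` bounded by `C`,
its antipode, and the region between them. -/
structure CapDecomposition (C D : Set Sphere2) : Prop where
  isOpen : IsOpen D
  isConnected : IsConnected D
  closure_eq : closure D = D ∪ C
  disjoint_curve : Disjoint D C
  isConnected_compl : IsConnected (D ∪ C)ᶜ
  subset_closure_compl : C ⊆ closure (D ∪ C)ᶜ
  disjoint_antipodal : Disjoint (closure D) (antipodal ⁻¹' closure D)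
  isConnected_between : IsConnected (closure D ∪ antipodal ⁻¹' closure D)ᶜ

theorem exists_capDecomposition {C : Set Sphere2} (hC : IsSimpleClosedCurve C)
    (hd : Disjoint C (antipodal ⁻¹' C)) : ∃ D, CapDecomposition C D := by
  have key : ∀ D B : Set Sphere2, IsOpen D → IsOpen B → IsConnected D → IsConnected B →
      Disjoint D B → D ∪ B = Cᶜ → C ⊆ closure D → C ⊆ closure B → antipodal ⁻¹' C ⊆ B →
      CapDecomposition C D := by
    intro D B hD hB hDc hBc hDB hU hcD hcB hCB
    have hDC : Disjoint D C := by
      rw [disjoint_left]; intro x hx hxC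
      exact (hU ▸ Or.inl hx : x ∈ Cᶜ) hxC
    have hBC : Disjoint B C := by
      rw [disjoint_left]; intro x hx hxC
      exact (hU ▸ Or.inr hx : x ∈ Cᶜ) hxC
    have hcompl : (D ∪ C)ᶜ = B := by
      ext x
      have h1 : x ∈ D ∪ B ↔ x ∉ C := by rw [hU]; rfl
      have h2 : x ∈ D → x ∉ B := fun h => disjoint_left.1 hDB h
      simp only [mem_compl_iff, mem_union] at h1 ⊢
      tauto
    have hcompl' : Bᶜ = D ∪ C := by rw [← hcompl, compl_compl]
    have hclo : closure D = D ∪ C := by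
      apply Subset.antisymm
      · rw [← hcompl']
        exact closure_minimal (disjoint_left.1 hDB) hB.isClosed_compl
      · exact union_subset subset_closure hcD
    have hdis : Disjoint (closure D) (antipodal ⁻¹' closure D) := by
      have hsub : closure D ⊆ antipodal ⁻¹' D ∪ antipodal ⁻¹' B := by
        rw [← preimage_union, hU, hclo, preimage_compl]
        rintro x hx hxC
        have := hCB hxC
        rw [← hcompl] at this
        exact this hx
      rcases isPreconnected_iff_subset_of_disjoint.1 hDc.isPreconnected.closure _ _
        (hD.preimage continuous_antipodal) (hB.preimage continuous_antipodal) hsub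
        (by rw [← preimage_inter, hDB.inter_eq, preimage_empty, inter_empty]) with h | h
      · exfalso
        obtain ⟨x, hx⟩ := nonempty_of_curve hC
        have h1 : antipodal x ∈ D := h (hcD hx)
        have h2 := h (subset_closure h1)
        rw [mem_preimage, antipodal_antipodal] at h2
        exact disjoint_left.1 hDC h2 hx
      · rw [hclo, ← hcompl'] at h ⊢
        rw [disjoint_left]
        intro x hx hx'
        exact hx' (h hx)
    have hbet : (closure D ∪ antipodal ⁻¹' closure D)ᶜ = B ∩ antipodal ⁻¹' B := by
      rw [hclo, ← hcompl', compl_union, preimage_compl, compl_compl, compl_compl]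
    refine ⟨hD, hDc, hclo, hDC, hcompl ▸ hBc, hcompl ▸ hcB, hdis, ?_⟩
    rw [hbet]
    have hσB := isConnected_preimage_antipodal hBc
    have hBσ : IsOpen (antipodal ⁻¹' B) := hB.preimage continuous_antipodal
    have hne : Bᶜ.Nonempty := by
      rw [hcompl']; exact (nonempty_of_curve hC).mono subset_union_right
    constructor
    · obtain ⟨x, hx⟩ := nonempty_of_curve hC
      have h1 : x ∈ antipodal ⁻¹' B := hCB (by rwa [mem_preimage, antipodal_antipodal])
      obtain ⟨y, hy, hyB⟩ := _root_.mem_closure_iff.1 (hcB hx) _ hBσ h1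
      exact ⟨y, hyB, hy⟩
    · refine LogProp.isPreconnected_inter hB hBσ hne ?_ ?_ hBc.isPreconnected
        hσB.isPreconnected
      · obtain ⟨x, hx⟩ := hne
        exact ⟨antipodal x, by rwa [mem_compl_iff, mem_preimage, antipodal_antipodal]⟩
      · have : B ∪ antipodal ⁻¹' B = univ := by
          rw [hclo, ← hcompl', preimage_compl, disjoint_compl_left_iff_subset] at hdis
          ext x
          simp only [mem_union, mem_univ, iff_true]
          by_contra h
          push Not at h
          exact h.1 (hdis h.2)
        rw [this]
        exact logProp_sphere
  obtain ⟨P, Q, hP, hQ, hPc, hQc, hPQ, hU, hcP, hcQ⟩ := jordan_sphere hC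
  have hsub : antipodal ⁻¹' C ⊆ P ∪ Q := by
    rw [hU]; exact fun x hx hx' => disjoint_left.1 hd hx' hx
  have hpre := isConnected_preimage_antipodal (isConnected_of_curve hC)
  rcases isPreconnected_iff_subset_of_disjoint.1 hpre.isPreconnected P Q hP hQ hsub
    (by rw [hPQ.inter_eq, inter_empty]) with h | h
  · exact ⟨Q, key Q P hQ hP hQc hPc hPQ.symm (by rw [union_comm, hU]) hcQ hcP h⟩
  · exact ⟨P, key P Q hP hQ hPc hQc hPQ hU hcP hcQ h⟩

namespace CapDecomposition

variable {C D : Set Sphere2}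

/-- The region between a cap and its antipode. -/
def between (D : Set Sphere2) : Set Sphere2 := (closure D ∪ antipodal ⁻¹' closure D)ᶜ

theorem isOpen_between (D : Set Sphere2) : IsOpen (between D) :=
  (isClosed_closure.union (isClosed_closure.preimage continuous_antipodal)).isOpen_compl

theorem antipodal_mem_between {x : Sphere2} : antipodal x ∈ between D ↔ x ∈ between D := by
  simp only [between, mem_compl_iff, mem_union, mem_preimage, antipodal_antipodal]
  tauto

theorem preimage_image_between :
    sphereProj ⁻¹' (sphereProj '' between D) = between D := by
  rw [preimage_image_sphereProj]
  ext x
  simp [antipodal_mem_between]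

theorem preimage_frontier (S : Set RealProjectivePlane) :
    sphereProj ⁻¹' frontier S = frontier (sphereProj ⁻¹' S) :=
  isOpenMap_sphereProj.preimage_frontier_eq_frontier_preimage continuous_sphereProj S

theorem frontier_between (h : CapDecomposition C D) :
    frontier (between D) = C ∪ antipodal ⁻¹' C := by
  rw [(isOpen_between D).frontier_eq]
  have hσ : antipodal ⁻¹' (D ∪ C) = antipodal ⁻¹' D ∪ antipodal ⁻¹' C := preimage_union
  have hdis := h.disjoint_antipodal
  have hcl1 : closure (between D) ⊆ Dᶜ := by
    refine closure_minimal ?_ h.isOpen.isClosed_compl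
    exact fun x hx hxD => hx (Or.inl (subset_closure hxD))
  have hcl2 : closure (between D) ⊆ (antipodal ⁻¹' D)ᶜ := by
    refine closure_minimal ?_ (h.isOpen.preimage continuous_antipodal).isClosed_compl
    exact fun x hx hxD => hx (Or.inr (subset_closure hxD))
  have hC : C ⊆ closure (between D) := by
    intro x hx
    rw [_root_.mem_closure_iff]
    intro O hO hxO
    have h1 : x ∈ (antipodal ⁻¹' closure D)ᶜ :=
      disjoint_left.1 hdis (h.closure_eq ▸ Or.inr hx)
    have h2 : IsOpen (antipodal ⁻¹' closure D)ᶜ :=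
      (isClosed_closure.preimage continuous_antipodal).isOpen_compl
    obtain ⟨y, hy, hy'⟩ := _root_.mem_closure_iff.1 (h.subset_closure_compl hx) _ (hO.inter h2) ⟨hxO, h1⟩
    rw [← h.closure_eq] at hy'
    exact ⟨y, hy.1, fun hh => hh.elim hy' hy.2⟩
  have hσb : antipodal ⁻¹' between D = between D := by ext x; exact antipodal_mem_between
  have hC2 : antipodal ⁻¹' C ⊆ closure (between D) := by
    rw [← hσb, closure_preimage_antipodal]; exact preimage_mono hC
  apply Subset.antisymm
  · rintro x ⟨hx, hxb⟩
    rw [between, mem_compl_iff, not_not, h.closure_eq, hσ] at hxb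
    have h1 := hcl1 hx
    have h2 := hcl2 hx
    rcases hxb with (h' | h') | (h' | h')
    · exact absurd h' h1
    · exact Or.inl h'
    · exact absurd h' h2
    · exact Or.inr h'
  · rintro x (hx | hx)
    · exact ⟨hC hx, fun hb => hb (Or.inl (h.closure_eq ▸ Or.inr hx))⟩
    · exact ⟨hC2 hx, fun hb => hb (Or.inr (by
        rw [mem_preimage, h.closure_eq]; exact Or.inr hx))⟩

theorem frontier_caps (h : CapDecomposition C D) :
    frontier (D ∪ antipodal ⁻¹' D) = C ∪ antipodal ⁻¹' C := by
  rw [(h.isOpen.union (h.isOpen.preimage continuous_antipodal)).frontier_eq, closure_union,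
    closure_preimage_antipodal]
  have hdis := disjoint_left.1 h.disjoint_antipodal
  rw [h.closure_eq] at hdis ⊢
  have hDC := disjoint_left.1 h.disjoint_curve
  ext x
  have h1 := @hdis x
  have h2 := @hDC x
  have h3 := @hDC (antipodal x)
  simp only [Set.mem_sdiff, mem_union, mem_preimage] at h1 ⊢
  tauto

theorem compl_curves (h : CapDecomposition C D) :
    (C ∪ antipodal ⁻¹' C)ᶜ = (D ∪ antipodal ⁻¹' D) ∪ between D := by
  have hdis := disjoint_left.1 h.disjoint_antipodal
  have hDC := disjoint_left.1 h.disjoint_curve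
  rw [between]
  rw [h.closure_eq] at hdis ⊢
  ext x
  have h1 := @hdis x
  have h2 := @hDC x
  have h3 := @hDC (antipodal x)
  simp only [mem_compl_iff, mem_union, mem_preimage] at h1 ⊢
  tauto

end CapDecomposition

end Curve

section Disc

theorem exists_disc_coordinates {C D : Set Sphere2} (h : CapDecomposition C D)
    (hC : C.Nonempty) {u : Sphere2} (hu : u ∈ D) :
    ∃ (Φ : Sphere2 → ℂ) (Ψ : ℂ → Sphere2), ContinuousOn Φ D ∧ ContinuousOn Ψ (ball 0 1) ∧
      MapsTo Φ D (ball 0 1) ∧ MapsTo Ψ (ball 0 1) D ∧ LeftInvOn Ψ Φ D ∧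
      RightInvOn Ψ Φ (ball 0 1) ∧ Φ u = 0 := by
  obtain ⟨p, hp⟩ := hC
  set B : Set Sphere2 := (D ∪ C)ᶜ with hB
  have hpre : ∀ S : Set Sphere2, p ∉ S → IsConnected S → IsConnected (chart p ⁻¹' S) := by
    intro S hpS hS
    have hne : ∀ x ∈ S, x ≠ p := fun x hx hxp => hpS (hxp ▸ hx)
    have e : chart p ⁻¹' S = chartInv p '' S := by
      ext z
      constructor
      · intro hz; exact ⟨chart p z, hz, chartInv_chart p z⟩
      · rintro ⟨x, hx, rfl⟩
        rw [mem_preimage, chart_chartInv (hne x hx)]; exact hx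
    rw [e]
    exact hS.image _ ((continuousOn_chartInv p).mono hne)
  have hpD : p ∉ D := fun hpD => disjoint_left.1 h.disjoint_curve hpD hp
  have hpB : p ∉ B := fun hpB => hpB (Or.inr hp)
  set W := chart p ⁻¹' D with hW
  have hWo : IsOpen W := h.isOpen.preimage (continuous_chart p)
  have hWc : IsConnected W := hpre D hpD h.isConnected
  have hBc : IsConnected (chart p ⁻¹' B) := hpre B hpB h.isConnected_compl
  have hBW : Disjoint (chart p ⁻¹' B) W := by
    rw [disjoint_left]; exact fun z hz hz' => hz (Or.inl hz')
  have hBb : ¬ Bornology.IsBounded (chart p ⁻¹' B) := by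
    intro hb
    have hK : IsCompact (chart p '' closure (chart p ⁻¹' B)) :=
      hb.isCompact_closure.image (continuous_chart p)
    have hsub : B ⊆ chart p '' closure (chart p ⁻¹' B) := by
      intro x hx
      have hxp : x ≠ p := fun e => hpB (e ▸ hx)
      exact ⟨chartInv p x, subset_closure (by rwa [mem_preimage, chart_chartInv hxp]),
        chart_chartInv hxp⟩
    obtain ⟨z, _, hz⟩ := closure_minimal hsub hK.isClosed (h.subset_closure_compl hp)
    exact chart_ne p z hz
  have hWn : W ≠ univ := by
    obtain ⟨z, hz⟩ := hBc.nonempty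
    exact fun e => disjoint_left.1 hBW hz (e ▸ mem_univ z)
  have hKW : ∀ K ⊆ W, IsCompact K → Wᶜ ⊆ unwound K := by
    intro K hKW hK z hz
    have h1 : chart p ⁻¹' B ⊆ unwound K :=
      subset_unwound_of_unbounded hK hBc.isPreconnected (hBW.mono_right hKW) hBb
    refine mem_unwound_of_mem_closure hK h1 ?_ (fun hzK => hz (hKW hzK))
    rw [← (isOpenEmbedding_chart p).isOpenMap.preimage_closure_eq_closure_preimage
      (continuous_chart p), mem_preimage]
    by_cases hzC : chart p z ∈ C
    · exact h.subset_closure_compl hzC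
    · exact subset_closure (fun hh => hh.elim hz hzC)
  obtain ⟨F, G, hF, hG, hFm, hGm, hGF, hFG⟩ := riemann_mapping hWo hWc hWn
    (fun f hf h0 => exists_holomorphic_log hWo hWc hKW hf h0)
  have hup : u ≠ p := fun e => hpD (e ▸ hu)
  have huW : chartInv p u ∈ W := by rw [hW, mem_preimage, chart_chartInv hup]; exact hu
  set c := F (chartInv p u) with hc
  have hcb : ‖c‖ < 1 := by simpa using hFm huW
  have hcb' : ‖-c‖ < 1 := by simpa using hcb
  have hDp : ∀ x ∈ D, x ≠ p := fun x hx e => hpD (e ▸ hx)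
  have hDW : MapsTo (chartInv p) D W := fun x hx => by
    rw [hW, mem_preimage, chart_chartInv (hDp x hx)]; exact hx
  refine ⟨fun x => discMap c (F (chartInv p x)), fun z => chart p (G (discMap (-c) z)), ?_, ?_,
    ?_, ?_, ?_, ?_, ?_⟩
  · exact (differentiableOn_discMap hcb).continuousOn.comp (hF.continuousOn.comp
      ((continuousOn_chartInv p).mono hDp) hDW)
      (fun x hx => hFm (hDW hx))
  · exact (continuous_chart p).comp_continuousOn (hG.continuousOn.comp
      (differentiableOn_discMap hcb').continuousOn (mapsTo_discMap hcb'))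
  · exact fun x hx => mapsTo_discMap hcb (hFm (hDW hx))
  · exact fun z hz => hGm (mapsTo_discMap hcb' hz)
  · intro x hx
    have h1 : ‖F (chartInv p x)‖ < 1 := by simpa using hFm (hDW hx)
    change chart p (G (discMap (-c) (discMap c _))) = x
    rw [discMap_neg_discMap hcb h1, hGF (hDW hx), chart_chartInv (hDp x hx)]
  · intro z hz
    have h1 : ‖z‖ < 1 := by simpa using hz
    change discMap c (F (chartInv p (chart p (G (discMap (-c) z))))) = z
    rw [chartInv_chart, hFG (mapsTo_discMap hcb' hz)]
    simpa using discMap_neg_discMap hcb' h1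
  · change discMap c c = 0
    exact discMap_self c

/-- Mutually inverse continuous maps between sets give a homeomorphism. -/
def homeomorphOfInvOn {X Y : Type*} [TopologicalSpace X] [TopologicalSpace Y] {s : Set X}
    {t : Set Y} (f : X → Y) (g : Y → X) (hf : ContinuousOn f s) (hg : ContinuousOn g t)
    (hfm : MapsTo f s t) (hgm : MapsTo g t s) (hl : LeftInvOn g f s) (hr : RightInvOn g f t) :
    s ≃ₜ t where
  toFun := hfm.restrict
  invFun := hgm.restrict
  left_inv x := Subtype.ext (hl x.2)
  right_inv y := Subtype.ext (hr y.2)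
  continuous_toFun := hf.mapsToRestrict hfm
  continuous_invFun := hg.mapsToRestrict hgm

theorem nonempty_homeomorph_openDisk :
    Nonempty (ball (0 : ℂ) 1 ≃ₜ OpenDisk) := by
  let e := Complex.orthonormalBasisOneI.repr
  refine ⟨homeomorphOfInvOn e e.symm e.continuous.continuousOn e.symm.continuous.continuousOn
    ?_ ?_ (fun x _ => e.symm_apply_apply x) (fun x _ => e.apply_symm_apply x)⟩
  · intro z hz
    simpa using hz
  · intro z hz
    simpa using hz

theorem nonempty_homeomorph_image_of_injOn {X Y : Type*} [TopologicalSpace X]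
    [TopologicalSpace Y] {f : X → Y} (hf : Continuous f) (ho : IsOpenMap f) {s : Set X}
    (hs : IsOpen s) (hi : InjOn f s) : Nonempty (s ≃ₜ f '' s) := by
  have h : IsOpenEmbedding (s.domRestrict f) :=
    .of_continuous_injective_isOpenMap (hf.comp continuous_subtype_val)
      (injOn_iff_injective.1 hi) (ho.domRestrict hs)
  exact ⟨h.isEmbedding.toHomeomorph.trans (Homeomorph.setCongr (range_domRestrict f s))⟩

theorem CapDecomposition.nonempty_homeomorph_disk {C D : Set Sphere2}
    (h : CapDecomposition C D) (hC : C.Nonempty) :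
    Nonempty (sphereProj '' D ≃ₜ OpenDisk) := by
  obtain ⟨u, hu⟩ := h.isConnected.nonempty
  obtain ⟨Φ, Ψ, h1, h2, h3, h4, h5, h6, -⟩ := exists_disc_coordinates h hC hu
  have hinj : InjOn sphereProj D := by
    intro x hx y hy hxy
    rcases sphereProj_eq_iff.1 hxy with e | e
    · exact e.symm
    · exfalso
      refine disjoint_left.1 h.disjoint_antipodal (subset_closure hx) ?_
      rw [mem_preimage, ← e]; exact subset_closure hy
  obtain ⟨e1⟩ := nonempty_homeomorph_image_of_injOn continuous_sphereProj isOpenMap_sphereProj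
    h.isOpen hinj
  obtain ⟨e2⟩ := nonempty_homeomorph_openDisk
  exact ⟨(e1.symm.trans (homeomorphOfInvOn Φ Ψ h1 h2 h3 h4 h5 h6)).trans e2⟩

end Disc

section Deck

/-- Deck transformations of the universal covering of the sphere minus two antipodal points over
its quotient. -/
noncomputable def tau (k : ℤ) (w : ℂ) : ℂ := ⟨(-1 : ℝ) ^ k * w.re, w.im + k * Real.pi⟩

theorem tau_tau (j k : ℤ) (w : ℂ) : tau j (tau k w) = tau (j + k) w := by
  apply Complex.ext
  · simp only [tau, zpow_add₀ (by norm_num : (-1 : ℝ) ≠ 0)]; ring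
  · simp only [tau]; push_cast; ring

theorem tau_zero (w : ℂ) : tau 0 w = w := by
  apply Complex.ext <;> simp [tau]

theorem tau_neg_tau (k : ℤ) (w : ℂ) : tau (-k) (tau k w) = w := by
  rw [tau_tau, neg_add_cancel, tau_zero]

theorem tau_tau_neg (k : ℤ) (w : ℂ) : tau k (tau (-k) w) = w := by
  rw [tau_tau, add_neg_cancel, tau_zero]

theorem continuous_tau (k : ℤ) : Continuous (tau k) := by
  have : tau k = fun w => Complex.equivRealProdCLM.symm ((-1 : ℝ) ^ k * w.re, w.im + k * Real.pi) := by
    ext w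
    apply Complex.ext <;> simp [tau]
  rw [this]
  refine Complex.equivRealProdCLM.symm.continuous.comp ?_
  exact (continuous_const.mul Complex.continuous_re).prodMk
    (Complex.continuous_im.add continuous_const)

theorem tau_of_even {k : ℤ} (hk : Even k) (w : ℂ) : tau k w = w + k * (Real.pi * Complex.I) := by
  apply Complex.ext <;> simp [tau, hk.neg_one_zpow]

theorem tau_of_odd {k : ℤ} (hk : Odd k) (w : ℂ) :
    tau k w = -(starRingEnd ℂ) w + k * (Real.pi * Complex.I) := by
  apply Complex.ext <;> simp [tau, hk.neg_one_zpow]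

theorem tau_ne_self {k : ℤ} (hk : k ≠ 0) (w : ℂ) : tau k w ≠ w := by
  intro h
  have := congrArg Complex.im h
  simp [tau, hk, Real.pi_ne_zero] at this

/-- The universal covering of the sphere minus two antipodal points. -/
noncomputable def expChart (p : Sphere2) (w : ℂ) : Sphere2 := chart p (Complex.exp w)

theorem continuous_expChart (p : Sphere2) : Continuous (expChart p) :=
  (continuous_chart p).comp Complex.continuous_exp

theorem isOpenMap_expChart (p : Sphere2) : IsOpenMap (expChart p) :=
  (isOpenEmbedding_chart p).isOpenMap.comp Complex.isOpenMap_exp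

theorem chart_injective (p : Sphere2) : Function.Injective (chart p) :=
  (isOpenEmbedding_chart p).injective

theorem exists_expChart_eq {p x : Sphere2} (hx : x ≠ p) (hx' : x ≠ antipodal p) :
    ∃ w, expChart p w = x := by
  have h0 : chartInv p x ≠ 0 := by
    intro h
    apply hx'
    rw [← chart_chartInv hx, h, chart_zero]
  exact ⟨Complex.log (chartInv p x), by rw [expChart, Complex.exp_log h0, chart_chartInv hx]⟩

theorem expChart_ne_antipodal (p : Sphere2) (w : ℂ) : expChart p w ≠ antipodal p := by
  rw [← chart_zero p]
  exact fun h => Complex.exp_ne_zero w (chart_injective p h)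

theorem expChart_tau_one (p : Sphere2) (w : ℂ) :
    expChart p (tau 1 w) = antipodal (expChart p w) := by
  rw [expChart, expChart, ← antipodal_chart p (Complex.exp_ne_zero w), tau_of_odd odd_one]
  congr 1
  rw [Int.cast_one, one_mul, Complex.exp_add, Complex.exp_pi_mul_I, Complex.exp_neg,
    ← Complex.exp_conj]
  field_simp

theorem expChart_tau_even (p : Sphere2) {k : ℤ} (hk : Even k) (w : ℂ) :
    expChart p (tau k w) = expChart p w := by
  obtain ⟨n, rfl⟩ := hk
  rw [expChart, expChart, tau_of_even ⟨n, rfl⟩]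
  congr 1
  rw [Complex.exp_eq_exp_iff_exists_int]
  exact ⟨n, by push_cast; ring⟩

theorem expChart_tau_odd (p : Sphere2) {k : ℤ} (hk : Odd k) (w : ℂ) :
    expChart p (tau k w) = antipodal (expChart p w) := by
  obtain ⟨n, rfl⟩ := hk
  rw [← expChart_tau_one, ← expChart_tau_even p (even_two_mul n) (tau 1 w), tau_tau]

theorem exists_tau_of_expChart_eq {p : Sphere2} {w w' : ℂ} (h : expChart p w = expChart p w') :
    ∃ k : ℤ, Even k ∧ w' = tau k w := by
  obtain ⟨n, hn⟩ := Complex.exp_eq_exp_iff_exists_int.1 (chart_injective p h).symm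
  refine ⟨2 * n, even_two_mul n, ?_⟩
  rw [tau_of_even (even_two_mul n), hn]
  push_cast; ring

theorem sphereProj_expChart_tau (p : Sphere2) (k : ℤ) (w : ℂ) :
    sphereProj (expChart p (tau k w)) = sphereProj (expChart p w) := by
  rcases Int.even_or_odd k with hk | hk
  · rw [expChart_tau_even p hk]
  · rw [expChart_tau_odd p hk, sphereProj_antipodal]

theorem exists_tau_of_sphereProj_eq {p : Sphere2} {w w' : ℂ}
    (h : sphereProj (expChart p w) = sphereProj (expChart p w')) : ∃ k : ℤ, w' = tau k w := by
  rcases sphereProj_eq_iff.1 h with e | e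
  · obtain ⟨k, -, hk⟩ := exists_tau_of_expChart_eq e.symm
    exact ⟨k, hk⟩
  · rw [← expChart_tau_one] at e
    obtain ⟨k, -, hk⟩ := exists_tau_of_expChart_eq e.symm
    exact ⟨k + 1, by rw [hk, tau_tau]⟩

end Deck

section Winding

variable {C D : Set Sphere2}

/-- A point over a cap can escape to infinity over that cap. -/
theorem exists_escape (h : CapDecomposition C D) (hC : C.Nonempty) {u : Sphere2} (hu : u ∈ D)
    {w : ℂ} (hw : expChart (antipodal u) w ∈ D) :
    ∃ S : Set ℂ, w ∈ S ∧ IsPreconnected S ∧ ¬ Bornology.IsBounded S ∧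
      S ⊆ expChart (antipodal u) ⁻¹' D := by
  obtain ⟨Φ, Ψ, hΦ, hΨ, hΦm, hΨm, hl, hr, h0⟩ := exists_disc_coordinates h hC hu
  set p := antipodal u with hp
  have hpu : antipodal p = u := antipodal_antipodal u
  have hpD : p ∉ D := by
    intro hpD
    refine disjoint_left.1 h.disjoint_antipodal (subset_closure hpD) ?_
    rw [mem_preimage, hpu]; exact subset_closure hu
  have hDp : ∀ x ∈ D, x ≠ p := fun x hx e => hpD (e ▸ hx)
  set ζ := Φ (expChart p w) with hζ
  have hζb : ‖ζ‖ < 1 := by simpa using hΦm hw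
  have hΨ0 : Ψ 0 = u := by rw [← h0]; exact hl hu
  have hζ0 : ζ ≠ 0 := by
    intro e
    have h1 := hl hw
    rw [← hζ, e, hΨ0, ← hpu] at h1
    exact expChart_ne_antipodal p w h1.symm
  have hζp : 0 < ‖ζ‖ := norm_pos_iff.2 hζ0
  set r := ‖ζ‖⁻¹ with hrdef
  have hr1 : 1 < r := (one_lt_inv₀ hζp).2 hζb
  have hball : ∀ t : ℝ, t ∈ Ico 0 r → (t : ℂ) * ζ ∈ ball (0 : ℂ) 1 := by
    intro t ht
    rw [mem_ball_zero_iff, norm_mul, Complex.norm_real, Real.norm_of_nonneg ht.1]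
    calc t * ‖ζ‖ < r * ‖ζ‖ := by gcongr; exact ht.2
      _ = 1 := inv_mul_cancel₀ hζp.ne'
  set c : ℝ → ℂ := fun t => chartInv p (Ψ (t * ζ)) with hc
  have hcc : ContinuousOn c (Ico 0 r) := by
    refine (continuousOn_chartInv p).comp (hΨ.comp (by fun_prop) hball) ?_
    exact fun t ht => hDp _ (hΨm (hball t ht))
  have hc0 : c 0 = 0 := by
    apply chart_injective p
    simp only [hc, Complex.ofReal_zero, zero_mul, hΨ0]
    rw [chart_chartInv (hDp u hu), chart_zero, hpu]
  have hcne : ∀ t ∈ Ioo 0 r, c t ≠ 0 := by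
    intro t ht e
    have ht' : t ∈ Ico 0 r := ⟨ht.1.le, ht.2⟩
    have h1 : Ψ (t * ζ) = u := by
      rw [← chart_chartInv (hDp _ (hΨm (hball t ht')))]
      change chart p (c t) = u
      rw [e, chart_zero, hpu]
    have h2 := hr (hball t ht')
    rw [h1, h0] at h2
    exact mul_ne_zero (Complex.ofReal_ne_zero.2 ht.1.ne') hζ0 h2.symm
  have hr0 : (0 : ℝ) < r := zero_lt_one.trans hr1
  obtain ⟨g, hg, hge⟩ := logProp_of_contractible ((convex_Ioo 0 r).contractibleSpace
    (nonempty_Ioo.2 hr0)) isOpen_Ioo c (hcc.mono Ioo_subset_Ico_self) hcne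
  have h1mem : (1 : ℝ) ∈ Ioo 0 r := ⟨zero_lt_one, hr1⟩
  have hg1 : Complex.exp (g 1) = Complex.exp w := by
    rw [hge 1 h1mem]
    apply chart_injective p
    simp only [hc, Complex.ofReal_one, one_mul]
    rw [chart_chartInv (hDp _ (hΨm (by simpa using hζb))), hζ, hl hw]
    rfl
  obtain ⟨n, hn⟩ := Complex.exp_eq_exp_iff_exists_int.1 hg1.symm
  set gs : ℝ → ℂ := fun t => g t + n * (2 * Real.pi * Complex.I) with hgd
  have hgs : ∀ t ∈ Ioo 0 r, Complex.exp (gs t) = c t := by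
    intro t ht
    rw [← hge t ht, Complex.exp_eq_exp_iff_exists_int]
    exact ⟨n, rfl⟩
  refine ⟨gs '' Ioo 0 r, ⟨1, h1mem, hn.symm⟩,
    isPreconnected_Ioo.image _ (hg.add continuousOn_const), ?_, ?_⟩
  · intro hb
    obtain ⟨R, hR⟩ := isBounded_iff_forall_norm_le.1 hb
    have h1 : ∀ t ∈ Ioo 0 r, Real.exp (-R) ≤ ‖c t‖ := by
      intro t ht
      rw [← hgs t ht, Complex.norm_exp, Real.exp_le_exp]
      have := hR _ (mem_image_of_mem gs ht)
      have := (abs_le.1 (Complex.abs_re_le_norm (gs t))).1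
      linarith
    have h2 : Tendsto (fun t => ‖c t‖) (𝓝[>] 0) (𝓝 0) := by
      have := (hcc 0 ⟨le_rfl, hr0⟩).norm
      rw [ContinuousWithinAt, hc0, norm_zero] at this
      refine this.mono_left ?_
      rw [← nhdsWithin_Ioo_eq_nhdsGT hr0]
      exact nhdsWithin_mono _ Ioo_subset_Ico_self
    have h3 := ge_of_tendsto h2 (by
      filter_upwards [Ioo_mem_nhdsGT hr0] with t ht using h1 t ht)
    exact absurd h3 (not_le.2 (Real.exp_pos _))
  · rintro _ ⟨t, ht, rfl⟩
    have ht' : t ∈ Ico 0 r := ⟨ht.1.le, ht.2⟩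
    rw [mem_preimage, expChart, hgs t ht]
    simp only [hc]
    rw [chart_chartInv (hDp _ (hΨm (hball t ht')))]
    exact hΨm (hball t ht')

theorem exists_escape_union (h : CapDecomposition C D) (hC : C.Nonempty) {u : Sphere2}
    (hu : u ∈ D) {w : ℂ} (hw : expChart (antipodal u) w ∈ D ∪ antipodal ⁻¹' D) :
    ∃ S : Set ℂ, w ∈ S ∧ IsPreconnected S ∧ ¬ Bornology.IsBounded S ∧
      S ⊆ expChart (antipodal u) ⁻¹' (D ∪ antipodal ⁻¹' D) := by
  rcases hw with hw | hw
  · obtain ⟨S, h1, h2, h3, h4⟩ := exists_escape h hC hu hw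
    exact ⟨S, h1, h2, h3, fun z hz => Or.inl (h4 hz)⟩
  · rw [mem_preimage, ← expChart_tau_one] at hw
    obtain ⟨S, h1, h2, h3, h4⟩ := exists_escape h hC hu hw
    refine ⟨tau (-1) '' S, ⟨_, h1, tau_neg_tau 1 w⟩, h2.image _ (continuous_tau _).continuousOn,
      ?_, ?_⟩
    · intro hb
      apply h3
      refine (hb.isCompact_closure.image (continuous_tau 1)).isBounded.subset ?_
      intro z hz
      exact ⟨_, subset_closure ⟨z, hz, rfl⟩, tau_tau_neg 1 z⟩
    · rintro _ ⟨z, hz, rfl⟩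
      right
      rw [mem_preimage, ← expChart_tau_one, tau_tau_neg]
      exact h4 hz

open CapDecomposition in
theorem compl_subset_unwound_of_between (h : CapDecomposition C D) (hC : C.Nonempty) {u : Sphere2}
    (hu : u ∈ D) {K : Set ℂ} (hK : IsCompact K)
    (hKT : K ⊆ expChart (antipodal u) ⁻¹' between D) :
    (expChart (antipodal u) ⁻¹' between D)ᶜ ⊆ unwound K := by
  set p := antipodal u
  have hcaps : expChart p ⁻¹' (D ∪ antipodal ⁻¹' D) ⊆ unwound K := by
    intro w hw
    obtain ⟨S, h1, h2, h3, h4⟩ := exists_escape_union h hC hu hw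
    refine subset_unwound_of_unbounded hK h2 ?_ h3 h1
    rw [disjoint_left]
    intro z hz hzK
    rcases h4 hz with h5 | h5
    · exact hKT hzK (Or.inl (subset_closure h5))
    · exact hKT hzK (Or.inr (show antipodal _ ∈ closure D from subset_closure h5))
  intro w hw
  refine mem_unwound_of_mem_closure hK hcaps ?_ (fun hwK => hw (hKT hwK))
  rw [← (isOpenMap_expChart p).preimage_closure_eq_closure_preimage (continuous_expChart p),
    closure_union, closure_preimage_antipodal]
  simpa only [between, mem_compl_iff, mem_preimage, not_not] using hw

open CapDecomposition in
theorem CapDecomposition.component_ne_univ (h : CapDecomposition C D) (hC : C.Nonempty)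
    {u : Sphere2} (hu : u ∈ D) (a : ℂ) :
    connectedComponentIn (expChart (antipodal u) ⁻¹' between D) a ≠ univ := by
  intro e
  obtain ⟨x, hx⟩ := hC
  have hxcl : x ∈ closure D := by rw [h.closure_eq]; exact Or.inr hx
  have hx1 : x ≠ antipodal u := by
    rintro rfl
    exact disjoint_left.1 h.disjoint_antipodal hxcl (by
      rw [mem_preimage, antipodal_antipodal]; exact subset_closure hu)
  have hx2 : x ≠ antipodal (antipodal u) := by
    rw [antipodal_antipodal]
    rintro rfl
    exact disjoint_left.1 h.disjoint_curve hu hx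
  obtain ⟨z, rfl⟩ := exists_expChart_eq hx1 hx2
  have hz := connectedComponentIn_subset (expChart (antipodal u) ⁻¹' between D) a (e ▸ mem_univ z)
  exact hz (Or.inl hxcl)

open CapDecomposition in
theorem compl_component_subset_unwound (h : CapDecomposition C D) (hC : C.Nonempty) {u : Sphere2}
    (hu : u ∈ D) (a : ℂ) {K : Set ℂ} (hK : IsCompact K)
    (hKT : K ⊆ connectedComponentIn (expChart (antipodal u) ⁻¹' between D) a) :
    (connectedComponentIn (expChart (antipodal u) ⁻¹' between D) a)ᶜ ⊆ unwound K := by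
  set T := expChart (antipodal u) ⁻¹' between D with hT
  have hTo : IsOpen T := (isOpen_between D).preimage (continuous_expChart _)
  have hout := compl_subset_unwound_of_between h hC hu hK
    (hKT.trans (connectedComponentIn_subset _ _))
  intro w hw
  by_cases hwT : w ∈ T
  swap
  · exact hout hwT
  set Y := connectedComponentIn T w with hY
  have hwY : w ∈ Y := mem_connectedComponentIn hwT
  have hYo : IsOpen Y := hTo.connectedComponentIn
  have hYK : ∀ z ∈ Y, z ∉ K := by
    intro z hz hzK
    have h1 := connectedComponentIn_eq (hKT hzK)
    have h2 := connectedComponentIn_eq hz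
    exact hw (by rw [h1, ← h2]; exact hwY)
  have hYn : ∃ y ∈ closure Y, y ∉ Y := by
    by_contra! hcl
    have hclo : IsClosed Y := isClosed_of_closure_subset hcl
    rcases isClopen_iff.1 ⟨hclo, hYo⟩ with e | e
    · rw [e] at hwY; exact hwY
    · exact h.component_ne_univ hC hu w e
  obtain ⟨y, hyc, hyY⟩ := hYn
  have hyT : y ∉ T := by
    intro hyT
    obtain ⟨z, hz, hzY⟩ := _root_.mem_closure_iff.1 hyc _ hTo.connectedComponentIn
      (mem_connectedComponentIn hyT)
    have h1 := connectedComponentIn_eq hz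
    have h2 := connectedComponentIn_eq hzY
    exact hyY (by rw [hY, h2, ← h1]; exact mem_connectedComponentIn hyT)
  obtain ⟨z, hzu, hzY⟩ := _root_.mem_closure_iff.1 hyc _ (isOpen_unwound hK.isClosed) (hout hyT)
  have hpre : IsPreconnected Y := isPreconnected_connectedComponentIn
  exact hpre.subset_left_of_subset_union (isOpen_unwound hK.isClosed) (isOpen_wound hK.isClosed)
    disjoint_sdiff_right (fun v hv => by
      by_cases hvu : v ∈ unwound K
      · exact Or.inl hvu
      · exact Or.inr ⟨hYK v hv, hvu⟩) ⟨z, hzY, hzu⟩ hwY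

end Winding

section Mobius

/-- Strip coordinates on a simply connected domain with a free orientation-reversing deck
transformation. -/
theorem exists_strip_coordinates {Y : Set ℂ} (hY : IsOpen Y) (hYc : IsConnected Y)
    (hYn : Y ≠ univ) (hKW : ∀ K ⊆ Y, IsCompact K → Yᶜ ⊆ unwound K) {m : ℤ} (hm : Odd m)
    (hmaps : MapsTo (tau m) Y Y) (hmaps' : MapsTo (tau (-m)) Y Y) :
    ∃ L : MobiusDom → ℂ, IsOpenEmbedding L ∧ range L = Y ∧
      ∀ y y', mobiusRel y y' ↔ L y' = tau m (L y) := by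
  obtain ⟨F, G, hF, hG, hFm, hGm, hGF, hFG⟩ := riemann_mapping hY hYc hYn
    (fun f hf h0 => exists_holomorphic_log hY hYc hKW hf h0)
  have hm0 : m ≠ 0 := by rintro rfl; simp at hm
  have hcb : ∀ z ∈ ball (0 : ℂ) 1, conj z ∈ ball (0 : ℂ) 1 := fun z hz => by
    rwa [mem_ball_zero_iff, RCLike.norm_conj, ← mem_ball_zero_iff]
  have hd : DifferentiableOn ℂ (fun z => F (tau m (G (conj z)))) (ball 0 1) := by
    intro z hz
    have h1 : DifferentiableAt ℂ (fun z => tau m (G (conj z))) z := by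
      have h2 : DifferentiableAt ℂ (conj ∘ G ∘ conj) z := by
        have := (hG.differentiableAt (isOpen_ball.mem_nhds (hcb z hz))).conj_conj
        simpa only [Complex.conj_conj] using this
      have h3 := h2.neg.add_const (m * (Real.pi * Complex.I))
      refine h3.congr_of_eventuallyEq (Eventually.of_forall fun w => ?_)
      exact tau_of_odd hm _
    have h2 : DifferentiableAt ℂ F (tau m (G (conj z))) :=
      hF.differentiableAt (hY.mem_nhds (hmaps (hGm (hcb z hz))))
    exact (h2.comp z h1).differentiableWithinAt
  have hmT : MapsTo (fun z => F (tau m (G z))) (ball 0 1) (ball 0 1) :=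
    fun z hz => hFm (hmaps (hGm hz))
  have hb : BijOn (fun z => F (tau m (G z))) (ball 0 1) (ball 0 1) := by
    refine InvOn.bijOn (f' := fun z => F (tau (-m) (G z))) ⟨?_, ?_⟩ hmT
      (fun z hz => hFm (hmaps' (hGm hz)))
    · intro z hz
      change F (tau (-m) (G (F (tau m (G z))))) = z
      rw [hGF (hmaps (hGm hz)), tau_neg_tau, hFG hz]
    · intro z hz
      change F (tau m (G (F (tau (-m) (G z))))) = z
      rw [hGF (hmaps' (hGm hz)), tau_tau_neg, hFG hz]
  have hfix : ∀ z ∈ ball (0 : ℂ) 1, F (tau m (G z)) ≠ z := by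
    intro z hz e
    have h1 := hGF (hmaps (hGm hz))
    rw [e] at h1
    exact tau_ne_self hm0 (G z) h1.symm
  obtain ⟨H, K, hH, hK, hHm, hKm, hKH, hHK, hT⟩ := exists_glide hd hb hfix
  let e : {q : ℝ × ℝ | q.2 ∈ Ioo (-1 : ℝ) 1} ≃ₜ Y :=
    homeomorphOfInvOn (fun q => G (K q)) (fun w => H (F w))
      (hG.continuousOn.comp hK (fun q hq => hKm q hq))
      (hH.comp hF.continuousOn hFm) (fun q hq => hGm (hKm q hq)) (fun w hw => hHm _ (hFm hw))
      (fun q hq => by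
        change H (F (G (K q))) = q
        rw [hFG (hKm q hq), hHK q hq])
      (fun w hw => by
        change G (K (H (F w))) = w
        rw [hKH _ (hFm hw), hGF hw])
  refine ⟨fun y => G (K y.1), hY.isOpenEmbedding_subtypeVal.comp e.isOpenEmbedding, ?_, ?_⟩
  · ext w
    constructor
    · rintro ⟨y, rfl⟩
      exact hGm (hKm y.1 y.2)
    · intro hw
      exact ⟨⟨H (F w), hHm _ (hFm hw)⟩, by
        change G (K (H (F w))) = w
        rw [hKH _ (hFm hw), hGF hw]⟩
  · intro y y'
    have hy := hKm y.1 y.2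
    have hy' := hKm y'.1 y'.2
    have h1 := hT (K y.1) hy
    rw [hHK y.1 y.2] at h1
    constructor
    · rintro ⟨ha, hb⟩
      have h2 : y'.1 = H (F (tau m (G (K y.1)))) := by
        rw [h1]; exact Prod.ext ha hb
      change G (K y'.1) = tau m (G (K y.1))
      rw [h2, hKH _ (hmT hy), hGF (hmaps (hGm hy))]
    · intro h
      have h2 : y'.1 = (y.1.1 + 1, -y.1.2) := by
        rw [← h1, ← show G (K y'.1) = tau m (G (K y.1)) from h, hFG hy', hHK y'.1 y'.2]
      exact ⟨congrArg Prod.fst h2, congrArg Prod.snd h2⟩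

/-- An open continuous map whose fibres are the classes of a relation identifies its range with
the quotient. -/
theorem nonempty_homeomorph_quot {X Z : Type*} [TopologicalSpace X] [TopologicalSpace Z]
    {r : X → X → Prop} {f : X → Z} (hf : Continuous f) (ho : IsOpenMap f)
    (hr : ∀ x y, r x y → f x = f y) (hi : ∀ x y, f x = f y → Quot.mk r x = Quot.mk r y) :
    Nonempty (range f ≃ₜ Quot r) := by
  have h : IsOpenEmbedding (Quot.lift f hr) := by
    refine .of_continuous_injective_isOpenMap (continuous_quot_lift hr hf) ?_ ?_
    · rintro ⟨x⟩ ⟨y⟩ hxy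
      exact hi x y hxy
    · intro O hO
      have e : Quot.lift f hr '' O = f '' (Quot.mk r ⁻¹' O) := by
        ext z
        constructor
        · rintro ⟨⟨x⟩, hx, rfl⟩
          exact ⟨x, hx, rfl⟩
        · rintro ⟨x, hx, rfl⟩
          exact ⟨Quot.mk r x, hx, rfl⟩
      rw [e]
      exact ho _ (hO.preimage continuous_quot_mk)
  have hrange : range (Quot.lift f hr) = range f := by
    ext z
    constructor
    · rintro ⟨⟨x⟩, rfl⟩
      exact ⟨x, rfl⟩
    · rintro ⟨x, rfl⟩
      exact ⟨Quot.mk r x, rfl⟩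
  exact ⟨(h.isEmbedding.toHomeomorph.trans (Homeomorph.setCongr hrange)).symm⟩

section Component

variable {p : Sphere2} {A : Set Sphere2} {a : ℂ}

theorem tau_mem_preimage (hσ : antipodal ⁻¹' A = A) (k : ℤ) {w : ℂ}
    (hw : w ∈ expChart p ⁻¹' A) : tau k w ∈ expChart p ⁻¹' A := by
  rcases Int.even_or_odd k with hk | hk
  · rwa [mem_preimage, expChart_tau_even p hk]
  · rw [mem_preimage, expChart_tau_odd p hk, ← mem_preimage (f := antipodal), hσ]; exact hw

theorem tau_image_subset_component (hσ : antipodal ⁻¹' A = A) {S : Set ℂ} (hS : IsPreconnected S)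
    (hSA : S ⊆ expChart p ⁻¹' A) {k : ℤ} {z : ℂ} (hz : z ∈ S)
    (hk : tau k z ∈ connectedComponentIn (expChart p ⁻¹' A) a) :
    MapsTo (tau k) S (connectedComponentIn (expChart p ⁻¹' A) a) := by
  rw [connectedComponentIn_eq hk]
  have : tau k '' S ⊆ connectedComponentIn (expChart p ⁻¹' A) (tau k z) :=
    (hS.image _ (continuous_tau k).continuousOn).subset_connectedComponentIn ⟨z, hz, rfl⟩ (by
      rintro _ ⟨w, hw, rfl⟩
      exact tau_mem_preimage hσ k (hSA hw))
  exact fun w hw => this ⟨w, hw, rfl⟩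

/-- A component of the preimage of a connected symmetric open set covers that set. -/
theorem image_component (hσ : antipodal ⁻¹' A = A) (hA : IsOpen A) (hAc : IsConnected A)
    (hAp : ∀ x ∈ A, x ≠ p ∧ x ≠ antipodal p) (ha : a ∈ expChart p ⁻¹' A) :
    expChart p '' connectedComponentIn (expChart p ⁻¹' A) a = A := by
  have hTo : IsOpen (expChart p ⁻¹' A) := hA.preimage (continuous_expChart p)
  set Y := connectedComponentIn (expChart p ⁻¹' A) a with hY
  have haY : a ∈ Y := mem_connectedComponentIn ha
  have hYA : expChart p '' Y ⊆ A := by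
    rintro _ ⟨w, hw, rfl⟩
    exact connectedComponentIn_subset (expChart p ⁻¹' A) a hw
  refine hYA.antisymm (hAc.isPreconnected.subset_of_closure_inter_subset
    (isOpenMap_expChart p _ hTo.connectedComponentIn) ⟨expChart p a, ha, a, haY, rfl⟩ ?_)
  rintro x ⟨hxc, hxA⟩
  obtain ⟨w, rfl⟩ := exists_expChart_eq (hAp x hxA).1 (hAp x hxA).2
  obtain ⟨ε, hε, hball⟩ := Metric.isOpen_iff.1 hTo w hxA
  obtain ⟨_, ⟨v, hv, rfl⟩, ⟨y, hy, hyv⟩⟩ := _root_.mem_closure_iff.1 hxc _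
    (isOpenMap_expChart p _ isOpen_ball) ⟨w, mem_ball_self hε, rfl⟩
  obtain ⟨k, hk, hyk⟩ := exists_tau_of_expChart_eq hyv.symm
  rw [hyk] at hy
  exact ⟨tau k w, tau_image_subset_component hσ (convex_ball w ε).isPreconnected hball hv hy
    (mem_ball_self hε), expChart_tau_even p hk w⟩

/-- The stabilizer of a component is generated by an odd translation length. -/
theorem exists_odd_generator (hσ : antipodal ⁻¹' A = A) (hA : IsOpen A) (hAc : IsConnected A)
    (hAp : ∀ x ∈ A, x ≠ p ∧ x ≠ antipodal p) (ha : a ∈ expChart p ⁻¹' A) :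
    ∃ m : ℤ, Odd m ∧ ∀ k : ℤ, m ∣ k ↔
      MapsTo (tau k) (connectedComponentIn (expChart p ⁻¹' A) a)
        (connectedComponentIn (expChart p ⁻¹' A) a) := by
  have himg := image_component hσ hA hAc hAp ha
  have hmove := fun (k : ℤ) (z : ℂ) => tau_image_subset_component (a := a) (k := k) (z := z) hσ
    (isPreconnected_connectedComponentIn (x := a) (F := expChart p ⁻¹' A))
    (connectedComponentIn_subset _ a)
  have haY := mem_connectedComponentIn ha
  set Y := connectedComponentIn (expChart p ⁻¹' A) a
  let S : AddSubgroup ℤ :=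
    { carrier := {k | MapsTo (tau k) Y Y}
      zero_mem' := fun w hw => by rwa [tau_zero]
      add_mem' := fun {j k} hj hk w hw => by rw [← tau_tau]; exact hj (hk hw)
      neg_mem' := fun {k} hk => hmove (-k) (tau k a) (hk haY) (by rwa [tau_neg_tau]) }
  obtain ⟨m, hm⟩ := Int.subgroup_cyclic S
  have hmS : ∀ k : ℤ, m ∣ k ↔ MapsTo (tau k) Y Y := by
    intro k
    rw [← Int.mem_zmultiples_iff, AddSubgroup.zmultiples_eq_closure, ← hm]
    rfl
  refine ⟨m, ?_, hmS⟩
  have h1 : expChart p (tau 1 a) ∈ expChart p '' Y := by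
    rw [himg]; exact tau_mem_preimage hσ 1 ha
  obtain ⟨y, hy, hya⟩ := h1
  obtain ⟨k, hk, hyk⟩ := exists_tau_of_expChart_eq hya.symm
  rw [hyk, tau_tau] at hy
  have hdvd : m ∣ k + 1 := (hmS (k + 1)).2 (hmove _ a haY hy)
  rw [← Int.not_even_iff_odd]
  exact fun he => Int.not_even_iff_odd.2 hk.add_one (even_iff_two_dvd.2 (he.two_dvd.trans hdvd))

end Component

open CapDecomposition in
theorem CapDecomposition.nonempty_homeomorph_mobius {C D : Set Sphere2}
    (h : CapDecomposition C D) (hC : C.Nonempty) :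
    Nonempty (sphereProj '' between D ≃ₜ OpenMobius) := by
  obtain ⟨u, hu⟩ := h.isConnected.nonempty
  set p := antipodal u with hp
  have hAp : ∀ x ∈ between D, x ≠ p ∧ x ≠ antipodal p := by
    intro x hx
    rw [hp, antipodal_antipodal]
    refine ⟨?_, ?_⟩
    · rintro rfl
      exact hx (Or.inr (by rw [mem_preimage, antipodal_antipodal]; exact subset_closure hu))
    · rintro rfl
      exact hx (Or.inl (subset_closure hu))
  have hσ : antipodal ⁻¹' between D = between D := by ext x; exact antipodal_mem_between
  obtain ⟨x, hx⟩ := h.isConnected_between.nonempty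
  obtain ⟨a, rfl⟩ := exists_expChart_eq (hAp x hx).1 (hAp x hx).2
  have hA := isOpen_between D
  have himg := image_component hσ hA h.isConnected_between hAp hx
  obtain ⟨m, hm, hmS⟩ := exists_odd_generator hσ hA h.isConnected_between hAp hx
  have hYo : IsOpen (connectedComponentIn (expChart p ⁻¹' between D) a) :=
    (hA.preimage (continuous_expChart p)).connectedComponentIn
  have hYc : IsConnected (connectedComponentIn (expChart p ⁻¹' between D) a) :=
    isConnected_connectedComponentIn_iff.2 hx
  have hmove := fun (k : ℤ) (z : ℂ) => tau_image_subset_component (a := a) (k := k) (z := z) hσ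
    (isPreconnected_connectedComponentIn (x := a) (F := expChart p ⁻¹' between D))
    (connectedComponentIn_subset _ a)
  have hYn := h.component_ne_univ hC hu a
  set Y := connectedComponentIn (expChart p ⁻¹' between D) a
  obtain ⟨L, hL, hLr, hLm⟩ := exists_strip_coordinates hYo hYc hYn
    (fun K hK hKc => compl_component_subset_unwound h hC hu a hKc hK) hm
    ((hmS m).1 dvd_rfl) ((hmS (-m)).1 (by simp))
  have hLY : ∀ y, L y ∈ Y := fun y => hLr ▸ mem_range_self y
  have hfc : Continuous (fun y => sphereProj (expChart p (L y))) :=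
    continuous_sphereProj.comp ((continuous_expChart p).comp hL.continuous)
  have hfo : IsOpenMap (fun y => sphereProj (expChart p (L y))) :=
    isOpenMap_sphereProj.comp ((isOpenMap_expChart p).comp hL.isOpenMap)
  have hrange : range (fun y => sphereProj (expChart p (L y))) = sphereProj '' between D := by
    rw [← himg, ← hLr, ← range_comp, ← range_comp]
    rfl
  have hsurj : ∀ w ∈ Y, ∃ y, L y = w := fun w hw => by rw [← hLr] at hw; exact hw
  have hpow : ∀ j : ℤ, ∀ y y', L y' = tau (m * j) (L y) →
      Quot.mk mobiusRel y = Quot.mk mobiusRel y' := by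
    intro j
    induction j using Int.induction_on with
    | zero =>
      intro y y' hy
      rw [mul_zero, tau_zero] at hy
      rw [hL.injective hy]
    | succ i ih =>
      intro y y' hy
      obtain ⟨y'', hy''⟩ := hsurj _ ((hmS (m * i)).1 (dvd_mul_right m i) (hLY y))
      rw [ih y y'' hy'']
      refine Quot.sound ((hLm y'' y').2 ?_)
      rw [hy, hy'', tau_tau]
      congr 1; ring
    | pred i ih =>
      intro y y' hy
      obtain ⟨y'', hy''⟩ := hsurj _ ((hmS (m * (-i))).1 (dvd_mul_right m _) (hLY y))
      rw [ih y y'' hy'']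
      refine (Quot.sound ((hLm y' y'').2 ?_)).symm
      rw [hy, hy'', tau_tau]
      congr 1; ring
  rw [← hrange]
  refine nonempty_homeomorph_quot hfc hfo ?_ ?_
  · intro y y' hyy'
    rw [(hLm y y').1 hyy', sphereProj_expChart_tau]
  · intro y y' hyy'
    obtain ⟨k, hk⟩ := exists_tau_of_sphereProj_eq hyy'
    obtain ⟨j, rfl⟩ := (hmS k).2 (hmove k (L y) (hLY y) (hk ▸ hLY y'))
    exact hpow j y y' hk

end Mobius

theorem complement_of_separating_curve
    (Γ : Set RealProjectivePlane) (hΓ : IsSimpleClosedCurve Γ)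
    (C₁ C₂ : Set Sphere2) (hpre : sphereProj ⁻¹' Γ = C₁ ∪ C₂)
    (hdisj : Disjoint C₁ C₂)
    (h₁ : IsSimpleClosedCurve C₁) (h₂ : IsSimpleClosedCurve C₂) :
    ∃ U V : Set RealProjectivePlane,
      IsOpen U ∧ IsOpen V ∧ IsConnected U ∧ IsConnected V ∧
      Disjoint U V ∧ U ∪ V = Γᶜ ∧
      Nonempty (U ≃ₜ OpenDisk) ∧ Nonempty (V ≃ₜ OpenMobius) ∧
      frontier U = Γ ∧ frontier V = Γ := by
  have hσ : antipodal ⁻¹' C₁ = C₂ := preimage_antipodal_of_lift (isConnected_of_curve hΓ) hpre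
    hdisj (isConnected_of_curve h₁) (isConnected_of_curve h₂) (isCompact_of_curve h₁).isClosed
    (isCompact_of_curve h₂).isClosed
  subst hσ
  obtain ⟨D, h⟩ := exists_capDecomposition h₁ hdisj
  have hC := nonempty_of_curve h₁
  have hinj := surjective_sphereProj.preimage_injective
  refine ⟨sphereProj '' D, sphereProj '' CapDecomposition.between D,
    isOpenMap_sphereProj _ h.isOpen, isOpenMap_sphereProj _ (CapDecomposition.isOpen_between D),
    h.isConnected.image _ continuous_sphereProj.continuousOn,
    h.isConnected_between.image _ continuous_sphereProj.continuousOn, ?_, ?_,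
    h.nonempty_homeomorph_disk hC, h.nonempty_homeomorph_mobius hC, ?_, ?_⟩
  · rw [disjoint_left]
    rintro _ ⟨x, hx, rfl⟩ hx'
    rw [← mem_preimage, CapDecomposition.preimage_image_between] at hx'
    exact hx' (Or.inl (subset_closure hx))
  · apply hinj
    rw [preimage_union, preimage_image_sphereProj, CapDecomposition.preimage_image_between,
      preimage_compl, hpre, h.compl_curves]
  · apply hinj
    rw [CapDecomposition.preimage_frontier, preimage_image_sphereProj, h.frontier_caps, hpre]
  · apply hinj
    rw [CapDecomposition.preimage_frontier, CapDecomposition.preimage_image_between,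
      h.frontier_between, hpre]

end ProjSep

/-- If a simple closed curve `Γ ⊆ ℝP²` has preimage under
`π : S² → ℝP²` a disjoint union of two simple closed curves, then `ℝP² \ Γ` has exactly
two connected components: one homeomorphic to an open disk, the other to an open
Möbius strip, and both have frontier `Γ`. -/
theorem complement_of_separating_curve_in_projective_plane
    (Γ : Set RealProjectivePlane) (hΓ : IsSimpleClosedCurve Γ)
    (C₁ C₂ : Set Sphere2) (hpre : sphereProj ⁻¹' Γ = C₁ ∪ C₂)
    (hdisj : Disjoint C₁ C₂)
    (h₁ : IsSimpleClosedCurve C₁) (h₂ : IsSimpleClosedCurve C₂) :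
    ∃ U V : Set RealProjectivePlane,
      IsOpen U ∧ IsOpen V ∧ IsConnected U ∧ IsConnected V ∧
      Disjoint U V ∧ U ∪ V = Γᶜ ∧
      Nonempty (U ≃ₜ OpenDisk) ∧ Nonempty (V ≃ₜ OpenMobius) ∧
      frontier U = Γ ∧ frontier V = Γ :=
  ProjSep.complement_of_separating_curve Γ hΓ C₁ C₂ hpre hdisj h₁ h₂
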